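/- Let n ≥ 1, let Ω ⊂ ℍⁿ be a non-empty bounded open set, let L : Ω × ℝ × ℝ²ⁿ → S^{2n×2n} be locally Lipschitz continuous and satisfy conditions (3.3), (3.4) and (3.5) (listed in the context) for some m > 1, let F[ψ] = ∇²_{H,s}ψ + L(·, ψ, ∇_H ψ), and let Σ be a non-empty open subset of S^{2n×2n} satisfying: (i) A ∈ Σ, B ∈ S^{2n×2n}, B positive definite imply A + B ∈ Σ; (ii) A ∈ Σ and c ∈ (0,1) imply cA ∈ Σ. If w ∈ LSC(Ω̄) and v ∈ USC(Ω̄) are respectively a viscosity supersolution and a viscosity subsolution of F[ψ] ∈ ∂Σ in Ω, and if w ≥ v in Ω and w > v on ∂Ω, then w > v in Ω. -/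

import Mathlib

open Filter Topology Matrix Asymptotics

noncomputable section

/-- Points of the Heisenberg group `ℍⁿ`: `(x, y, t) ∈ ℝⁿ × ℝⁿ × ℝ`. -/
abbrev Heis (n : ℕ) : Type := (Fin n → ℝ) × (Fin n → ℝ) × ℝ

/-- Index type for the `2n` horizontal directions. -/
abbrev HIdx (n : ℕ) : Type := Fin n ⊕ Fin n

/-- `2n × 2n` real matrices. -/
abbrev HMat (n : ℕ) : Type := Matrix (HIdx n) (HIdx n) ℝ

namespace Heis

variable {n : ℕ}

/-- The Heisenberg group law. -/
def hmul (ξ η : Heis n) : Heis n :=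
  (ξ.1 + η.1, ξ.2.1 + η.2.1,
    ξ.2.2 + η.2.2 + 2 * ∑ i, (ξ.2.1 i * η.1 i - ξ.1 i * η.2.1 i))

/-- The group inverse `ξ⁻¹ = -ξ`. -/
def hinv (ξ : Heis n) : Heis n := (-ξ.1, -ξ.2.1, -ξ.2.2)

/-- `|z|²` for `ξ = (z, t)`. -/
def zsq (ξ : Heis n) : ℝ := ∑ i, (ξ.1 i ^ 2 + ξ.2.1 i ^ 2)

/-- The homogeneous norm `|ξ|_H = (|z|⁴ + t²)^{1/4}`. -/
def hnorm (ξ : Heis n) : ℝ := (zsq ξ ^ 2 + ξ.2.2 ^ 2) ^ ((1 : ℝ) / 4)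

/-- The left-invariant horizontal vector fields `X_j` (for `Sum.inl j`)
and `Y_j` (for `Sum.inr j`), as tangent vectors at `ξ`. -/
def vecField (j : HIdx n) (ξ : Heis n) : Heis n :=
  match j with
  | Sum.inl j => (Pi.single j 1, 0, 2 * ξ.2.1 j)
  | Sum.inr j => (0, Pi.single j 1, -(2 * ξ.1 j))

/-- Horizontal (Heisenberg) gradient `∇_H ψ (ξ) ∈ ℝ^{2n}`. -/
def hGrad (ψ : Heis n → ℝ) (ξ : Heis n) : HIdx n → ℝ :=
  fun j => fderiv ℝ ψ ξ (vecField j ξ)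

/-- Heisenberg Hessian: entry `(i, j)` is `(field j)((field i) ψ)(ξ)`. -/
def hHess (ψ : Heis n → ℝ) (ξ : Heis n) : HMat n :=
  Matrix.of fun i j =>
    fderiv ℝ (fun η => fderiv ℝ ψ η (vecField i η)) ξ (vecField j ξ)

/-- Symmetrized Heisenberg Hessian `∇²_{H,s} ψ`. -/
def hHessSym (ψ : Heis n → ℝ) (ξ : Heis n) : HMat n :=
  ((1 : ℝ) / 2) • (hHess ψ ξ + (hHess ψ ξ)ᵀ)

/-- The standard symplectic matrix `J = [[0, Iₙ], [-Iₙ, 0]]`. -/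
def Jmat (n : ℕ) : HMat n :=
  Matrix.of fun i j =>
    match i, j with
    | Sum.inl a, Sum.inr b => if a = b then (1 : ℝ) else 0
    | Sum.inr a, Sum.inl b => if a = b then (-1 : ℝ) else 0
    | _, _ => 0

/-- Euclidean norm of `p ∈ ℝ^{2n}`. -/
def pnorm (p : HIdx n → ℝ) : ℝ := Real.sqrt (∑ j, p j ^ 2)

/-- The Loewner (positive semidefinite) order on matrices. -/
def matLE (A B : HMat n) : Prop := (B - A).PosSemidef

/-- The operator `F[ψ] = ∇²_{H,s} ψ + L(·, ψ, ∇_H ψ)`. -/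
def Fop (L : Heis n → ℝ → (HIdx n → ℝ) → HMat n) (ψ : Heis n → ℝ) (ξ : Heis n) : HMat n :=
  hHessSym ψ ξ + L ξ (ψ ξ) (hGrad ψ ξ)

/-- Viscosity subsolution of `F[ψ] ∈ ∂Σ` in `Ω`: `F[ψ] ∈ closure Σ`
in the viscosity sense. -/
def IsSubsolution (Ω : Set (Heis n)) (L : Heis n → ℝ → (HIdx n → ℝ) → HMat n)
    (S : Set (HMat n)) (v : Heis n → EReal) : Prop :=
  ∀ ξ₀ ∈ Ω, ∀ φ : Heis n → ℝ, ContDiffOn ℝ 2 φ Ω → v ξ₀ = ((φ ξ₀ : ℝ) : EReal) →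
    (∀ᶠ η in nhds ξ₀, η ∈ Ω → v η ≤ ((φ η : ℝ) : EReal)) →
    Fop L φ ξ₀ ∈ closure S

/-- Viscosity supersolution of `F[ψ] ∈ ∂Σ` in `Ω`: `F[ψ] ∈ S^{2n×2n} ∖ Σ`
in the viscosity sense. -/
def IsSupersolution (Ω : Set (Heis n)) (L : Heis n → ℝ → (HIdx n → ℝ) → HMat n)
    (S : Set (HMat n)) (w : Heis n → EReal) : Prop :=
  ∀ ξ₀ ∈ Ω, ∀ φ : Heis n → ℝ, ContDiffOn ℝ 2 φ Ω → w ξ₀ = ((φ ξ₀ : ℝ) : EReal) →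
    (∀ᶠ η in nhds ξ₀, η ∈ Ω → ((φ η : ℝ) : EReal) ≤ w η) →
    Fop L φ ξ₀ ∉ S

/-- The class `USC(s)`: upper semicontinuous, valued in `ℝ ∪ {-∞}`, not identically `-∞`. -/
def USCFun (s : Set (Heis n)) (v : Heis n → EReal) : Prop :=
  UpperSemicontinuousOn v s ∧ (∀ ξ ∈ s, v ξ ≠ ⊤) ∧ (∃ ξ ∈ s, v ξ ≠ ⊥)

/-- The class `LSC(s)`: lower semicontinuous, valued in `ℝ ∪ {+∞}`, not identically `+∞`. -/
def LSCFun (s : Set (Heis n)) (w : Heis n → EReal) : Prop :=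
  LowerSemicontinuousOn w s ∧ (∀ ξ ∈ s, w ξ ≠ ⊥) ∧ (∃ ξ ∈ s, w ξ ≠ ⊤)

/-- `Σ` is (relatively) open as a subset of the space of symmetric matrices. -/
def RelOpen (S : Set (HMat n)) : Prop :=
  IsOpen {A : {M : HMat n // M.IsSymm} | A.1 ∈ S}

/-- The quadratic lower-order term
`L(ξ,s,p) = α(ξ,s) p⊗p - γ(ξ,s) Jp⊗Jp - β(ξ,s)|p|² I₂ₙ`. -/
def Lquad (α β γ : Heis n → ℝ → ℝ) : Heis n → ℝ → (HIdx n → ℝ) → HMat n :=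
  fun ξ s p =>
    α ξ s • vecMulVec p p - γ ξ s • vecMulVec (Jmat n *ᵥ p) (Jmat n *ᵥ p)
      - (β ξ s * ∑ j, p j ^ 2) • (1 : HMat n)

/-- The quadratic lower-order term with constant coefficients
`L(s,p) = a p⊗p - c Jp⊗Jp - b|p|² I₂ₙ`. -/
def LquadC (a b c : ℝ) : Heis n → ℝ → (HIdx n → ℝ) → HMat n :=
  fun _ _ p =>
    a • vecMulVec p p - c • vecMulVec (Jmat n *ᵥ p) (Jmat n *ᵥ p)
      - (b * ∑ j, p j ^ 2) • (1 : HMat n)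

/-- Locally Lipschitz on a set. -/
def LocallyLipschitzOnSet {X : Type*} [PseudoMetricSpace X] (s : Set X) (f : X → ℝ) : Prop :=
  ∀ x ∈ s, ∃ K : NNReal, ∃ t ∈ nhdsWithin x s, LipschitzOnWith K f t

/-- All entries of `L(ξ,s,·)` are differentiable at `p`. -/
def DiffInP (L : Heis n → ℝ → (HIdx n → ℝ) → HMat n) (ξ : Heis n) (s : ℝ)
    (p : HIdx n → ℝ) : Prop :=
  ∀ i j, DifferentiableAt ℝ (fun q => L ξ s q i j) p

/-- All entries of `L(·,s,p)` are differentiable at `ξ`. -/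
def DiffInXi (L : Heis n → ℝ → (HIdx n → ℝ) → HMat n) (ξ : Heis n) (s : ℝ)
    (p : HIdx n → ℝ) : Prop :=
  ∀ i j, DifferentiableAt ℝ (fun η => L η s p i j) ξ

/-- A norm of `∇_p L(ξ,s,p)`. -/
def pGradNorm (L : Heis n → ℝ → (HIdx n → ℝ) → HMat n) (ξ : Heis n) (s : ℝ)
    (p : HIdx n → ℝ) : ℝ :=
  Real.sqrt (∑ i, ∑ j, ∑ k, (fderiv ℝ (fun q => L ξ s q i j) p (Pi.single k 1)) ^ 2)

/-- A norm of `∇_ξ L(ξ,s,p)`. -/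
def xiGradNorm (L : Heis n → ℝ → (HIdx n → ℝ) → HMat n) (ξ : Heis n) (s : ℝ)
    (p : HIdx n → ℝ) : ℝ :=
  Real.sqrt (∑ i : HIdx n, ∑ j : HIdx n, ‖fderiv ℝ (fun η => L η s p i j) ξ‖ ^ 2)

/-- The matrix `p · ∇_p L(ξ,s,p)`. -/
def pDotGradL (L : Heis n → ℝ → (HIdx n → ℝ) → HMat n) (ξ : Heis n) (s : ℝ)
    (p : HIdx n → ℝ) : HMat n :=
  Matrix.of fun i j => fderiv ℝ (fun q => L ξ s q i j) p p

/-- Structural condition (3.3): `|∇_ξ L(ξ,s,p)| ≤ C|p|^m` and `|∇_p L(ξ,s,p)| ≤ C|p|`. -/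
def Cond33 (Ω : Set (Heis n)) (L : Heis n → ℝ → (HIdx n → ℝ) → HMat n) (m : ℝ) : Prop :=
  ∀ R : ℝ, 0 < R → ∃ C : ℝ, 0 < C ∧ ∀ ξ ∈ Ω, ∀ s : ℝ, |s| ≤ R → ∀ p : HIdx n → ℝ,
    (DiffInXi L ξ s p → xiGradNorm L ξ s p ≤ C * pnorm p ^ m) ∧
    (DiffInP L ξ s p → pGradNorm L ξ s p ≤ C * pnorm p)

/-- Structural condition (3.4): `0 ≤ L(ξ,s',p) - L(ξ,s,p) ≤ C(s'-s)|p|^m I₂ₙ`. -/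
def Cond34 (Ω : Set (Heis n)) (L : Heis n → ℝ → (HIdx n → ℝ) → HMat n) (m : ℝ) : Prop :=
  ∀ R : ℝ, 0 < R → ∃ C : ℝ, 0 < C ∧ ∀ ξ ∈ Ω, ∀ s s' : ℝ, -R ≤ s → s ≤ s' → s' ≤ R →
    ∀ p : HIdx n → ℝ,
      matLE 0 (L ξ s' p - L ξ s p) ∧
      matLE (L ξ s' p - L ξ s p) ((C * (s' - s) * pnorm p ^ m) • (1 : HMat n))

/-- The second inequality of condition (3.4): `L(ξ,s',p) - L(ξ,s,p) ≤ C(s'-s)|p|^m I₂ₙ`. -/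
def Cond34Upper (Ω : Set (Heis n)) (L : Heis n → ℝ → (HIdx n → ℝ) → HMat n) (m : ℝ) : Prop :=
  ∀ R : ℝ, 0 < R → ∃ C : ℝ, 0 < C ∧ ∀ ξ ∈ Ω, ∀ s s' : ℝ, -R ≤ s → s ≤ s' → s' ≤ R →
    ∀ p : HIdx n → ℝ,
      matLE (L ξ s' p - L ξ s p) ((C * (s' - s) * pnorm p ^ m) • (1 : HMat n))

/-- Structural condition (3.5). -/
def Cond35 (Ω : Set (Heis n)) (L : Heis n → ℝ → (HIdx n → ℝ) → HMat n) (m : ℝ) : Prop :=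
  ∀ R : ℝ, 0 < R → ∀ Λ : ℝ, 0 < Λ → ∃ θb : ℝ, 0 < θb ∧ ∃ C : ℝ, 0 < C ∧
    ∀ θ : ℝ, 0 ≤ θ → θ ≤ θb → ∀ ξ ∈ Ω, ∀ s : ℝ, |s| ≤ R → ∀ p : HIdx n → ℝ,
      DiffInP L ξ s p →
      matLE (pDotGradL L ξ s p - L ξ s p + (θ * Λ * pGradNorm L ξ s p) • (1 : HMat n)
              - θ • (1 : HMat n))
            (C • vecMulVec p p - ((1 / C) * pnorm p ^ m) • (1 : HMat n))

/-- Structural condition (3.7). -/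
def Cond37 (Ω : Set (Heis n)) (L : Heis n → ℝ → (HIdx n → ℝ) → HMat n) (m : ℝ) : Prop :=
  ∀ R : ℝ, 0 < R → ∀ Λ : ℝ, 0 < Λ → ∃ θb : ℝ, 0 < θb ∧ ∃ C : ℝ, 0 < C ∧
    ∀ θ : ℝ, 0 < θ → θ ≤ θb → ∀ ξ ∈ Ω, ∀ s : ℝ, |s| ≤ R → ∀ p : HIdx n → ℝ,
      DiffInP L ξ s p →
      matLE ((-C) • vecMulVec p p + ((1 / C) * pnorm p ^ m) • (1 : HMat n))
            (pDotGradL L ξ s p - L ξ s p - (θ * Λ * pGradNorm L ξ s p) • (1 : HMat n)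
              + θ • (1 : HMat n))

/-- `P` is a second-order Taylor witness for `u` at `ξ`: `u` is punctually second order
differentiable at `ξ` with expansion given by the `C²` function `P`. -/
def PunctualWitness (u P : Heis n → ℝ) (ξ : Heis n) : Prop :=
  ContDiff ℝ 2 P ∧ P ξ = u ξ ∧
    (fun η => u η - P η) =o[nhds ξ] (fun η => ‖η - ξ‖ ^ 2)

/-- The `ε`-lower envelope `w_ε`. -/
def lowerEnv (Ω : Set (Heis n)) (w : Heis n → EReal) (ε : ℝ) (ξ : Heis n) : EReal :=
  ⨅ η ∈ closure Ω, (w η + (((1 / ε) * hnorm (hmul (hinv η) ξ) ^ 4 : ℝ) : EReal))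

/-- The `ε`-upper envelope `v^ε`. -/
def upperEnv (Ω : Set (Heis n)) (v : Heis n → EReal) (ε : ℝ) (ξ : Heis n) : EReal :=
  ⨆ η ∈ closure Ω, (v η - (((1 / ε) * hnorm (hmul (hinv η) ξ) ^ 4 : ℝ) : EReal))

/-- The `ε`-lower envelope, as a real valued function. -/
def lowerEnvR (Ω : Set (Heis n)) (w : Heis n → EReal) (ε : ℝ) (ξ : Heis n) : ℝ :=
  (lowerEnv Ω w ε ξ).toReal

/-- The `ε`-upper envelope, as a real valued function. -/
def upperEnvR (Ω : Set (Heis n)) (v : Heis n → EReal) (ε : ℝ) (ξ : Heis n) : ℝ :=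
  (upperEnv Ω v ε ξ).toReal

/-- The lower semicontinuous envelope `g_*` relative to `O`. -/
def lscEnv (O : Set (Heis n)) (g : Heis n → EReal) (ξ : Heis n) : EReal :=
  ⨆ (r : ℝ) (_ : 0 < r), ⨅ η ∈ O ∩ Metric.ball ξ r, g η

/-- The upper semicontinuous envelope `g^*` relative to `O`. -/
def uscEnv (O : Set (Heis n)) (g : Heis n → EReal) (ξ : Heis n) : EReal :=
  ⨅ (r : ℝ) (_ : 0 < r), ⨆ η ∈ O ∩ Metric.ball ξ r, g η

end Heis

open Heis

/-! ### Alexandrov theorem for functions with subgradients everywhere -/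
section Alexandrov

variable {E : Type*} [NormedAddCommGroup E] [InnerProductSpace ℝ E] [FiniteDimensional ℝ E]

/-- `f` has a subgradient at every point. -/
def HasSub (f : E → ℝ) : Prop := ∀ x, ∃ p : E, ∀ z, f x + inner ℝ p (z - x) ≤ f z

lemma HasSub.convexOn {f : E → ℝ} (hf : HasSub f) : ConvexOn ℝ Set.univ f := by
  refine ⟨convex_univ, ?_⟩
  intro x _ y _ a b ha hb hab
  obtain ⟨p, hp⟩ := hf (a • x + b • y)
  have h1 := mul_le_mul_of_nonneg_left (hp x) ha
  have h2 := mul_le_mul_of_nonneg_left (hp y) hb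
  have h3 : a * inner ℝ p (x - (a • x + b • y)) + b * inner ℝ p (y - (a • x + b • y)) = 0 := by
    rw [← real_inner_smul_right, ← real_inner_smul_right, ← inner_add_right]
    have : a • (x - (a • x + b • y)) + b • (y - (a • x + b • y)) = 0 := by
      have : b = 1 - a := by linarith
      subst this
      module
    rw [this, inner_zero_right]
  simp only [smul_eq_mul]
  have h4 : f (a • x + b • y) = a * f (a • x + b • y) + b * f (a • x + b • y) := by
    rw [← add_mul, hab, one_mul]
  nlinarith

lemma HasSub.continuous {f : E → ℝ} (hf : HasSub f) : Continuous f :=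
  hf.convexOn.locallyLipschitz.continuous

lemma HasSub.exists_prox {f : E → ℝ} (hf : HasSub f) (y : E) :
    ∃ x, ∀ z, f x + inner ℝ (y - x) (z - x) ≤ f z := by
  have hc := hf.continuous
  obtain ⟨p, hp⟩ := hf y
  have hg : Continuous (fun x => f x + ‖x - y‖ ^ 2 / 2) := by fun_prop
  obtain ⟨x, hx⟩ := hg.exists_forall_le' y (by
    have : ∀ᶠ x in cocompact E, x ∉ Metric.closedBall y (2 * ‖p‖) :=
      (isCompact_closedBall y (2 * ‖p‖)).compl_mem_cocompact
    filter_upwards [this] with x hx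
    rw [Metric.mem_closedBall, dist_eq_norm, not_le] at hx
    have h1 := hp x
    have h2 := abs_real_inner_le_norm p (x - y)
    have h3 := neg_abs_le (inner ℝ p (x - y))
    simp only [sub_self, norm_zero]
    nlinarith [norm_nonneg p, norm_nonneg (x - y)])
  refine ⟨x, fun z => ?_⟩
  by_contra hcon
  push Not at hcon
  have key : ∀ t : ℝ, 0 < t → t ≤ 1 →
      f x + inner ℝ (y - x) (z - x) - f z ≤ t * ‖z - x‖ ^ 2 := by
    intro t ht ht1
    have h1 := hx (x + t • (z - x))
    have h2 := hf.convexOn.2 (Set.mem_univ x) (Set.mem_univ z) (by linarith : 0 ≤ 1 - t) ht.le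
      (by ring)
    have h3 : (1 - t) • x + t • z = x + t • (z - x) := by module
    rw [h3] at h2
    simp only [smul_eq_mul] at h2
    have h4 : ‖x + t • (z - x) - y‖ ^ 2
        = ‖x - y‖ ^ 2 + 2 * t * inner ℝ (x - y) (z - x) + t ^ 2 * ‖z - x‖ ^ 2 := by
      have : x + t • (z - x) - y = (x - y) + t • (z - x) := by module
      rw [this, norm_add_sq_real, inner_smul_right, norm_smul, mul_pow, Real.norm_eq_abs, sq_abs]
      ring
    have h5 : inner ℝ (y - x) (z - x) = - inner ℝ (x - y) (z - x) := by
      rw [← inner_neg_left]; simp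
    simp only [h4] at h1
    have h6 : 0 ≤ t * (f z - f x + inner ℝ (x - y) (z - x) + t * ‖z - x‖ ^ 2 ) := by
      nlinarith [mul_nonneg (sq_nonneg t) (sq_nonneg ‖z - x‖)]
    have h7 := nonneg_of_mul_nonneg_right h6 ht
    rw [h5]; linarith
  set D := f x + inner ℝ (y - x) (z - x) - f z with hD
  have hDpos : 0 < D := by linarith
  have hn := sq_nonneg ‖z - x‖
  have h1 := key (min 1 (D / (2 * (‖z - x‖ ^ 2 + 1)))) (by positivity) (min_le_left _ _)
  have h2 : min 1 (D / (2 * (‖z - x‖ ^ 2 + 1))) * ‖z - x‖ ^ 2 ≤ D / 2 := by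
    calc _ ≤ (D / (2 * (‖z - x‖ ^ 2 + 1))) * (‖z - x‖ ^ 2 + 1) := by
          gcongr
          · exact min_le_right _ _
          · linarith
      _ = D / 2 := by field_simp
  linarith

/-- Second order expansion of `f` at `x`. -/
def TwiceAt (f : E → ℝ) (x : E) : Prop :=
  ∃ (p : E) (B : E →L[ℝ] E), ∀ ε > 0, ∀ᶠ z in 𝓝 x,
    |f z - f x - inner ℝ p (z - x) - (1 / 2) * inner ℝ (B (z - x)) (z - x)| ≤ ε * ‖z - x‖ ^ 2

lemma taylor_of_subgrad {f : E → ℝ} (hf : HasSub f) {x p0 : E} {B : E →L[ℝ] E}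
    (H : ∀ ε > 0, ∃ r > 0, ∀ z p : E, ‖z - x‖ < r → (∀ z', f z + inner ℝ p (z' - z) ≤ f z') →
      ‖p - p0 - B (z - x)‖ ≤ ε * ‖z - x‖) : TwiceAt f x := by
  refine ⟨p0, B, fun ε hε => ?_⟩
  obtain ⟨r, hr, hH⟩ := H (ε / 2) (by positivity)
  filter_upwards [Metric.ball_mem_nhds x hr] with z hz
  rw [Metric.mem_ball, dist_eq_norm] at hz
  obtain ⟨N, hN⟩ := exists_nat_gt (‖B‖ / ε)
  set h := z - x with hh
  have hN0 : (0 : ℝ) < N := lt_of_le_of_lt (by positivity) hN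
  have hBN : ‖B‖ ≤ ε * N := by
    rw [div_lt_iff₀ hε] at hN; linarith
  choose P hP using hf
  have hseg : ∀ i : ℕ, i ≤ N → |inner ℝ (P (x + ((i : ℝ) / N) • h)) h
      - inner ℝ p0 h - ((i : ℝ) / N) * inner ℝ (B h) h| ≤ ε / 2 * ‖h‖ ^ 2 := by
    intro i hi
    have hiN : (i : ℝ) / N ≤ 1 := by
      rw [div_le_one hN0]; exact_mod_cast hi
    have hi0 : 0 ≤ (i : ℝ) / N := by positivity
    have hsub : x + ((i : ℝ) / N) • h - x = ((i : ℝ) / N) • h := by abel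
    have hle : ‖((i : ℝ) / N) • h‖ ≤ ‖h‖ := by
      rw [norm_smul, Real.norm_of_nonneg hi0]
      exact mul_le_of_le_one_left (norm_nonneg _) hiN
    have h1 := hH (x + ((i : ℝ) / N) • h) (P (x + ((i : ℝ) / N) • h))
      (by rw [hsub]; exact lt_of_le_of_lt hle hz) (hP _)
    rw [hsub] at h1
    have h2 : inner ℝ (P (x + ((i : ℝ) / N) • h)) h - inner ℝ p0 h
        - ((i : ℝ) / N) * inner ℝ (B h) h
        = inner ℝ (P (x + ((i : ℝ) / N) • h) - p0 - B (((i : ℝ) / N) • h)) h := by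
      rw [inner_sub_left, inner_sub_left, map_smul, real_inner_smul_left]
    rw [h2]
    calc _ ≤ ‖P (x + ((i : ℝ) / N) • h) - p0 - B (((i : ℝ) / N) • h)‖ * ‖h‖ :=
          abs_real_inner_le_norm _ _
      _ ≤ (ε / 2 * ‖h‖) * ‖h‖ := by
          gcongr
          exact h1.trans (by gcongr)
      _ = _ := by ring
  have hstep : ∀ i : ℕ, f (x + (((i + 1 : ℕ) : ℝ) / N) • h) - f (x + ((i : ℝ) / N) • h)
        ≤ (1 / N) * inner ℝ (P (x + (((i + 1 : ℕ) : ℝ) / N) • h)) h ∧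
      (1 / N) * inner ℝ (P (x + ((i : ℝ) / N) • h)) h ≤
        f (x + (((i + 1 : ℕ) : ℝ) / N) • h) - f (x + ((i : ℝ) / N) • h) := by
    intro i
    have h1 := hP (x + (((i + 1 : ℕ) : ℝ) / N) • h) (x + ((i : ℝ) / N) • h)
    have h2 := hP (x + ((i : ℝ) / N) • h) (x + (((i + 1 : ℕ) : ℝ) / N) • h)
    have e1 : x + ((i : ℝ) / N) • h - (x + (((i + 1 : ℕ) : ℝ) / N) • h) = (-(1 / N : ℝ)) • h := by
      push_cast
      have : ((i : ℝ) + 1) / N = i / N + 1 / N := by ring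
      rw [this]; module
    have e2 : x + (((i + 1 : ℕ) : ℝ) / N) • h - (x + ((i : ℝ) / N) • h) = (1 / N : ℝ) • h := by
      push_cast
      have : ((i : ℝ) + 1) / N = i / N + 1 / N := by ring
      rw [this]; module
    rw [e1, real_inner_smul_right] at h1
    rw [e2, real_inner_smul_right] at h2
    constructor <;> linarith
  have hind : ∀ i : ℕ, i ≤ N →
      f (x + ((i : ℝ) / N) • h) - f x ≤ ((i : ℝ) / N) * (inner ℝ p0 h + ε / 2 * ‖h‖ ^ 2)
        + ((i : ℝ) * (i + 1) / (2 * N ^ 2)) * inner ℝ (B h) h ∧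
      ((i : ℝ) / N) * (inner ℝ p0 h - ε / 2 * ‖h‖ ^ 2)
        + ((i : ℝ) * (i - 1) / (2 * N ^ 2)) * inner ℝ (B h) h ≤ f (x + ((i : ℝ) / N) • h) - f x := by
    intro i
    induction i with
    | zero => intro _; simp
    | succ i ih =>
      intro hi
      obtain ⟨i1, i2⟩ := ih (by omega)
      obtain ⟨s1, s2⟩ := hstep i
      have a1 := (abs_le.1 (hseg (i + 1) hi)).2
      have a2 := (abs_le.1 (hseg i (by omega))).1
      have b1 : (1 / N : ℝ) * inner ℝ (P (x + (((i + 1 : ℕ) : ℝ) / N) • h)) h ≤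
          (1 / N : ℝ) * (inner ℝ p0 h + (((i + 1 : ℕ) : ℝ) / N) * inner ℝ (B h) h
            + ε / 2 * ‖h‖ ^ 2) := by
        gcongr; linarith
      have b2 : (1 / N : ℝ) * (inner ℝ p0 h + ((i : ℝ) / N) * inner ℝ (B h) h
            - ε / 2 * ‖h‖ ^ 2) ≤ (1 / N : ℝ) * inner ℝ (P (x + ((i : ℝ) / N) • h)) h := by
        gcongr; linarith
      constructor
      · have : (((i + 1 : ℕ) : ℝ) / N) * (inner ℝ p0 h + ε / 2 * ‖h‖ ^ 2)
            + (((i + 1 : ℕ) : ℝ) * (((i + 1 : ℕ) : ℝ) + 1) / (2 * N ^ 2)) * inner ℝ (B h) h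
            = ((i : ℝ) / N) * (inner ℝ p0 h + ε / 2 * ‖h‖ ^ 2)
            + ((i : ℝ) * (i + 1) / (2 * N ^ 2)) * inner ℝ (B h) h +
            (1 / N : ℝ) * (inner ℝ p0 h + (((i + 1 : ℕ) : ℝ) / N) * inner ℝ (B h) h
            + ε / 2 * ‖h‖ ^ 2) := by
          push_cast; field_simp; ring
        rw [this]; linarith
      · have : (((i + 1 : ℕ) : ℝ) / N) * (inner ℝ p0 h - ε / 2 * ‖h‖ ^ 2)
            + (((i + 1 : ℕ) : ℝ) * (((i + 1 : ℕ) : ℝ) - 1) / (2 * N ^ 2)) * inner ℝ (B h) h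
            = ((i : ℝ) / N) * (inner ℝ p0 h - ε / 2 * ‖h‖ ^ 2)
            + ((i : ℝ) * (i - 1) / (2 * N ^ 2)) * inner ℝ (B h) h +
            (1 / N : ℝ) * (inner ℝ p0 h + ((i : ℝ) / N) * inner ℝ (B h) h
            - ε / 2 * ‖h‖ ^ 2) := by
          push_cast; field_simp; ring
        rw [this]; linarith
  obtain ⟨u1, u2⟩ := hind N le_rfl
  have hNN : (N : ℝ) / N = 1 := div_self hN0.ne'
  have hz' : x + ((N : ℝ) / N) • h = z := by rw [hNN, one_smul, hh]; abel
  rw [hz', hNN] at u1 u2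
  have c1 : ((N : ℝ) * (N + 1) / (2 * N ^ 2)) = 1 / 2 + 1 / (2 * N) := by field_simp
  have c2 : ((N : ℝ) * (N - 1) / (2 * N ^ 2)) = 1 / 2 - 1 / (2 * N) := by field_simp
  rw [c1] at u1
  rw [c2] at u2
  have hB : |inner ℝ (B h) h| ≤ ε * N * ‖h‖ ^ 2 := by
    calc _ ≤ ‖B h‖ * ‖h‖ := abs_real_inner_le_norm _ _
      _ ≤ (‖B‖ * ‖h‖) * ‖h‖ := by gcongr; exact B.le_opNorm h
      _ = ‖B‖ * ‖h‖ ^ 2 := by ring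
      _ ≤ _ := by gcongr
  have hB2 : |1 / (2 * N) * inner ℝ (B h) h| ≤ ε / 2 * ‖h‖ ^ 2 := by
    rw [abs_mul, abs_of_nonneg (by positivity : (0:ℝ) ≤ 1 / (2 * N))]
    calc _ ≤ 1 / (2 * N) * (ε * N * ‖h‖ ^ 2) := by gcongr
      _ = _ := by field_simp
  have := abs_le.1 hB2
  rw [abs_le]
  constructor <;> nlinarith [this.1, this.2]

lemma twiceAt_of_prox {f : E → ℝ} (hf : HasSub f) {J : E → E}
    (hJ : ∀ y z, f (J y) + inner ℝ (y - J y) (z - J y) ≤ f z)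
    {y : E} {T : E →L[ℝ] E} (hT : HasFDerivAt J T y) (hdet : T.det ≠ 0) : TwiceAt f (J y) := by
  -- firm nonexpansiveness
  have mono : ∀ a b : E, ‖J a - J b‖ ^ 2 ≤ inner ℝ (a - b) (J a - J b) := by
    intro a b
    have h1 := hJ a (J b)
    have h2 := hJ b (J a)
    have e1 : inner ℝ (a - J a) (J b - J a) = - inner ℝ (a - J a) (J a - J b) := by
      rw [← inner_neg_right]; simp
    rw [e1] at h1
    have e2 : inner ℝ (a - b) (J a - J b) = inner ℝ (a - J a) (J a - J b)
        - inner ℝ (b - J b) (J a - J b) + inner ℝ (J a - J b) (J a - J b) := by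
      rw [← inner_sub_left, ← inner_add_left]; congr 1; abel
    rw [e2, real_inner_self_eq_norm_sq]; linarith
  have inv : ∀ z p : E, (∀ z', f z + inner ℝ p (z' - z) ≤ f z') → J (z + p) = z := by
    intro z p hp
    have h1 := hp (J (z + p))
    have h2 := hJ (z + p) z
    have e2 : inner ℝ (z + p - J (z + p)) (z - J (z + p)) = ‖z - J (z + p)‖ ^ 2
        - inner ℝ p (J (z + p) - z) := by
      rw [← real_inner_self_eq_norm_sq, ← neg_sub z (J (z + p)), inner_neg_right, sub_neg_eq_add,
        ← inner_add_left]; congr 1; abel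
    rw [e2] at h2
    have : ‖z - J (z + p)‖ ^ 2 ≤ 0 := by linarith
    have h3 : ‖z - J (z + p)‖ = 0 := by
      have := sq_nonneg ‖z - J (z + p)‖
      exact pow_eq_zero_iff (two_ne_zero) |>.1 (by linarith)
    rw [norm_eq_zero, sub_eq_zero] at h3
    exact h3.symm
  have hTmono : ∀ k : E, ‖T k‖ ^ 2 ≤ inner ℝ k (T k) := by
    intro k
    have ht := (hT.hasLineDerivAt k).tendsto_slope_zero
    have l1 : Tendsto (fun t : ℝ => ‖t⁻¹ • (J (y + t • k) - J y)‖ ^ 2) (𝓝[≠] 0) (𝓝 (‖T k‖ ^ 2)) :=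
      (ht.norm).pow 2
    have l2 : Tendsto (fun t : ℝ => inner ℝ k (t⁻¹ • (J (y + t • k) - J y))) (𝓝[≠] 0)
        (𝓝 (inner ℝ k (T k))) := tendsto_const_nhds.inner ht
    refine le_of_tendsto_of_tendsto l1 l2 ?_
    filter_upwards [self_mem_nhdsWithin] with t ht0
    have ht0' : t ≠ 0 := ht0
    have h1 := mono (y + t • k) y
    rw [add_sub_cancel_left, real_inner_smul_left] at h1
    rw [norm_smul, mul_pow, real_inner_smul_right, norm_inv, Real.norm_eq_abs, inv_pow, sq_abs]
    calc _ ≤ (t ^ 2)⁻¹ * (t * inner ℝ k (J (y + t • k) - J y)) := by gcongr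
      _ = _ := by field_simp
  let T' := T.toContinuousLinearEquivOfDetNeZero hdet
  let S : E →L[ℝ] E := T'.symm
  have hST : ∀ k, S (T k) = k := fun k => T'.symm_apply_apply k
  set M := ‖S‖ + 1 with hM
  have hMpos : 0 < M := by positivity
  have hSM : ∀ k, ‖S k‖ ≤ M * ‖k‖ := fun k => (S.le_opNorm k).trans (by gcongr; linarith)
  have hTM : ∀ k, ‖k‖ ≤ M * ‖T k‖ := fun k => by
    have := hSM (T k); rwa [hST] at this
  have hTpos : ∀ k, ‖k‖ ^ 2 / M ^ 2 ≤ inner ℝ k (T k) := fun k => by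
    refine le_trans ?_ (hTmono k)
    rw [div_le_iff₀ (by positivity)]
    calc ‖k‖ ^ 2 ≤ (M * ‖T k‖) ^ 2 := by gcongr; exact hTM k
      _ = _ := by ring
  refine taylor_of_subgrad hf (p0 := y - J y) (B := S - ContinuousLinearMap.id ℝ E) ?_
  intro ε hε
  set η := min (ε / (2 * M ^ 2)) (min (1 / (2 * M ^ 2)) (1 / (2 * M))) with hη
  have hηpos : 0 < η := by positivity
  have hη1 : η ≤ ε / (2 * M ^ 2) := min_le_left _ _
  have hη2 : η ≤ 1 / (2 * M ^ 2) := (min_le_right _ _).trans (min_le_left _ _)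
  have hη3 : η ≤ 1 / (2 * M) := (min_le_right _ _).trans (min_le_right _ _)
  have hlo := (hasFDerivAt_iff_isLittleO_nhds_zero.1 hT).def hηpos
  obtain ⟨ρ0, hρ0, hρ⟩ := Metric.eventually_nhds_iff.1 hlo
  set ρ := ρ0 / 2 with hρdef
  have hρpos : 0 < ρ := by positivity
  have hρ' : ∀ k : E, ‖k‖ ≤ ρ → ‖J (y + k) - J y - T k‖ ≤ η * ‖k‖ := by
    intro k hk
    apply hρ
    rw [dist_zero_right]; linarith
  refine ⟨ρ / (2 * M ^ 2), by positivity, ?_⟩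
  intro z p hz hp
  set k := z + p - y with hk
  have hzk : J (y + k) = z := by rw [hk, add_sub_cancel]; exact inv z p hp
  have hgoal : p - (y - J y) - (S - ContinuousLinearMap.id ℝ E) (z - J y) = k - S (z - J y) := by
    simp only [_root_.sub_apply, ContinuousLinearMap.id_apply, hk]; abel
  rw [hgoal]
  by_cases hkρ : ‖k‖ ≤ ρ
  · have h1 := hρ' k hkρ
    rw [hzk] at h1
    have h2 : k - S (z - J y) = - S (z - J y - T k) := by
      rw [map_sub S (z - J y), hST]; abel
    have h3 : ‖k - S (z - J y)‖ ≤ M * (η * ‖k‖) := by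
      rw [h2, norm_neg]; exact (hSM _).trans (by gcongr)
    have h4 : ‖k‖ ≤ M * ‖z - J y‖ + M * (η * ‖k‖) := by
      have : k = S (z - J y) + (k - S (z - J y)) := by abel
      calc ‖k‖ = ‖S (z - J y) + (k - S (z - J y))‖ := by rw [← this]
        _ ≤ _ := (norm_add_le _ _).trans (add_le_add (hSM _) h3)
    have h5 : M * η ≤ 1 / 2 := by
      calc M * η ≤ M * (1 / (2 * M)) := by gcongr
        _ = 1 / 2 := by field_simp
    have h6 : ‖k‖ ≤ 2 * M * ‖z - J y‖ := by nlinarith [norm_nonneg k]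
    calc ‖k - S (z - J y)‖ ≤ M * (η * ‖k‖) := h3
      _ ≤ M * ((ε / (2 * M ^ 2)) * (2 * M * ‖z - J y‖)) := by gcongr
      _ = ε * ‖z - J y‖ := by field_simp
  · exfalso
    push Not at hkρ
    have hkpos : 0 < ‖k‖ := hρpos.trans hkρ
    set k' := (ρ / ‖k‖) • k with hk'
    have hk'n : ‖k'‖ = ρ := by
      rw [hk', norm_smul, Real.norm_of_nonneg (by positivity)]; field_simp
    have h1 := mono (y + k) (y + k')
    have h2 : y + k - (y + k') = (‖k‖ / ρ - 1) • k' := by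
      rw [hk', smul_smul, sub_mul, one_mul]
      have : ‖k‖ / ρ * (ρ / ‖k‖) = 1 := by field_simp
      rw [this]; module
    rw [h2, real_inner_smul_left] at h1
    have h3 : 0 < ‖k‖ / ρ - 1 := by
      rw [sub_pos, lt_div_iff₀ hρpos]; linarith
    have h4 : 0 ≤ inner ℝ k' (J (y + k) - J (y + k')) := by
      have : 0 ≤ (‖k‖ / ρ - 1) * inner ℝ k' (J (y + k) - J (y + k')) :=
        le_trans (sq_nonneg _) h1
      exact nonneg_of_mul_nonneg_right this h3
    have h5 := hρ' k' hk'n.le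
    have h6 : inner ℝ k' (J (y + k) - J y) = inner ℝ k' (J (y + k) - J (y + k'))
        + inner ℝ k' (J (y + k') - J y - T k') + inner ℝ k' (T k') := by
      rw [← inner_add_right, ← inner_add_right]; congr 1; abel
    have h7 : -(ρ * (η * ρ)) ≤ inner ℝ k' (J (y + k') - J y - T k') := by
      have a1 := abs_real_inner_le_norm k' (J (y + k') - J y - T k')
      have a2 := neg_abs_le (inner ℝ k' (J (y + k') - J y - T k'))
      have a3 : ‖k'‖ * ‖J (y + k') - J y - T k'‖ ≤ ρ * (η * ρ) := by
        rw [hk'n] at h5 ⊢; gcongr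
      linarith
    have h8 := hTpos k'
    rw [hk'n] at h8
    have h9 : inner ℝ k' (J (y + k) - J y) ≤ ρ * ‖z - J y‖ := by
      rw [hzk]
      calc _ ≤ ‖k'‖ * ‖z - J y‖ := real_inner_le_norm _ _
        _ = _ := by rw [hk'n]
    have h10 : ρ * (η * ρ) ≤ ρ ^ 2 / M ^ 2 / 2 := by
      calc ρ * (η * ρ) ≤ ρ * ((1 / (2 * M ^ 2)) * ρ) := by gcongr
        _ = _ := by field_simp
    have h11 : ρ * ‖z - J y‖ < ρ * (ρ / (2 * M ^ 2)) := by gcongr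
    have h12 : ρ * (ρ / (2 * M ^ 2)) = ρ ^ 2 / M ^ 2 / 2 := by field_simp
    linarith

open MeasureTheory in
lemma alexandrov [MeasurableSpace E] [BorelSpace E] {f : E → ℝ} (hf : HasSub f) :
    Measure.hausdorffMeasure (Module.finrank ℝ E : ℝ) {x : E | ¬ TwiceAt f x} = 0 := by
  choose J hJ using hf.exists_prox
  have mono : ∀ a b : E, ‖J a - J b‖ ^ 2 ≤ inner ℝ (a - b) (J a - J b) := by
    intro a b
    have h1 := hJ a (J b)
    have h2 := hJ b (J a)
    have e1 : inner ℝ (a - J a) (J b - J a) = - inner ℝ (a - J a) (J a - J b) := by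
      rw [← inner_neg_right]; simp
    rw [e1] at h1
    have e2 : inner ℝ (a - b) (J a - J b) = inner ℝ (a - J a) (J a - J b)
        - inner ℝ (b - J b) (J a - J b) + inner ℝ (J a - J b) (J a - J b) := by
      rw [← inner_sub_left, ← inner_add_left]; congr 1; abel
    rw [e2, real_inner_self_eq_norm_sq]; linarith
  have inv : ∀ z p : E, (∀ z', f z + inner ℝ p (z' - z) ≤ f z') → J (z + p) = z := by
    intro z p hp
    have h1 := hp (J (z + p))
    have h2 := hJ (z + p) z
    have e2 : inner ℝ (z + p - J (z + p)) (z - J (z + p)) = ‖z - J (z + p)‖ ^ 2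
        - inner ℝ p (J (z + p) - z) := by
      rw [← real_inner_self_eq_norm_sq, ← neg_sub z (J (z + p)), inner_neg_right, sub_neg_eq_add,
        ← inner_add_left]; congr 1; abel
    rw [e2] at h2
    have : ‖z - J (z + p)‖ ^ 2 ≤ 0 := by linarith
    have h3 : ‖z - J (z + p)‖ = 0 := by
      have := sq_nonneg ‖z - J (z + p)‖
      exact pow_eq_zero_iff (two_ne_zero) |>.1 (by linarith)
    rw [norm_eq_zero, sub_eq_zero] at h3
    exact h3.symm
  have hlip : LipschitzWith 1 J := by
    apply LipschitzWith.of_dist_le_mul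
    intro a b
    rw [dist_eq_norm, dist_eq_norm, NNReal.coe_one, one_mul]
    have h1 := mono a b
    have h2 := real_inner_le_norm (a - b) (J a - J b)
    by_contra hcon
    push Not at hcon
    nlinarith [norm_nonneg (a - b), norm_nonneg (J a - J b)]
  set μ : Measure E := Measure.hausdorffMeasure (Module.finrank ℝ E : ℝ) with hμ
  have hN : μ {y | ¬ DifferentiableAt ℝ J y} = 0 := hlip.ae_differentiableAt
  have hJN : μ (J '' {y | ¬ DifferentiableAt ℝ J y}) = 0 := by
    have := hlip.hausdorffMeasure_image_le (d := (Module.finrank ℝ E : ℝ)) (by positivity)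
      {y | ¬ DifferentiableAt ℝ J y}
    rw [← hμ, hN, mul_zero] at this
    exact le_antisymm this bot_le
  have hJZ : μ (J '' {y | DifferentiableAt ℝ J y ∧ (fderiv ℝ J y).det = 0}) = 0 :=
    addHaar_image_eq_zero_of_det_fderivWithin_eq_zero μ
      (f' := fun y => fderiv ℝ J y)
      (fun y hy => hy.1.hasFDerivAt.hasFDerivWithinAt) (fun y hy => hy.2)
  refine measure_mono_null ?_ (measure_union_null hJN hJZ)
  intro x hx
  obtain ⟨p, hp⟩ := hf x
  have hxJ := inv x p hp
  by_cases hd : DifferentiableAt ℝ J (x + p)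
  · right
    refine ⟨x + p, ⟨hd, ?_⟩, hxJ⟩
    by_contra hdet
    exact hx (hxJ ▸ twiceAt_of_prox hf hJ hd.hasFDerivAt hdet)
  · left
    exact ⟨x + p, hd, hxJ⟩

end Alexandrov

/-! ### A Jensen type lemma -/
section Jensen

/-- Semiconvexity, expressed through subgradients. -/
def SemiSub {V : Type*} [NormedAddCommGroup V] [NormedSpace ℝ V] (k : ℝ) (F : V → ℝ) : Prop :=
  ∀ x, ∃ p : V →L[ℝ] ℝ, ∀ z, F x + p (z - x) - k * ‖z - x‖ ^ 2 ≤ F z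

variable {E : Type*} [NormedAddCommGroup E] [InnerProductSpace ℝ E] [FiniteDimensional ℝ E]

lemma quad_nonpos {b : E} {C : E →L[ℝ] E}
    (H : ∀ᶠ h in 𝓝 (0 : E), inner ℝ b h + inner ℝ (C h) h ≤ 0) :
    b = 0 ∧ ∀ h, inner ℝ (C h) h ≤ 0 := by
  have H2 : ∀ h : E, ∀ᶠ t : ℝ in 𝓝 0, t * inner ℝ b h + t ^ 2 * inner ℝ (C h) h ≤ 0 := by
    intro h
    have : Tendsto (fun t : ℝ => t • h) (𝓝 0) (𝓝 0) := by
      have : Continuous (fun t : ℝ => t • h) := by fun_prop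
      simpa using this.tendsto 0
    filter_upwards [this.eventually H] with t ht
    rw [real_inner_smul_right, map_smul, real_inner_smul_left, real_inner_smul_right] at ht
    linarith
  have H3 : ∀ h : E, ∀ᶠ t : ℝ in 𝓝[>] 0, t * inner ℝ b h + t ^ 2 * inner ℝ (C h) h ≤ 0 ∧
      (-t) * inner ℝ b h + t ^ 2 * inner ℝ (C h) h ≤ 0 := by
    intro h
    have h1 := H2 h
    have h2 : ∀ᶠ t : ℝ in 𝓝 0, (-t) * inner ℝ b h + t ^ 2 * inner ℝ (C h) h ≤ 0 := by
      have : Tendsto (fun t : ℝ => -t) (𝓝 0) (𝓝 0) := by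
        simpa using (continuous_neg (G := ℝ)).tendsto 0
      filter_upwards [this.eventually h1] with t ht
      simpa using ht
    exact nhdsWithin_le_nhds (h1.and h2)
  constructor
  · have h1 : inner ℝ b b ≤ (0 : ℝ) := by
      have hl : Tendsto (fun t : ℝ => inner ℝ b b + t * inner ℝ (C b) b) (𝓝[>] 0)
          (𝓝 (inner ℝ b b + 0 * inner ℝ (C b) b)) := by
        apply Tendsto.mono_left _ nhdsWithin_le_nhds
        have : Continuous (fun t : ℝ => inner ℝ b b + t * inner ℝ (C b) b) := by fun_prop
        exact this.tendsto 0
      rw [zero_mul, add_zero] at hl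
      refine le_of_tendsto hl ?_
      filter_upwards [H3 b, self_mem_nhdsWithin] with t ht ht0
      have ht0' : 0 < t := ht0
      have : t * (inner ℝ b b + t * inner ℝ (C b) b) ≤ 0 := by nlinarith [ht.1]
      exact nonpos_of_mul_nonpos_right this ht0'
    rw [real_inner_self_eq_norm_sq] at h1
    have : ‖b‖ = 0 := by
      have := sq_nonneg ‖b‖
      exact pow_eq_zero_iff (two_ne_zero) |>.1 (by linarith)
    simpa using this
  · intro h
    obtain ⟨t, ht, ht0⟩ := ((H3 h).and self_mem_nhdsWithin).exists
    have ht0' : 0 < t := ht0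
    have : t ^ 2 * inner ℝ (C h) h ≤ 0 := by linarith [ht.1, ht.2]
    exact nonpos_of_mul_nonpos_right this (by positivity)

lemma lin_quad_zero {a : E} {κ : ℝ} (hκ : 0 < κ) {d : ℝ}
    (H : ∀ u : E, inner ℝ a u ≤ κ * ‖u‖ ^ 2 + κ * d ^ 2) : ‖a‖ ^ 2 ≤ (2 * κ * d) ^ 2 := by
  have h := H ((1 / (2 * κ)) • a)
  rw [real_inner_smul_right, real_inner_self_eq_norm_sq, norm_smul,
    Real.norm_of_nonneg (by positivity), mul_pow] at h
  have h2 : κ * ((1 / (2 * κ)) ^ 2 * ‖a‖ ^ 2) = (1 / (4 * κ)) * ‖a‖ ^ 2 := by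
    field_simp; ring
  rw [h2] at h
  have h3 : (1 / (2 * κ)) * ‖a‖ ^ 2 = 2 * ((1 / (4 * κ)) * ‖a‖ ^ 2) := by field_simp; ring
  rw [h3] at h
  have h4 : (1 / (4 * κ)) * ‖a‖ ^ 2 ≤ κ * d ^ 2 := by linarith
  rw [div_mul_eq_mul_div, one_mul, div_le_iff₀ (by positivity)] at h4
  nlinarith

open MeasureTheory in
lemma jensen_E {F1 F2 : E → ℝ} {k : ℝ} (hk : 0 ≤ k) (h1 : SemiSub k F1) (h2 : SemiSub k F2)
    {Bd : ℝ} (hB : ∀ z, F1 z + F2 z ≤ Bd) {s : ℝ} (hs : 0 < s) :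
    ∃ (x p1 p2 : E) (B1 B2 : E →L[ℝ] E), (∀ z, F1 z + F2 z ≤ F1 x + F2 x + s) ∧
      ‖p1 + p2‖ ≤ s ∧ (∀ h, inner ℝ (B1 h) h + inner ℝ (B2 h) h ≤ s * ‖h‖ ^ 2) ∧
      (∀ᶠ z in 𝓝 x, F1 z ≤ F1 x + inner ℝ p1 (z - x) + inner ℝ (B1 (z - x)) (z - x)) ∧
      (∀ᶠ z in 𝓝 x, F2 z ≤ F2 x + inner ℝ p2 (z - x) + inner ℝ (B2 (z - x)) (z - x)) := by
  borelize E
  set σ := s / 5 with hσ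
  have hσp : 0 < σ := by positivity
  have hSub : ∀ F : E → ℝ, SemiSub k F → HasSub (fun x => F x + k * ‖x‖ ^ 2) := by
    intro F hF x
    obtain ⟨p, hp⟩ := hF x
    refine ⟨(InnerProductSpace.toDual ℝ E).symm p + (2 * k) • x, fun z => ?_⟩
    have h := hp z
    rw [inner_add_left, real_inner_smul_left, InnerProductSpace.toDual_symm_apply]
    have e : ‖z‖ ^ 2 = ‖x‖ ^ 2 + 2 * inner ℝ x (z - x) + ‖z - x‖ ^ 2 := by
      rw [← norm_add_sq_real]; simp
    simp only [e]
    linarith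
  have hf1 := hSub F1 h1
  have hf2 := hSub F2 h2
  have hc : ∀ F : E → ℝ, SemiSub k F → Continuous F := by
    intro F hF
    have h := (hSub F hF).continuous
    have : F = fun x => (F x + k * ‖x‖ ^ 2) - k * ‖x‖ ^ 2 := by ext x; ring
    rw [this]; fun_prop
  have hc1 := hc F1 h1
  have hc2 := hc F2 h2
  -- almost maximum point
  obtain ⟨x0, hx0⟩ : ∃ x0, ∀ z, F1 z + F2 z ≤ F1 x0 + F2 x0 + σ := by
    have hbdd : BddAbove (Set.range fun z => F1 z + F2 z) := ⟨Bd, by rintro _ ⟨z, rfl⟩; exact hB z⟩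
    obtain ⟨x0, hx⟩ := exists_lt_of_lt_ciSup (sub_lt_self (⨆ z, F1 z + F2 z) hσp)
    refine ⟨x0, fun z => ?_⟩
    have := le_ciSup hbdd z
    linarith
  set Φ : E → ℝ := fun z => F1 z + F2 z - σ * ‖z - x0‖ ^ 2 with hΦ
  have hΦc : Continuous Φ := by fun_prop
  set κ := 2 * k + σ with hκ
  have hκp : 0 < κ := by positivity
  have exp0 : ∀ x z : E, ‖z - x0‖ ^ 2 = ‖x - x0‖ ^ 2 + 2 * inner ℝ (x - x0) (z - x)
      + ‖z - x‖ ^ 2 := by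
    intro x z
    rw [← norm_add_sq_real]; simp
  have hΦs : ∀ x, ∃ p : E, ∀ z, Φ x + inner ℝ p (z - x) - κ * ‖z - x‖ ^ 2 ≤ Φ z := by
    intro x
    obtain ⟨p, hp⟩ := h1 x
    obtain ⟨p', hp'⟩ := h2 x
    refine ⟨(InnerProductSpace.toDual ℝ E).symm (p + p') - (2 * σ) • (x - x0), fun z => ?_⟩
    have a1 := hp z
    have a2 := hp' z
    rw [inner_sub_left, real_inner_smul_left, InnerProductSpace.toDual_symm_apply]
    simp only [hΦ, exp0 x z, _root_.add_apply]
    simp only [hκ]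
    linarith
  set A : Set E := {x | ∃ q : E, ‖q‖ ≤ σ ∧ ∀ z, Φ z ≤ Φ x + inner ℝ q (z - x)} with hA
  have hlow : ∀ x q : E, (∀ z, Φ z ≤ Φ x + inner ℝ q (z - x)) →
      ∀ z, Φ x + inner ℝ q (z - x) - κ * ‖z - x‖ ^ 2 ≤ Φ z := by
    intro x q hq
    obtain ⟨p, hp⟩ := hΦs x
    have hpq : p - q = 0 := by
      have := lin_quad_zero (a := p - q) hκp (d := 0) (fun u => by
        have a1 := hp (x + u)
        have a2 := hq (x + u)
        rw [add_sub_cancel_left] at a1 a2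
        rw [inner_sub_left]; linarith)
      have h0 : ‖p - q‖ = 0 := by
        have h' := sq_nonneg ‖p - q‖
        exact pow_eq_zero_iff (two_ne_zero) |>.1 (by linarith)
      simpa using h0
    rw [sub_eq_zero] at hpq
    subst hpq
    exact hp
  have hLip : ∀ x x' q q' : E, (∀ z, Φ z ≤ Φ x + inner ℝ q (z - x)) →
      (∀ z, Φ z ≤ Φ x' + inner ℝ q' (z - x')) → ‖q' - q‖ ≤ 2 * κ * ‖x' - x‖ := by
    intro x x' q q' hq hq'
    have l := hlow x q hq
    have l' := hlow x' q' hq'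
    have := lin_quad_zero (a := q' - q) hκp (d := ‖x' - x‖) (fun u => by
      have a1 := l' (x' + u)
      have a2 := hq (x' + u)
      have a3 := l x'
      rw [add_sub_cancel_left] at a1
      have e : x' + u - x = (x' - x) + u := by abel
      rw [e, inner_add_right] at a2
      rw [inner_sub_left]; linarith)
    exact abs_le_of_sq_le_sq' this (by positivity) |>.2
  have hex : ∀ q : E, ‖q‖ ≤ σ → ∃ x, ∀ z, Φ z ≤ Φ x + inner ℝ q (z - x) := by
    intro q hq
    have hg : Continuous (fun z => Φ z - inner ℝ q (z - x0)) := by fun_prop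
    obtain ⟨x, hx⟩ := hg.exists_forall_ge' x0 (by
      have : ∀ᶠ x in cocompact E, x ∉ Metric.closedBall x0 2 :=
        (isCompact_closedBall x0 2).compl_mem_cocompact
      filter_upwards [this] with z hz
      rw [Metric.mem_closedBall, dist_eq_norm, not_le] at hz
      have a1 := hx0 z
      have a2 := abs_real_inner_le_norm q (z - x0)
      have a3 := neg_abs_le (inner ℝ q (z - x0))
      have a4 : ‖q‖ * ‖z - x0‖ ≤ σ * ‖z - x0‖ := by gcongr
      have a5 : σ * (1 + ‖z - x0‖ - ‖z - x0‖^2) ≤ 0 :=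
        mul_nonpos_of_nonneg_of_nonpos hσp.le (by nlinarith)
      simp only [hΦ, sub_self, norm_zero, inner_zero_right]
      nlinarith)
    refine ⟨x, fun z => ?_⟩
    have := hx z
    have e : inner ℝ q (z - x) = inner ℝ q (z - x0) - inner ℝ q (x - x0) := by
      rw [← inner_sub_right]; congr 1; abel
    rw [e]; linarith
  -- the contact set is not null
  set μ : Measure E := Measure.hausdorffMeasure (Module.finrank ℝ E : ℝ) with hμ
  have hbad1 := alexandrov hf1
  have hbad2 := alexandrov hf2
  obtain ⟨x, hxA, ht1, ht2⟩ : ∃ x ∈ A, TwiceAt (fun x => F1 x + k * ‖x‖ ^ 2) x ∧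
      TwiceAt (fun x => F2 x + k * ‖x‖ ^ 2) x := by
    by_contra hcon
    push Not at hcon
    have hAnull : μ A = 0 := by
      refine measure_mono_null ?_ (measure_union_null hbad1 hbad2)
      intro x hx
      by_cases hx1 : TwiceAt (fun x => F1 x + k * ‖x‖ ^ 2) x
      · right; exact hcon x hx hx1
      · left; exact hx1
    have hch : ∀ x : E, ∃ q : E, x ∈ A → ‖q‖ ≤ σ ∧ ∀ z, Φ z ≤ Φ x + inner ℝ q (z - x) := by
      intro x
      by_cases hx : x ∈ A
      · obtain ⟨q, hq⟩ := hx
        exact ⟨q, fun _ => hq⟩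
      · exact ⟨0, fun h => absurd h hx⟩
    choose qf hqf using hch
    have hlip : LipschitzOnWith (2 * κ).toNNReal qf A := by
      apply LipschitzOnWith.of_dist_le_mul
      intro x hx y hy
      rw [dist_eq_norm, dist_eq_norm, Real.coe_toNNReal _ (by positivity)]
      exact hLip y x _ _ (hqf y hy).2 (hqf x hx).2
    have himg : μ (qf '' A) = 0 := by
      have := hlip.hausdorffMeasure_image_le (d := (Module.finrank ℝ E : ℝ)) (by positivity)
      rw [← hμ, hAnull, mul_zero] at this
      exact le_antisymm this bot_le
    have hball : Metric.closedBall (0 : E) σ ⊆ qf '' A := by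
      intro q hq
      rw [mem_closedBall_zero_iff] at hq
      obtain ⟨x, hx⟩ := hex q hq
      have hxA : x ∈ A := ⟨q, hq, hx⟩
      refine ⟨x, hxA, ?_⟩
      have := hLip x x _ _ hx (hqf x hxA).2
      rw [sub_self, norm_zero, mul_zero] at this
      have h0 : ‖qf x - q‖ = 0 := le_antisymm this (norm_nonneg _)
      rw [norm_eq_zero, sub_eq_zero] at h0
      exact h0
    have hpos := Metric.measure_closedBall_pos μ (0 : E) hσp
    exact absurd (measure_mono_null hball himg) hpos.ne'
  obtain ⟨q, hqn, hq⟩ := hxA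
  -- two sided expansions
  have hexp : ∀ F : E → ℝ, TwiceAt (fun x => F x + k * ‖x‖ ^ 2) x →
      ∃ (p : E) (B : E →L[ℝ] E), ∀ᶠ z in 𝓝 x,
        F z ≤ F x + inner ℝ p (z - x) + inner ℝ (B (z - x)) (z - x) ∧
        F x + inner ℝ p (z - x) + inner ℝ (B (z - x)) (z - x) - 2 * σ * ‖z - x‖ ^ 2 ≤ F z := by
    rintro F ⟨p, B, hpB⟩
    refine ⟨p - (2 * k) • x, (1 / 2 : ℝ) • B + (σ - k) • ContinuousLinearMap.id ℝ E, ?_⟩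
    filter_upwards [hpB σ hσp] with z hz
    have e : ‖z‖ ^ 2 = ‖x‖ ^ 2 + 2 * inner ℝ x (z - x) + ‖z - x‖ ^ 2 := by
      rw [← norm_add_sq_real]; simp
    have e2 : inner ℝ (((1 / 2 : ℝ) • B + (σ - k) • ContinuousLinearMap.id ℝ E) (z - x)) (z - x)
        = (1 / 2) * inner ℝ (B (z - x)) (z - x) + (σ - k) * ‖z - x‖ ^ 2 := by
      simp only [_root_.add_apply, _root_.smul_apply, ContinuousLinearMap.id_apply]
      rw [inner_add_left, real_inner_smul_left, real_inner_smul_left, real_inner_self_eq_norm_sq]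
    rw [e2, inner_sub_left, real_inner_smul_left]
    simp only [e] at hz
    have hz' := abs_le.1 hz
    constructor
    · linarith [hz'.2]
    · linarith [hz'.1]
  obtain ⟨p1, B1, hE1⟩ := hexp F1 ht1
  obtain ⟨p2, B2, hE2⟩ := hexp F2 ht2
  have hupper : ∀ z, F1 z + F2 z ≤ F1 x + F2 x + inner ℝ ((2 * σ) • (x - x0) + q) (z - x)
      + σ * ‖z - x‖ ^ 2 := by
    intro z
    have := hq z
    simp only [hΦ, exp0 x z] at this
    rw [inner_add_left, real_inner_smul_left]; linarith
  have hquad := quad_nonpos (b := p1 + p2 - ((2 * σ) • (x - x0) + q))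
    (C := B1 + B2 - (5 * σ) • ContinuousLinearMap.id ℝ E) (by
      have ht : Tendsto (fun h : E => x + h) (𝓝 0) (𝓝 x) := by
        have : Continuous (fun h : E => x + h) := by fun_prop
        simpa using this.tendsto 0
      filter_upwards [ht.eventually hE1, ht.eventually hE2] with h a1 a2
      have a3 := hupper (x + h)
      rw [add_sub_cancel_left] at a1 a2 a3
      simp only [_root_.add_apply, _root_.sub_apply, _root_.smul_apply,
        ContinuousLinearMap.id_apply]
      rw [inner_sub_left, inner_add_left p1, inner_sub_left, inner_add_left (B1 h),
        real_inner_smul_left, real_inner_self_eq_norm_sq]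
      linarith [a1.2, a2.2])
  obtain ⟨hb, hC⟩ := hquad
  rw [sub_eq_zero] at hb
  set d := ‖x - x0‖ with hd
  have hq0 := hq x0
  have hq1 := abs_le.1 (abs_real_inner_le_norm q (x - x0))
  have hq2 : ‖q‖ * ‖x - x0‖ ≤ σ * d := by gcongr
  have hq3 : inner ℝ q (x0 - x) = - inner ℝ q (x - x0) := by
    rw [← inner_neg_right]; simp
  rw [hq3] at hq0
  simp only [hΦ, sub_self, norm_zero] at hq0
  rw [← hd] at hq0
  have hd0 : 0 ≤ d := norm_nonneg _
  have hd2 : d ≤ 2 := by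
    have := hx0 x
    have h5 : 0 ≤ σ * (1 + d - d ^ 2) := by nlinarith
    have h6 := nonneg_of_mul_nonneg_right h5 hσp
    nlinarith
  refine ⟨x, p1, p2, B1, B2, ?_, ?_, ?_, hE1.mono fun _ h => h.1, hE2.mono fun _ h => h.1⟩
  · intro z
    have := hx0 z
    nlinarith
  · rw [hb]
    calc _ ≤ ‖(2 * σ) • (x - x0)‖ + ‖q‖ := norm_add_le _ _
      _ ≤ 2 * σ * 2 + σ := by
        gcongr
        rw [norm_smul, Real.norm_of_nonneg (by positivity)]
        gcongr
      _ = s := by rw [hσ]; ring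
  · intro h
    have := hC h
    simp only [_root_.add_apply, _root_.sub_apply, _root_.smul_apply,
        ContinuousLinearMap.id_apply] at this
    rw [inner_sub_left, inner_add_left, real_inner_smul_left, real_inner_self_eq_norm_sq] at this
    have e5 : 5 * σ = s := by rw [hσ]; ring
    rw [e5] at this
    linarith

lemma jensen_V {V : Type*} [NormedAddCommGroup V] [NormedSpace ℝ V] [FiniteDimensional ℝ V]
    {F1 F2 : V → ℝ} {k : ℝ} (hk : 0 ≤ k) (h1 : SemiSub k F1) (h2 : SemiSub k F2)
    {Bd : ℝ} (hB : ∀ z, F1 z + F2 z ≤ Bd) {s : ℝ} (hs : 0 < s) :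
    ∃ (x : V) (p1 p2 : V →L[ℝ] ℝ) (B1 B2 : V →L[ℝ] V →L[ℝ] ℝ),
      (∀ z, F1 z + F2 z ≤ F1 x + F2 x + s) ∧
      ‖p1 + p2‖ ≤ s ∧ (∀ h, B1 h h + B2 h h ≤ s * ‖h‖ ^ 2) ∧
      (∀ᶠ z in 𝓝 x, F1 z ≤ F1 x + p1 (z - x) + B1 (z - x) (z - x)) ∧
      (∀ᶠ z in 𝓝 x, F2 z ≤ F2 x + p2 (z - x) + B2 (z - x) (z - x)) := by
  let e : V ≃L[ℝ] EuclideanSpace ℝ (Fin (Module.finrank ℝ V)) := toEuclidean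
  set M := ‖(e : V →L[ℝ] EuclideanSpace ℝ (Fin (Module.finrank ℝ V)))‖ with hM
  set M' := ‖(e.symm : EuclideanSpace ℝ (Fin (Module.finrank ℝ V)) →L[ℝ] V)‖ with hM'
  have hM0 : 0 ≤ M := norm_nonneg _
  have heM : ∀ v, ‖e v‖ ≤ M * ‖v‖ := fun v =>
    (e : V →L[ℝ] EuclideanSpace ℝ (Fin (Module.finrank ℝ V))).le_opNorm v
  have heM' : ∀ v, ‖e.symm v‖ ≤ M' * ‖v‖ := fun v =>
    (e.symm : EuclideanSpace ℝ (Fin (Module.finrank ℝ V)) →L[ℝ] V).le_opNorm v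
  set s' := s / (1 + M + M ^ 2) with hs'
  have hs'p : 0 < s' := by positivity
  have hss : s' * (1 + M + M ^ 2) = s := by rw [hs']; field_simp
  have hsemi : ∀ F : V → ℝ, SemiSub k F → SemiSub (k * M' ^ 2) (fun u => F (e.symm u)) := by
    intro F hF x
    obtain ⟨p, hp⟩ := hF (e.symm x)
    refine ⟨p.comp (e.symm : EuclideanSpace ℝ (Fin (Module.finrank ℝ V)) →L[ℝ] V), fun z => ?_⟩
    have h := hp (e.symm z)
    rw [← map_sub] at h
    have h3 : ‖e.symm (z - x)‖ ^ 2 ≤ (M' * ‖z - x‖) ^ 2 := by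
      gcongr; exact heM' _
    have h4 := mul_le_mul_of_nonneg_left h3 hk
    simp only [ContinuousLinearMap.comp_apply, ContinuousLinearEquiv.coe_coe]
    nlinarith
  obtain ⟨x, p1, p2, B1, B2, a1, a2, a3, a4, a5⟩ := jensen_E (by positivity) (hsemi F1 h1)
    (hsemi F2 h2) (Bd := Bd) (fun z => hB _) hs'p
  let ee : V →L[ℝ] EuclideanSpace ℝ (Fin (Module.finrank ℝ V)) := e
  let P : EuclideanSpace ℝ (Fin (Module.finrank ℝ V)) → V →L[ℝ] ℝ := fun p =>
    (innerSL ℝ p).comp ee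
  let Q : (EuclideanSpace ℝ (Fin (Module.finrank ℝ V)) →L[ℝ]
      EuclideanSpace ℝ (Fin (Module.finrank ℝ V))) → V →L[ℝ] V →L[ℝ] ℝ := fun B =>
    ContinuousLinearMap.bilinearComp (innerSL ℝ) (B.comp ee) ee
  have hP : ∀ p v, P p v = inner ℝ p (e v) := fun p v => rfl
  have hQ : ∀ B v, Q B v v = inner ℝ (B (e v)) (e v) := fun B v => rfl
  have hcont : Tendsto e (𝓝 (e.symm x)) (𝓝 x) := by
    have := e.continuous.tendsto (e.symm x)
    rwa [e.apply_symm_apply] at this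
  refine ⟨e.symm x, P p1, P p2, Q B1, Q B2, ?_, ?_, ?_, ?_, ?_⟩
  · intro z
    have h := a1 (e z)
    simp only [e.symm_apply_apply] at h
    have : s' ≤ s := by rw [← hss]; nlinarith [mul_nonneg hs'p.le hM0, mul_nonneg hs'p.le (sq_nonneg M)]
    linarith
  · refine ContinuousLinearMap.opNorm_le_bound _ hs.le fun v => ?_
    rw [_root_.add_apply, hP, hP, ← inner_add_left]
    calc _ ≤ ‖p1 + p2‖ * ‖e v‖ := abs_real_inner_le_norm _ _
      _ ≤ s' * (M * ‖v‖) := by gcongr; exact heM v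
      _ = (s' * M) * ‖v‖ := by ring
      _ ≤ s * ‖v‖ := by
        gcongr
        rw [← hss]; gcongr; nlinarith
  · intro h
    rw [hQ, hQ]
    calc _ ≤ s' * ‖e h‖ ^ 2 := a3 _
      _ ≤ s' * (M * ‖h‖) ^ 2 := by gcongr; exact heM h
      _ = (s' * M ^ 2) * ‖h‖ ^ 2 := by ring
      _ ≤ s * ‖h‖ ^ 2 := by
        gcongr
        rw [← hss]; gcongr; nlinarith
  · filter_upwards [hcont.eventually a4] with z hz
    simp only [e.symm_apply_apply] at hz
    rw [hP, hQ, map_sub, e.apply_symm_apply]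
    exact hz
  · filter_upwards [hcont.eventually a5] with z hz
    simp only [e.symm_apply_apply] at hz
    rw [hP, hQ, map_sub, e.apply_symm_apply]
    exact hz

end Jensen


open MeasureTheory in
lemma ae_diff_of_locLip {V : Type*} [NormedAddCommGroup V] [NormedSpace ℝ V] [FiniteDimensional ℝ V]
    [MeasurableSpace V] [BorelSpace V] (μ : Measure V) [μ.IsAddHaarMeasure] {f : V → ℝ} {U : Set V}
    (hU : IsOpen U) (hf : LocallyLipschitzOn U f) :
    ∀ᵐ x ∂μ, x ∈ U → DifferentiableAt ℝ f x := by
  rw [ae_iff]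
  apply measure_null_of_locally_null
  intro x hx
  simp only [Set.mem_ofPred_eq, Classical.not_imp] at hx
  obtain ⟨K, t, ht, hK⟩ := hf hx.1
  rw [hU.nhdsWithin_eq hx.1] at ht
  have h1 : ∀ᵐ x ∂μ, x ∈ interior t → DifferentiableAt ℝ f x := by
    filter_upwards [(hK.mono interior_subset).ae_differentiableWithinAt_of_mem (μ := μ)] with y hy hyt
    exact (hy hyt).differentiableAt (isOpen_interior.mem_nhds hyt)
  rw [ae_iff] at h1
  refine ⟨{a | a ∈ U → DifferentiableAt ℝ f a}ᶜ ∩ interior t, ?_, ?_⟩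
  · exact inter_mem_nhdsWithin _ (isOpen_interior.mem_nhds (mem_interior_iff_mem_nhds.2 ht))
  · refine measure_mono_null ?_ h1
    rintro y ⟨hy1, hy2⟩
    simp only [Set.mem_compl_iff, Set.mem_ofPred_eq, Classical.not_imp] at hy1 ⊢
    exact ⟨hy2, hy1.2⟩

open MeasureTheory in
lemma seg_le {V : Type*} [NormedAddCommGroup V] [NormedSpace ℝ V] [FiniteDimensional ℝ V]
    [MeasurableSpace V] [BorelSpace V] (μ : Measure V) [μ.IsAddHaarMeasure] {f G : V → ℝ} {U : Set V}
    (hU : IsOpen U) (hf : LocallyLipschitzOn U f) (hG : ContinuousOn G U) {a d : V} {K : ℝ}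
    (hseg : ∀ t ∈ Set.Icc (0 : ℝ) 1, a + t • d ∈ U)
    (hGK : ∀ t ∈ Set.Icc (0 : ℝ) 1, G (a + t • d) ≤ K)
    (hd : ∀ᵐ x ∂μ, x ∈ U → ∃ f' : V →L[ℝ] ℝ, HasFDerivAt f f' x ∧ f' d ≤ G x) :
    f (a + d) - f a ≤ K := by
  refine le_of_forall_pos_le_add fun ε hε => ?_
  set T : Set V := (fun t : ℝ => a + t • d) '' Set.Icc 0 1 with hT
  have hTc : IsCompact T := isCompact_Icc.image (by fun_prop)
  have hWo : IsOpen (U ∩ G ⁻¹' Set.Iio (K + ε)) := hG.isOpen_inter_preimage hU isOpen_Iio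
  have hTW : T ⊆ U ∩ G ⁻¹' Set.Iio (K + ε) := by
    rintro _ ⟨t, ht, rfl⟩
    exact ⟨hseg t ht, lt_of_le_of_lt (hGK t ht) (by linarith)⟩
  obtain ⟨δ, hδ, hsub⟩ := hTc.exists_cthickening_subset_open hWo hTW
  have hCc : IsCompact (Metric.cthickening δ T) := hTc.cthickening
  obtain ⟨K', hK'⟩ := (hf.mono (hsub.trans Set.inter_subset_left)).exists_lipschitzOnWith_of_compact hCc
  have hmem : ∀ u : V, ‖u‖ < δ → ∀ t ∈ Set.Icc (0 : ℝ) 1, a + t • d + u ∈ Metric.cthickening δ T := by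
    intro u hu t ht
    refine Metric.mem_cthickening_of_dist_le _ (a + t • d) _ _ ⟨t, ht, rfl⟩ ?_
    simp [dist_eq_norm, hu.le]
  obtain ⟨N, hN1, hN2, hN3⟩ : ∃ N : Set V, MeasurableSet N ∧ μ N = 0 ∧ ∀ x, x ∉ N →
      x ∈ U → ∃ f' : V →L[ℝ] ℝ, HasFDerivAt f f' x ∧ f' d ≤ G x := by
    refine ⟨toMeasurable μ {x | ¬ (x ∈ U → ∃ f' : V →L[ℝ] ℝ, HasFDerivAt f f' x ∧ f' d ≤ G x)},
      measurableSet_toMeasurable _ _, ?_, ?_⟩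
    · rw [measure_toMeasurable]; exact ae_iff.1 hd
    · intro x hx
      by_contra h
      exact hx (subset_toMeasurable _ _ h)
  have hae : ∀ᵐ u ∂μ, ∀ᵐ t : ℝ, a + t • d + u ∉ N := by
    have hms : MeasurableSet {x : ℝ × V | a + x.1 • d + x.2 ∉ N} := by
      have : Measurable (fun x : ℝ × V => a + x.1 • d + x.2) := by fun_prop
      exact this hN1.compl
    refine (Measure.ae_ae_comm (μ := (volume : Measure ℝ)) (ν := μ)
      (p := fun t u => a + t • d + u ∉ N) hms).1 ?_
    refine Eventually.of_forall fun t => ?_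
    rw [ae_iff]
    simp only [not_not]
    have : {u | a + t • d + u ∈ N} = (fun u => (a + t • d) + u) ⁻¹' N := rfl
    rw [this, measure_preimage_add, hN2]
  have hkey : ∀ u : V, ‖u‖ < δ → (∀ᵐ t : ℝ, a + t • d + u ∉ N) →
      f (a + d + u) - f (a + u) ≤ K + ε := by
    intro u hu hut
    set g : ℝ → ℝ := fun t => f (a + t • d + u) with hg
    have hlip : LipschitzOnWith (K' * ‖d‖₊) g (Set.uIcc 0 1) := by
      rw [Set.uIcc_of_le zero_le_one]
      refine LipschitzOnWith.of_dist_le_mul fun s hs t ht => ?_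
      have h1 := hK'.dist_le_mul _ (hmem u hu s hs) _ (hmem u hu t ht)
      refine h1.trans (le_of_eq ?_)
      have : a + s • d + u - (a + t • d + u) = (s - t) • d := by rw [sub_smul]; abel
      rw [dist_eq_norm, this, norm_smul, Real.dist_eq, Real.norm_eq_abs]
      push_cast
      ring
    have hac := hlip.absolutelyContinuousOnInterval
    have hacI := hac.integral_deriv_eq_sub
    have h2 : ∫ x in (0:ℝ)..1, deriv g x ≤ ∫ x in (0:ℝ)..1, (K + ε) := by
      refine intervalIntegral.integral_mono_ae_restrict zero_le_one hac.intervalIntegrable_deriv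
        (by simp) ?_
      rw [EventuallyLE, ae_restrict_iff' measurableSet_Icc]
      filter_upwards [hut] with t ht hti
      have hm := hsub (hmem u hu t hti)
      obtain ⟨f', hf', hle⟩ := hN3 _ ht hm.1
      have hd1 : HasDerivAt (fun t : ℝ => a + t • d + u) d t := by
        simpa using (((hasDerivAt_id t).smul_const d).const_add a).add_const u
      have := hf'.comp_hasDerivAt t hd1
      rw [show deriv g t = f' d from this.deriv]
      have := hm.2
      simp only [Set.mem_preimage, Set.mem_Iio] at this
      linarith
    rw [hacI] at h2
    simpa [hg] using h2
  have hdense := Measure.dense_of_ae hae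
  have hc0 : ContinuousWithinAt (fun u => f (a + d + u) - f (a + u)) (Metric.ball 0 δ) 0 := by
    have hcf : ContinuousOn f U := hf.continuousOn
    have h0 : a ∈ U := by simpa using hseg 0 (by simp)
    have h1 : a + d ∈ U := by simpa using hseg 1 (by simp)
    have c0 : ContinuousAt f a := hcf.continuousAt (hU.mem_nhds h0)
    have c1 : ContinuousAt f (a + d) := hcf.continuousAt (hU.mem_nhds h1)
    refine ContinuousAt.continuousWithinAt (ContinuousAt.sub ?_ ?_)
    · refine ContinuousAt.comp (g := f) (f := fun u => a + d + u) ?_ (by fun_prop)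
      simpa using c1
    · refine ContinuousAt.comp (g := f) (f := fun u => a + u) ?_ (by fun_prop)
      simpa using c0
  have hcl : (0 : V) ∈ closure (Metric.ball 0 δ ∩ {u | ∀ᵐ t : ℝ, a + t • d + u ∉ N}) := by
    exact hdense.open_subset_closure_inter Metric.isOpen_ball (Metric.mem_ball_self hδ)
  have hnb : (𝓝[Metric.ball 0 δ ∩ {u | ∀ᵐ t : ℝ, a + t • d + u ∉ N}] (0 : V)).NeBot :=
    mem_closure_iff_nhdsWithin_neBot.1 hcl
  have ht := (hc0.mono (Set.inter_subset_left (t := {u | ∀ᵐ t : ℝ, a + t • d + u ∉ N}))).tendsto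
  have h3 := le_of_tendsto ht (b := K + ε) (by
    filter_upwards [self_mem_nhdsWithin] with u hu
    exact hkey u (by simpa using hu.1) hu.2)
  simpa using h3


lemma locLip_comp {X Y Z : Type*} [PseudoEMetricSpace X] [PseudoEMetricSpace Y] [PseudoEMetricSpace Z]
    {S : Set X} {T : Set Y} {f : X → Y} {g : Y → Z} (hg : LocallyLipschitzOn T g)
    (hf : LocallyLipschitzOn S f) (hm : Set.MapsTo f S T) : LocallyLipschitzOn S (fun x => g (f x)) := by
  intro x hx
  obtain ⟨Kf, t, ht, hKf⟩ := hf hx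
  obtain ⟨Kg, t', ht', hKg⟩ := hg (hm hx)
  refine ⟨Kg * Kf, t ∩ f ⁻¹' t', inter_mem ht ?_, ?_⟩
  · exact ((hf.continuousOn x hx).tendsto_nhdsWithin hm) ht'
  · exact hKg.comp (hKf.mono Set.inter_subset_left) (fun y hy => hy.2)

lemma locLip_pair {X Y Z : Type*} [PseudoEMetricSpace X] [PseudoEMetricSpace Y] [PseudoEMetricSpace Z]
    {S : Set X} {f : X → Y} {g : X → Z} (hf : LocallyLipschitzOn S f)
    (hg : LocallyLipschitzOn S g) : LocallyLipschitzOn S (fun x => (f x, g x)) := by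
  intro x hx
  obtain ⟨Kf, t, ht, hKf⟩ := hf hx
  obtain ⟨Kg, t', ht', hKg⟩ := hg hx
  refine ⟨max Kf Kg, t ∩ t', inter_mem ht ht', ?_⟩
  exact (hKf.mono Set.inter_subset_left).prodMk (hKg.mono Set.inter_subset_right)

lemma locLip_mul {X : Type*} [PseudoEMetricSpace X]
    {S : Set X} {f g : X → ℝ} (hf : LocallyLipschitzOn S f)
    (hg : LocallyLipschitzOn S g) : LocallyLipschitzOn S (fun x => f x * g x) := by
  have h : LocallyLipschitz (fun z : ℝ × ℝ => z.1 * z.2) :=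
    ContDiff.locallyLipschitz (𝕂 := ℝ) (by fun_prop)
  exact locLip_comp (locallyLipschitzOn_univ.2 h) (locLip_pair hf hg) (Set.mapsTo_univ _ _)

lemma locLip_const {X Y : Type*} [PseudoEMetricSpace X] [PseudoEMetricSpace Y]
    {S : Set X} (c : Y) : LocallyLipschitzOn S (fun _ => c) :=
  (LipschitzWith.const c).locallyLipschitz.locallyLipschitzOn

lemma locLip_sum {X ι : Type*} [PseudoEMetricSpace X] {S : Set X} {f : ι → X → ℝ} (s : Finset ι)
    (hf : ∀ i, LocallyLipschitzOn S (f i)) : LocallyLipschitzOn S (fun x => ∑ i ∈ s, f i x) := by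
  classical
  induction s using Finset.induction_on with
  | empty => simpa using locLip_const (0 : ℝ)
  | insert a s ha ih =>
    simp only [Finset.sum_insert ha]
    exact (hf a).add ih

/-- quadratic form -/
def qf {n : ℕ} (A : HMat n) (e : HIdx n → ℝ) : ℝ := ∑ i, ∑ j, e i * A i j * e j

/-- squared Euclidean norm -/
def esq {n : ℕ} (e : HIdx n → ℝ) : ℝ := ∑ j, e j ^ 2

section
variable {n : ℕ}

lemma esq_nonneg (e : HIdx n → ℝ) : 0 ≤ esq e := Finset.sum_nonneg fun _ _ => sq_nonneg _

lemma pnorm_nonneg (e : HIdx n → ℝ) : 0 ≤ pnorm e := Real.sqrt_nonneg _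

lemma pnorm_sq (e : HIdx n → ℝ) : pnorm e ^ 2 = esq e := Real.sq_sqrt (esq_nonneg e)

lemma dot_le_pnorm (p q : HIdx n → ℝ) : ∑ i, p i * q i ≤ pnorm p * pnorm q :=
  Real.sum_mul_le_sqrt_mul_sqrt _ _ _

lemma dot_sq_le (p e : HIdx n → ℝ) : (∑ i, p i * e i) ^ 2 ≤ pnorm p ^ 2 * esq e := by
  rw [pnorm_sq]; exact Finset.sum_mul_sq_le_sq_mul_sq _ _ _

lemma pnorm_smul (c : ℝ) (p : HIdx n → ℝ) : pnorm (c • p) = |c| * pnorm p := by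
  simp only [pnorm, Pi.smul_apply, smul_eq_mul, mul_pow, ← Finset.mul_sum]
  rw [Real.sqrt_mul (sq_nonneg _), Real.sqrt_sq_eq_abs]

lemma pnorm_add_le (p q : HIdx n → ℝ) : pnorm (p + q) ≤ pnorm p + pnorm q := by
  refine abs_le_of_sq_le_sq' ?_ (add_nonneg (pnorm_nonneg _) (pnorm_nonneg _)) |>.2
  have h := dot_le_pnorm p q
  have e : esq (p + q) = esq p + esq q + 2 * ∑ i, p i * q i := by
    simp only [esq, Pi.add_apply, Finset.mul_sum, ← Finset.sum_add_distrib]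
    exact Finset.sum_congr rfl fun i _ => by ring
  rw [pnorm_sq, e, add_sq, pnorm_sq, pnorm_sq]
  nlinarith

lemma pnorm_neg (p : HIdx n → ℝ) : pnorm (-p) = pnorm p := by
  simp [pnorm]

lemma continuous_pnorm : Continuous (pnorm : (HIdx n → ℝ) → ℝ) := by
  unfold pnorm; fun_prop

lemma qf_eq (A : HMat n) (e : HIdx n → ℝ) : e ⬝ᵥ A *ᵥ e = qf A e := by
  simp only [qf, dotProduct, mulVec, Finset.mul_sum]
  exact Finset.sum_congr rfl fun i _ => Finset.sum_congr rfl fun j _ => by ring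

lemma qf_add (A B : HMat n) (e : HIdx n → ℝ) : qf (A + B) e = qf A e + qf B e := by
  simp only [← qf_eq, add_mulVec, dotProduct_add]

lemma qf_sub (A B : HMat n) (e : HIdx n → ℝ) : qf (A - B) e = qf A e - qf B e := by
  simp only [← qf_eq, sub_mulVec, dotProduct_sub]

lemma qf_smul (c : ℝ) (A : HMat n) (e : HIdx n → ℝ) : qf (c • A) e = c * qf A e := by
  simp only [← qf_eq, smul_mulVec, dotProduct_smul, smul_eq_mul]

lemma qf_zero (e : HIdx n → ℝ) : qf (0 : HMat n) e = 0 := by simp [qf]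

lemma qf_one (e : HIdx n → ℝ) : qf (1 : HMat n) e = esq e := by
  simp only [← qf_eq, one_mulVec, esq, dotProduct, sq]

lemma qf_vec (p e : HIdx n → ℝ) : qf (vecMulVec p p) e = (∑ i, p i * e i) ^ 2 := by
  simp only [qf, vecMulVec_apply, sq, Finset.sum_mul_sum]
  exact Finset.sum_congr rfl fun i _ => Finset.sum_congr rfl fun j _ => by ring

lemma qf_le_of_matLE {A B : HMat n} (h : matLE A B) (e : HIdx n → ℝ) : qf A e ≤ qf B e := by
  have h2 := h.dotProduct_mulVec_nonneg e
  simp only [star_trivial] at h2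
  rw [qf_eq, qf_sub] at h2
  linarith

lemma seg_qf {V : Type*} [NormedAddCommGroup V] [NormedSpace ℝ V] [FiniteDimensional ℝ V]
    {U : Set V} (hU : IsOpen U) (M : V → HMat n)
    (hM : ∀ i j, LocallyLipschitzOn U (fun x => M x i j)) (e : HIdx n → ℝ)
    {G : V → ℝ} (hG : ContinuousOn G U) {a d : V} {K : ℝ}
    (hseg : ∀ t ∈ Set.Icc (0 : ℝ) 1, a + t • d ∈ U)
    (hGK : ∀ t ∈ Set.Icc (0 : ℝ) 1, G (a + t • d) ≤ K)
    (hd : ∀ x ∈ U, (∀ i j, DifferentiableAt ℝ (fun x => M x i j) x) →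
      qf (Matrix.of fun i j => fderiv ℝ (fun x => M x i j) x d) e ≤ G x) :
    qf (M (a + d)) e - qf (M a) e ≤ K := by
  letI : MeasurableSpace V := borel V
  haveI : BorelSpace V := ⟨rfl⟩
  have hlip : LocallyLipschitzOn U (fun x => qf (M x) e) := by
    unfold qf
    exact locLip_sum _ fun i => locLip_sum _ fun j =>
      locLip_mul (locLip_mul (locLip_const _) (hM i j)) (locLip_const _)
  refine seg_le (MeasureTheory.Measure.addHaar) hU hlip hG hseg hGK ?_
  have hae : ∀ᵐ x ∂(MeasureTheory.Measure.addHaar : MeasureTheory.Measure V),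
      ∀ i j, x ∈ U → DifferentiableAt ℝ (fun x => M x i j) x := by
    rw [MeasureTheory.ae_all_iff]; intro i
    rw [MeasureTheory.ae_all_iff]; intro j
    exact ae_diff_of_locLip _ hU (hM i j)
  filter_upwards [hae] with x hx hxU
  have hx' : ∀ i j, HasFDerivAt (fun x => M x i j) (fderiv ℝ (fun x => M x i j) x) x :=
    fun i j => (hx i j hxU).hasFDerivAt
  refine ⟨∑ i, ∑ j, (e j) • ((e i) • (fderiv ℝ (fun x => M x i j) x)), ?_, ?_⟩
  · unfold qf
    refine HasFDerivAt.fun_sum fun i _ => HasFDerivAt.fun_sum fun j _ => ?_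
    exact ((hx' i j).const_mul (e i)).mul_const (e j)
  · refine le_of_eq_of_le ?_ (hd x hxU (fun i j => hx i j hxU))
    simp only [qf, _root_.sum_apply, _root_.smul_apply, smul_eq_mul, of_apply]
    exact Finset.sum_congr rfl fun i _ => Finset.sum_congr rfl fun j _ => by ring

end


section
variable {n : ℕ}

lemma triple_cs (D : HIdx n → HIdx n → HIdx n → ℝ) (e d : HIdx n → ℝ) :
    ∑ i, ∑ j, e i * (∑ k, d k * D i j k) * e j ≤
      Real.sqrt (∑ i, ∑ j, ∑ k, (D i j k) ^ 2) * pnorm d * esq e := by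
  have h := Real.sum_mul_le_sqrt_mul_sqrt (Finset.univ : Finset (HIdx n × HIdx n × HIdx n))
    (fun x => D x.1 x.2.1 x.2.2) (fun x => e x.1 * (e x.2.1 * d x.2.2))
  have e1 : ∑ x : HIdx n × HIdx n × HIdx n, (D x.1 x.2.1 x.2.2) ^ 2
      = ∑ i, ∑ j, ∑ k, (D i j k) ^ 2 := by
    rw [Fintype.sum_prod_type]
    exact Finset.sum_congr rfl fun i _ => by rw [Fintype.sum_prod_type]
  have e2 : ∑ x : HIdx n × HIdx n × HIdx n, (e x.1 * (e x.2.1 * d x.2.2)) ^ 2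
      = (esq e) ^ 2 * esq d := by
    rw [Fintype.sum_prod_type]
    simp only [Fintype.sum_prod_type, mul_pow, ← Finset.mul_sum, ← Finset.sum_mul]
    unfold esq; ring
  have e3 : ∑ x : HIdx n × HIdx n × HIdx n, D x.1 x.2.1 x.2.2 * (e x.1 * (e x.2.1 * d x.2.2))
      = ∑ i, ∑ j, e i * (∑ k, d k * D i j k) * e j := by
    rw [Fintype.sum_prod_type]
    refine Finset.sum_congr rfl fun i _ => ?_
    rw [Fintype.sum_prod_type]
    refine Finset.sum_congr rfl fun j _ => ?_
    rw [Finset.mul_sum, Finset.sum_mul]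
    exact Finset.sum_congr rfl fun k _ => by ring
  rw [e1, e2, e3, Real.sqrt_mul (sq_nonneg _), Real.sqrt_sq (esq_nonneg e)] at h
  refine h.trans (le_of_eq ?_)
  unfold pnorm esq
  ring

lemma clm_eq_sum (f : (HIdx n → ℝ) →L[ℝ] ℝ) (d : HIdx n → ℝ) :
    f d = ∑ k, d k * f (Pi.single k 1) := by
  conv_lhs => rw [pi_eq_sum_univ' d, map_sum]
  refine Finset.sum_congr rfl fun k _ => ?_
  rw [map_smul, smul_eq_mul]

lemma qf_pgrad_le (L : Heis n → ℝ → (HIdx n → ℝ) → HMat n) (ξ : Heis n) (s : ℝ)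
    (p d e : HIdx n → ℝ) :
    qf (Matrix.of fun i j => fderiv ℝ (fun q => L ξ s q i j) p d) e ≤
      pGradNorm L ξ s p * pnorm d * esq e := by
  have := triple_cs (fun i j k => fderiv ℝ (fun q => L ξ s q i j) p (Pi.single k 1)) e d
  unfold pGradNorm
  refine le_of_eq_of_le ?_ this
  simp only [qf, of_apply]
  refine Finset.sum_congr rfl fun i _ => Finset.sum_congr rfl fun j _ => ?_
  rw [clm_eq_sum]

lemma double_cs (D : HIdx n → HIdx n → ℝ) (e : HIdx n → ℝ) :
    ∑ i, ∑ j, e i * D i j * e j ≤ Real.sqrt (∑ i, ∑ j, (D i j) ^ 2) * esq e := by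
  have h := Real.sum_mul_le_sqrt_mul_sqrt (Finset.univ : Finset (HIdx n × HIdx n))
    (fun x => D x.1 x.2) (fun x => e x.1 * e x.2)
  have e2 : ∑ x : HIdx n × HIdx n, (e x.1 * e x.2) ^ 2 = (esq e) ^ 2 := by
    rw [Fintype.sum_prod_type]
    simp only [mul_pow, ← Finset.mul_sum, ← Finset.sum_mul]
    unfold esq; ring
  rw [e2, Fintype.sum_prod_type, Fintype.sum_prod_type, Real.sqrt_sq (esq_nonneg e)] at h
  refine le_of_eq_of_le ?_ h
  exact Finset.sum_congr rfl fun i _ => Finset.sum_congr rfl fun j _ => by ring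

lemma qf_xigrad_le (L : Heis n → ℝ → (HIdx n → ℝ) → HMat n) (ξ : Heis n) (s : ℝ)
    (p e : HIdx n → ℝ) (d : Heis n) :
    qf (Matrix.of fun i j => fderiv ℝ (fun η => L η s p i j) ξ d) e ≤
      xiGradNorm L ξ s p * ‖d‖ * esq e := by
  have := double_cs (fun i j => fderiv ℝ (fun η => L η s p i j) ξ d) e
  refine this.trans ?_
  refine mul_le_mul_of_nonneg_right ?_ (esq_nonneg e)
  unfold xiGradNorm
  rw [← Real.sqrt_sq (norm_nonneg d), ← Real.sqrt_mul (by positivity)]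
  refine Real.sqrt_le_sqrt ?_
  rw [Finset.sum_mul]
  refine Finset.sum_le_sum fun i _ => ?_
  rw [Finset.sum_mul]
  refine Finset.sum_le_sum fun j _ => ?_
  rw [← mul_pow]
  refine sq_le_sq' ?_ ?_
  · have := (fderiv ℝ (fun η => L η s p i j) ξ).le_opNorm d
    rw [Real.norm_eq_abs] at this
    exact (abs_le.1 this).1
  · have := (fderiv ℝ (fun η => L η s p i j) ξ).le_opNorm d
    rw [Real.norm_eq_abs] at this
    exact (abs_le.1 this).2

variable {Ω : Set (Heis n)} {L : Heis n → ℝ → (HIdx n → ℝ) → HMat n}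

lemma L_p_lip (hΩ : IsOpen Ω)
    (hL : ∀ i j : HIdx n, LocallyLipschitzOnSet (Ω ×ˢ (Set.univ : Set (ℝ × (HIdx n → ℝ))))
      (fun q : Heis n × ℝ × (HIdx n → ℝ) => L q.1 q.2.1 q.2.2 i j))
    {C : ℝ} (hC : 0 < C) {ξ : Heis n} (hξ : ξ ∈ Ω) {s : ℝ}
    (h : ∀ p, DiffInP L ξ s p → pGradNorm L ξ s p ≤ C * pnorm p) (p q e : HIdx n → ℝ) :
    qf (L ξ s q) e - qf (L ξ s p) e ≤ C * (pnorm p + pnorm (q - p)) * pnorm (q - p) * esq e := by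
  have hl : ∀ i j, LocallyLipschitzOn Set.univ (fun x => L ξ s x i j) := by
    intro i j
    refine locLip_comp (T := Ω ×ˢ Set.univ) (f := fun x => (ξ, s, x))
      (g := fun q : Heis n × ℝ × (HIdx n → ℝ) => L q.1 q.2.1 q.2.2 i j) (fun x hx => hL i j x hx) ?_ ?_
    · exact locallyLipschitzOn_univ.2 (ContDiff.locallyLipschitz (𝕂 := ℝ) (by fun_prop))
    · intro x _; exact ⟨hξ, trivial⟩
  have := seg_qf isOpen_univ (fun x => L ξ s x) hl e (a := p) (d := q - p)
    (G := fun x => C * pnorm x * pnorm (q - p) * esq e)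
    (K := C * (pnorm p + pnorm (q - p)) * pnorm (q - p) * esq e)
    (by have := continuous_pnorm (n := n); fun_prop) (fun _ _ => trivial) ?_ ?_
  · simpa using this
  · intro t ht
    have h1 := pnorm_add_le p (t • (q - p))
    rw [pnorm_smul, abs_of_nonneg ht.1] at h1
    have h2 : t * pnorm (q - p) ≤ 1 * pnorm (q - p) :=
      mul_le_mul_of_nonneg_right ht.2 (pnorm_nonneg _)
    have := pnorm_nonneg (q - p)
    have := esq_nonneg e
    have : pnorm (p + t • (q - p)) ≤ pnorm p + pnorm (q - p) := by linarith
    gcongr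
  · intro x _ hx
    refine (qf_pgrad_le L ξ s x (q - p) e).trans ?_
    have := pnorm_nonneg (q - p)
    have := esq_nonneg e
    have := h x hx
    gcongr

lemma L_xi_lip (hΩ : IsOpen Ω)
    (hL : ∀ i j : HIdx n, LocallyLipschitzOnSet (Ω ×ˢ (Set.univ : Set (ℝ × (HIdx n → ℝ))))
      (fun q : Heis n × ℝ × (HIdx n → ℝ) => L q.1 q.2.1 q.2.2 i j))
    {C m : ℝ} {s : ℝ} {p : HIdx n → ℝ}
    (h : ∀ ξ ∈ Ω, DiffInXi L ξ s p → xiGradNorm L ξ s p ≤ C * pnorm p ^ m)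
    {ξ η : Heis n} (hseg : ∀ t ∈ Set.Icc (0 : ℝ) 1, ξ + t • (η - ξ) ∈ Ω) (e : HIdx n → ℝ) :
    qf (L η s p) e - qf (L ξ s p) e ≤ C * pnorm p ^ m * ‖η - ξ‖ * esq e := by
  have hl : ∀ i j, LocallyLipschitzOn Ω (fun x => L x s p i j) := by
    intro i j
    refine locLip_comp (T := Ω ×ˢ Set.univ) (f := fun x => (x, s, p))
      (g := fun q : Heis n × ℝ × (HIdx n → ℝ) => L q.1 q.2.1 q.2.2 i j) (fun x hx => hL i j x hx) ?_ ?_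
    · exact (locallyLipschitzOn_univ.2 (ContDiff.locallyLipschitz (𝕂 := ℝ) (by fun_prop))).mono
        (Set.subset_univ _)
    · intro x hx; exact ⟨hx, trivial⟩
  have := seg_qf hΩ (fun x => L x s p) hl e (a := ξ) (d := η - ξ)
    (G := fun x => C * pnorm p ^ m * ‖η - ξ‖ * esq e)
    (K := C * pnorm p ^ m * ‖η - ξ‖ * esq e)
    (by fun_prop) hseg (fun _ _ => le_rfl) ?_
  · simpa using this
  · intro x hxΩ hx
    refine (qf_xigrad_le L x s p e (η - ξ)).trans ?_
    have := esq_nonneg e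
    have := h x hxΩ hx
    gcongr

lemma L_persp (hΩ : IsOpen Ω)
    (hL : ∀ i j : HIdx n, LocallyLipschitzOnSet (Ω ×ˢ (Set.univ : Set (ℝ × (HIdx n → ℝ))))
      (fun q : Heis n × ℝ × (HIdx n → ℝ) => L q.1 q.2.1 q.2.2 i j))
    {C m θ Λ : ℝ} (hC : 0 < C) (hm : 1 < m) (hθ : 0 ≤ θ) {ξ : Heis n} (hξ : ξ ∈ Ω) {s : ℝ}
    (h : ∀ p, DiffInP L ξ s p → matLE (pDotGradL L ξ s p - L ξ s p +
              (θ * Λ * pGradNorm L ξ s p) • (1 : HMat n) - θ • (1 : HMat n))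
            (C • vecMulVec p p - ((1 / C) * pnorm p ^ m) • (1 : HMat n)))
    {c : ℝ} (hc0 : 0 < c) (hc1 : c < 1) (p ζ e : HIdx n → ℝ) (hζ : pnorm ζ ≤ θ * Λ) :
    c * qf (L ξ s p) e - (1 - c) * (C * (∑ i, p i * e i) ^ 2 + C * pnorm ζ ^ 2 * esq e
      - (1 / C) * pnorm (c • p + (1 - c) • ζ) ^ m * esq e + (1 / C) * pnorm ζ ^ m * esq e + θ * esq e)
      ≤ qf (L ξ s (c • p + (1 - c) • ζ)) e := by
  set U : Set ((HIdx n → ℝ) × ℝ) := {x | 0 < x.2} with hU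
  have hUo : IsOpen U := isOpen_lt continuous_const continuous_snd
  have hUc : Convex ℝ U := (convex_Ioi (0 : ℝ)).linear_preimage (LinearMap.snd ℝ (HIdx n → ℝ) ℝ)
  set M : (HIdx n → ℝ) × ℝ → HMat n := fun x => (-x.2) • L ξ s (x.2⁻¹ • x.1) with hM
  have hMl : ∀ i j, LocallyLipschitzOn U (fun x => M x i j) := by
    intro i j
    have h1 : LocallyLipschitzOn U (fun x : (HIdx n → ℝ) × ℝ => L ξ s (x.2⁻¹ • x.1) i j) := by
      refine locLip_comp (T := Ω ×ˢ Set.univ) (f := fun x : (HIdx n → ℝ) × ℝ => (ξ, s, x.2⁻¹ • x.1))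
        (g := fun q : Heis n × ℝ × (HIdx n → ℝ) => L q.1 q.2.1 q.2.2 i j) (fun x hx => hL i j x hx) ?_ ?_
      · refine ContDiffOn.locallyLipschitzOn hUc ?_
        refine contDiffOn_const.prodMk (contDiffOn_const.prodMk ?_)
        have hi : ContDiffOn ℝ 1 (fun x : (HIdx n → ℝ) × ℝ => x.2⁻¹) U :=
          contDiff_snd.contDiffOn.inv (fun x hx => ne_of_gt hx)
        exact hi.smul contDiff_fst.contDiffOn
      · intro x _; exact ⟨hξ, trivial⟩
    have h2 : LocallyLipschitzOn U (fun x : (HIdx n → ℝ) × ℝ => -x.2) :=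
      ContDiffOn.locallyLipschitzOn hUc (by fun_prop)
    exact locLip_mul h2 h1
  set κ : ℝ := c⁻¹ - 1 with hκ
  have hκp : 0 < κ := by rw [hκ, sub_pos]; exact (one_lt_inv₀ hc0).2 hc1
  set π := c • p + (1 - c) • ζ with hπ
  set Gf : (HIdx n → ℝ) → ℝ := fun q => κ * (C * (∑ i, q i * e i) ^ 2
      - (1 / C) * pnorm q ^ m * esq e + θ * esq e) with hGf
  have hGfc : Continuous Gf := by
    have h1 : Continuous (fun q : HIdx n → ℝ => pnorm q ^ m) :=
      (Real.continuous_rpow_const (by linarith)).comp continuous_pnorm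
    fun_prop
  have key := seg_qf hUo M hMl e (a := (p, 1)) (d := κ • (ζ, (1:ℝ)))
    (G := fun x => Gf (x.2⁻¹ • x.1))
    (K := κ * (C * (∑ i, p i * e i) ^ 2 + C * pnorm ζ ^ 2 * esq e
      - (1 / C) * pnorm π ^ m * esq e + (1 / C) * pnorm ζ ^ m * esq e + θ * esq e)) ?_ ?_ ?_ ?_
  · have e1 : ((p, (1:ℝ)) + κ • (ζ, (1:ℝ)) : (HIdx n → ℝ) × ℝ) = (p + κ • ζ, c⁻¹) := by
      simp [hκ]
    have e2 : c • (p + κ • ζ) = π := by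
      rw [hπ, smul_add, smul_smul, hκ]; congr 2; field_simp
    rw [e1] at key
    simp only [hM, inv_inv, e2, inv_one, one_smul, qf_smul] at key
    have := mul_le_mul_of_nonneg_left key hc0.le
    have e3 : c * c⁻¹ = 1 := mul_inv_cancel₀ hc0.ne'
    have e4 : c * κ = 1 - c := by rw [hκ, mul_sub, e3, mul_one]
    rw [← mul_assoc c κ, e4] at this
    have e5 : c * (-c⁻¹ * qf (L ξ s π) e - -1 * qf (L ξ s p) e)
      = - qf (L ξ s π) e + c * qf (L ξ s p) e := by
      linear_combination (-qf (L ξ s π) e) * e3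
    rw [e5] at this
    linarith
  · refine hGfc.comp_continuousOn ?_
    have hi : ContinuousOn (fun x : (HIdx n → ℝ) × ℝ => x.2⁻¹) U :=
      continuous_snd.continuousOn.inv₀ (fun x hx => ne_of_gt hx)
    exact hi.smul continuous_fst.continuousOn
  · intro t ht
    simp only [hU, Set.mem_ofPred_eq, Prod.snd_add, Prod.smul_snd, smul_eq_mul]
    have := mul_nonneg ht.1 hκp.le
    linarith
  · intro t ht
    set u : ℝ := 1 + t * κ with hu
    have htκ := mul_nonneg ht.1 hκp.le
    have hu1 : 1 ≤ u := by linarith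
    have huc : u * c ≤ 1 := by
      have : u ≤ c⁻¹ := by
        have := mul_le_mul_of_nonneg_right ht.2 hκp.le
        rw [hu]; linarith
      calc u * c ≤ c⁻¹ * c := by gcongr
        _ = 1 := inv_mul_cancel₀ hc0.ne'
    have hup : 0 < u := by linarith
    set q : HIdx n → ℝ := u⁻¹ • (p + (t * κ) • ζ) with hq
    have e0 : (((p, (1:ℝ)) + t • κ • (ζ, (1:ℝ)) : (HIdx n → ℝ) × ℝ)).2⁻¹ •
        (((p, (1:ℝ)) + t • κ • (ζ, (1:ℝ)) : (HIdx n → ℝ) × ℝ)).1 = q := by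
      simp [hq, hu, smul_smul]
    rw [e0]
    have hinv : u⁻¹ ≤ 1 := inv_le_one_of_one_le₀ hu1
    have hinv0 : 0 < u⁻¹ := inv_pos.2 hup
    have hinvu : u⁻¹ * u = 1 := inv_mul_cancel₀ hup.ne'
    have hq1 : ∑ i, q i * e i = u⁻¹ * (∑ i, p i * e i) + (1 - u⁻¹) * (∑ i, ζ i * e i) := by
      have : (1 - u⁻¹) = u⁻¹ * (t * κ) := by rw [show t * κ = u - 1 by rw [hu]; ring]; linear_combination -hinvu
      rw [this]
      simp only [hq, Pi.smul_apply, Pi.add_apply, smul_eq_mul, Finset.mul_sum, ← Finset.sum_add_distrib]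
      exact Finset.sum_congr rfl fun i _ => by ring
    have b1 : (∑ i, q i * e i) ^ 2 ≤ (∑ i, p i * e i) ^ 2 + pnorm ζ ^ 2 * esq e := by
      have := dot_sq_le ζ e
      rw [hq1]
      set A := ∑ i, p i * e i
      set B := ∑ i, ζ i * e i
      have : (u⁻¹ * A + (1 - u⁻¹) * B) ^ 2 ≤ A ^ 2 + B ^ 2 := by
        have x1 : (u⁻¹ * A + (1 - u⁻¹) * B) ^ 2 = u⁻¹ * A ^ 2 + (1 - u⁻¹) * B^2
          - u⁻¹ * (1 - u⁻¹) * (A - B) ^ 2 := by ring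
        have x2 : 0 ≤ u⁻¹ * (1 - u⁻¹) * (A - B) ^ 2 :=
          mul_nonneg (mul_nonneg hinv0.le (by linarith)) (sq_nonneg _)
        nlinarith [sq_nonneg A, sq_nonneg B]
      linarith
    have hπq : π = (u * c) • q + (1 - u * c) • ζ := by
      rw [hπ, hq, smul_smul, show u * c * u⁻¹ = c by field_simp, smul_add, smul_smul]
      have : c * (t * κ) = u * c - c := by rw [hu]; ring
      rw [this, add_assoc, ← add_smul]; congr 2; ring
    have huc0 : 0 ≤ u * c := by positivity
    have b2 : pnorm π ≤ max (pnorm q) (pnorm ζ) := by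
      have h1 := pnorm_add_le ((u * c) • q) ((1 - u * c) • ζ)
      rw [← hπq, pnorm_smul (u * c) q, pnorm_smul (1 - u * c) ζ, abs_of_nonneg huc0, abs_of_nonneg (by linarith)] at h1
      have h2 := le_max_left (pnorm q) (pnorm ζ)
      have h3 := le_max_right (pnorm q) (pnorm ζ)
      have h4 := mul_le_mul_of_nonneg_left h2 huc0
      have h5 := mul_le_mul_of_nonneg_left h3 (by linarith : 0 ≤ 1 - u * c)
      linarith
    have b3 : pnorm π ^ m ≤ pnorm q ^ m + pnorm ζ ^ m := by
      have r1 := Real.rpow_nonneg (pnorm_nonneg q) m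
      have r2 := Real.rpow_nonneg (pnorm_nonneg ζ) m
      have r3 := Real.rpow_le_rpow (pnorm_nonneg π) b2 (by linarith : (0:ℝ) ≤ m)
      rcases le_total (pnorm q) (pnorm ζ) with h | h
      · rw [max_eq_right h] at r3; linarith
      · rw [max_eq_left h] at r3; linarith
    simp only [hGf]
    refine mul_le_mul_of_nonneg_left ?_ hκp.le
    have b4 : C * (∑ i, q i * e i) ^ 2 ≤ C * ((∑ i, p i * e i) ^ 2 + pnorm ζ ^ 2 * esq e) := by gcongr
    have b5 : (1 / C * esq e) * pnorm π ^ m ≤ (1 / C * esq e) * (pnorm q ^ m + pnorm ζ ^ m) :=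
      mul_le_mul_of_nonneg_left b3 (mul_nonneg (by positivity) (esq_nonneg e))
    nlinarith
  · rintro ⟨P, u⟩ hx hdiff
    have hup : 0 < u := hx
    set q := u⁻¹ • P with hq
    have hD : DiffInP L ξ s q := by
      intro i j
      have h1 : (fun y => L ξ s y i j) = fun y => (-u⁻¹) * M (u • y, u) i j := by
        ext y
        simp only [hM, smul_smul, inv_mul_cancel₀ hup.ne', one_smul, Matrix.smul_apply, smul_eq_mul]
        field_simp
      rw [h1]
      refine DifferentiableAt.const_mul ?_ _
      have h2 := hdiff i j
      have h3 : (P, u) = (u • q, u) := by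
        rw [hq, smul_smul, mul_inv_cancel₀ hup.ne', one_smul]
      rw [h3] at h2
      exact h2.comp q (f := fun y => (u • y, u)) (by fun_prop)
    have hfd : ∀ i j, fderiv ℝ (fun x => M x i j) (P, u) (κ • (ζ, (1:ℝ))) =
        κ * (fderiv ℝ (fun y => L ξ s y i j) q q - L ξ s q i j
          + fderiv ℝ (fun y => L ξ s y i j) q (-ζ)) := by
      intro i j
      have h1 := (hdiff i j).hasFDerivAt.comp_hasDerivAt_of_eq (0:ℝ)
        (f := fun t : ℝ => (P, u) + t • κ • (ζ, (1:ℝ))) (f' := κ • (ζ, (1:ℝ)))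
        (by simpa using ((hasDerivAt_id (0:ℝ)).smul_const (κ • (ζ, (1:ℝ)))).const_add (P, u)) (by simp)
      have h2 : HasDerivAt (fun t : ℝ => (u + t * κ)) κ 0 := by
        simpa using ((hasDerivAt_id (0:ℝ)).mul_const κ).const_add u
      have h3 : HasDerivAt (fun t : ℝ => P + (t * κ) • ζ) (κ • ζ) 0 := by
        simpa using (((hasDerivAt_id (0:ℝ)).mul_const κ).smul_const ζ).const_add P
      have h4 : HasDerivAt (fun t : ℝ => (u + t * κ)⁻¹) (-κ / u ^ 2) 0 := by
        simpa using h2.fun_inv (by simpa using hup.ne')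
      have h5 := h4.smul h3
      have h6 := (hD i j).hasFDerivAt.comp_hasDerivAt_of_eq (0:ℝ) h5 (by simp [hq])
      have h7 := h2.fun_neg.mul h6
      have h8 := h1.unique (f := fun t : ℝ => M ((P, u) + t • κ • (ζ, (1:ℝ))) i j) (x := (0:ℝ)) (f₁' := _)
        (by
          refine h7.congr_of_eventuallyEq (Eventually.of_forall fun t => ?_)
          simp [hM, smul_smul]; ring)
      rw [h8]
      simp only [zero_mul, add_zero, zero_smul, map_add, map_smul, map_neg, Function.comp]
      have h9 : fderiv ℝ (fun y => L ξ s y i j) q P = u * fderiv ℝ (fun y => L ξ s y i j) q q := by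
        have : P = u • q := by rw [hq, smul_smul, mul_inv_cancel₀ hup.ne', one_smul]
        conv_lhs => rw [this]
        rw [map_smul, smul_eq_mul]
      simp
      rw [h9, ← hq]
      field_simp
      ring
    have hm1 := qf_le_of_matLE (h q hD) e
    have hm2 := qf_pgrad_le L ξ s q (-ζ) e
    rw [pnorm_neg] at hm2
    have e1 : (Matrix.of fun i j => fderiv ℝ (fun x => M x i j) (P, u) (κ • (ζ, (1:ℝ))))
        = κ • (pDotGradL L ξ s q - L ξ s q + Matrix.of fun i j => fderiv ℝ (fun y => L ξ s y i j) q (-ζ)) := by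
      ext i j
      simp only [of_apply, hfd, Matrix.smul_apply, Matrix.add_apply, Matrix.sub_apply, pDotGradL, smul_eq_mul]
    rw [e1, qf_smul]
    simp only [hGf]
    refine mul_le_mul_of_nonneg_left ?_ hκp.le
    simp only [qf_add, qf_sub, qf_smul, qf_one, qf_vec] at hm1 ⊢
    have hpg : 0 ≤ pGradNorm L ξ s q := Real.sqrt_nonneg _
    have h10 : pGradNorm L ξ s q * pnorm ζ * esq e ≤ pGradNorm L ξ s q * (θ * Λ) * esq e := by
      have := esq_nonneg e
      gcongr
    nlinarith
end


section
variable {n : ℕ}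

/-- symplectic form -/
def om (ξ η : Heis n) : ℝ := ∑ i, (ξ.2.1 i * η.1 i - ξ.1 i * η.2.1 i)

lemma om_add_left (a b c : Heis n) : om (a + b) c = om a c + om b c := by
  simp only [om, Prod.fst_add, Prod.snd_add, Pi.add_apply, ← Finset.sum_add_distrib]
  exact Finset.sum_congr rfl fun i _ => by ring

lemma om_smul_left (t : ℝ) (a c : Heis n) : om (t • a) c = t * om a c := by
  simp only [om, Prod.smul_fst, Prod.smul_snd, Pi.smul_apply, smul_eq_mul, Finset.mul_sum]
  exact Finset.sum_congr rfl fun i _ => by ring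

lemma om_anti (a b : Heis n) : om a b = - om b a := by
  simp only [om, ← Finset.sum_neg_distrib]
  exact Finset.sum_congr rfl fun i _ => by ring

lemma om_add_right (a b c : Heis n) : om a (b + c) = om a b + om a c := by
  rw [om_anti, om_add_left, om_anti b, om_anti c]; ring

lemma om_smul_right (t : ℝ) (a c : Heis n) : om a (t • c) = t * om a c := by
  rw [om_anti, om_smul_left, om_anti c]; ring

lemma om_self (a : Heis n) : om a a = 0 := by
  have := om_anti a a; linarith

lemma om_congr {a b c d : Heis n} (h1 : a.1 = c.1) (h2 : a.2.1 = c.2.1) (h3 : b.1 = d.1)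
    (h4 : b.2.1 = d.2.1) : om a b = om c d := by
  simp only [om, h1, h2, h3, h4]

lemma hmul_eq (ξ η : Heis n) : hmul ξ η = ξ + η + ((0, 0, 2 * om ξ η) : Heis n) := by
  simp [hmul, om, Prod.ext_iff]

lemma hinv_eq (ξ : Heis n) : hinv ξ = -ξ := rfl

lemma om_neg_right (a c : Heis n) : om a (-c) = - om a c := by
  rw [← neg_one_smul ℝ, om_smul_right]; ring

lemma om_vert_left (a c : Heis n) (t : ℝ) : om (a + (0, 0, t)) c = om a c :=
  om_congr (by simp) (by simp) rfl rfl

lemma om_vert_right (a c : Heis n) (t : ℝ) : om a (c + (0, 0, t)) = om a c :=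
  om_congr rfl rfl (by simp) (by simp)

lemma om_vert (c : Heis n) (t : ℝ) : om (0, 0, t) c = 0 := by simp [om]

lemma hmul_cancel (a η : Heis n) : hmul (hmul a η) (hinv η) = a := by
  simp only [hmul_eq, hinv_eq, om_vert, om_add_left, om_neg_right, om_self]
  simp [Prod.ext_iff]
  ring

lemma hmul_cancel' (x μ : Heis n) : hmul (hmul x (hinv μ)) μ = x := by
  simp only [hmul_eq, hinv_eq, om_vert, om_add_left, om_neg_right]
  rw [← neg_one_smul ℝ μ, om_smul_left, om_self]
  simp [Prod.ext_iff]
  ring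

/-- horizontal direction -/
def hdir (η : Heis n) (e : HIdx n → ℝ) : Heis n :=
  (fun j => e (Sum.inl j), fun j => e (Sum.inr j),
    2 * ∑ j, (η.2.1 j * e (Sum.inl j) - η.1 j * e (Sum.inr j)))

/-- horizontal vector, without vertical component -/
def hvec (e : HIdx n → ℝ) : Heis n := (fun j => e (Sum.inl j), fun j => e (Sum.inr j), 0)

lemma hdir_eq (η : Heis n) (e : HIdx n → ℝ) : hdir η e = hvec e + ((0, 0, 2 * om η (hvec e)) : Heis n) := by
  simp [hdir, hvec, om, Prod.ext_iff]

lemma om_hdir (a η : Heis n) (e : HIdx n → ℝ) : om a (hdir η e) = om a (hvec e) := by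
  rw [hdir_eq, om_vert_right]

lemma hdir_line (η : Heis n) (e : HIdx n → ℝ) (t : ℝ) : hdir (η + t • hdir η e) e = hdir η e := by
  rw [hdir_eq, om_add_left, om_smul_left, om_anti (hdir η e), om_hdir, om_self]
  conv_rhs => rw [hdir_eq]
  simp

lemma hmul_line (a η : Heis n) (e : HIdx n → ℝ) (t : ℝ) :
    hmul a (η + t • hdir η e) = hmul a η + t • hdir (hmul a η) e := by
  rw [hmul_eq, hmul_eq, om_add_right, om_smul_right, om_hdir]
  conv_lhs => rw [hdir_eq]
  conv_rhs => rw [hdir_eq, om_vert_left, om_add_left]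
  simp only [Prod.ext_iff]
  refine ⟨by simp [add_assoc], by simp [add_assoc], ?_⟩
  simp
  ring

lemma hdir_sum (η : Heis n) (e : HIdx n → ℝ) : hdir η e = ∑ j, e j • vecField j η := by
  rw [Fintype.sum_sum_type]
  refine Prod.ext ?_ (Prod.ext ?_ ?_)
  · ext k
    simp [hdir, vecField, Prod.fst_sum, Finset.sum_apply, Pi.single_apply]
  · ext k
    simp [hdir, vecField, Prod.fst_sum, Prod.snd_sum, Finset.sum_apply, Pi.single_apply]
  · simp only [hdir, vecField, Prod.snd_add, Prod.snd_sum, Prod.smul_snd, smul_eq_mul, Finset.mul_sum,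
      ← Finset.sum_add_distrib]
    exact Finset.sum_congr rfl fun i _ => by ring

lemma hGrad_dot (u : Heis n → ℝ) (η : Heis n) (e : HIdx n → ℝ) :
    ∑ j, hGrad u η j * e j = fderiv ℝ u η (hdir η e) := by
  rw [hdir_sum, map_sum]
  exact Finset.sum_congr rfl fun i _ => by rw [map_smul, hGrad, smul_eq_mul, mul_comm]

lemma qf_transpose (A : HMat n) (e : HIdx n → ℝ) : qf Aᵀ e = qf A e := by
  simp only [qf, transpose_apply]
  rw [Finset.sum_comm]
  exact Finset.sum_congr rfl fun i _ => Finset.sum_congr rfl fun j _ => by ring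

lemma qf_hHessSym (u : Heis n → ℝ) (η : Heis n) (e : HIdx n → ℝ) :
    qf (hHessSym u η) e = qf (hHess u η) e := by
  rw [hHessSym, qf_smul, qf_add, qf_transpose]; ring

lemma contDiff_vecField (j : HIdx n) : ContDiff ℝ 2 (vecField j : Heis n → Heis n) := by
  rcases j with j | j
  · have : (vecField (Sum.inl j) : Heis n → Heis n) = fun ξ => (Pi.single j 1, 0, 2 * ξ.2.1 j) := rfl
    rw [this]; fun_prop
  · have : (vecField (Sum.inr j) : Heis n → Heis n) = fun ξ => (0, Pi.single j 1, -(2 * ξ.1 j)) := rfl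
    rw [this]; fun_prop

lemma qf_hHess_eq {u : Heis n → ℝ} {η : Heis n} (hu : ContDiffAt ℝ 2 u η) (e : HIdx n → ℝ) :
    HasDerivAt (fun t : ℝ => fderiv ℝ u (η + t • hdir η e) (hdir η e)) (qf (hHessSym u η) e) 0 := by
  rw [qf_hHessSym]
  have hd : DifferentiableAt ℝ (fderiv ℝ u) η :=
    (hu.fderiv_right (m := 1) (by norm_num)).differentiableAt (by norm_num)
  have hi : ∀ i, DifferentiableAt ℝ (fun ζ => fderiv ℝ u ζ (vecField i ζ)) η := fun i =>
    hd.clm_apply ((contDiff_vecField i).differentiable (by norm_num) η)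
  have hsum : HasFDerivAt (fun ζ => ∑ i, e i * fderiv ℝ u ζ (vecField i ζ))
      (∑ i, e i • fderiv ℝ (fun ζ => fderiv ℝ u ζ (vecField i ζ)) η) η :=
    HasFDerivAt.fun_sum fun i _ => ((hi i).hasFDerivAt.const_mul (e i))
  have hline : HasDerivAt (fun t : ℝ => η + t • hdir η e) (hdir η e) 0 := by
    simpa using ((hasDerivAt_id (0:ℝ)).smul_const (hdir η e)).const_add η
  have h := hsum.comp_hasDerivAt_of_eq (0:ℝ) hline (by simp)
  have e1 : (fun t : ℝ => fderiv ℝ u (η + t • hdir η e) (hdir η e)) =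
      (fun ζ => ∑ i, e i * fderiv ℝ u ζ (vecField i ζ)) ∘ (fun t : ℝ => η + t • hdir η e) := by
    ext t
    simp only [Function.comp]
    have h0 : fderiv ℝ u (η + t • hdir η e) (hdir η e) =
      fderiv ℝ u (η + t • hdir η e) (hdir (η + t • hdir η e) e) := by rw [hdir_line]
    rw [h0, hdir_sum (η + t • hdir η e), map_sum]
    simp only [map_smul, smul_eq_mul]
  rw [e1]
  refine h.congr_deriv ?_
  symm
  simp only [_root_.sum_apply, _root_.smul_apply, smul_eq_mul, qf, hHess, of_apply]
  refine Finset.sum_congr rfl fun i _ => ?_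
  rw [hdir_sum, map_sum, Finset.mul_sum]
  refine Finset.sum_congr rfl fun j _ => ?_
  rw [map_smul, smul_eq_mul]; ring

lemma horiz_jet {u : Heis n → ℝ} {η : Heis n} (hu : ContDiffAt ℝ 2 u η) (e : HIdx n → ℝ)
    {g1 : ℝ → ℝ} {g2 : ℝ}
    (h1 : ∀ t, HasDerivAt (fun t : ℝ => u (η + t • hdir η e)) (g1 t) t) (h2 : HasDerivAt g1 g2 0) :
    ∑ j, hGrad u η j * e j = g1 0 ∧ qf (hHessSym u η) e = g2 := by
  have hline : ∀ t, HasDerivAt (fun t : ℝ => η + t • hdir η e) (hdir η e) t := fun t => by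
    simpa using ((hasDerivAt_id t).smul_const (hdir η e)).const_add η
  have hev : ∀ᶠ t : ℝ in 𝓝 0, fderiv ℝ u (η + t • hdir η e) (hdir η e) = g1 t := by
    have hc : Tendsto (fun t : ℝ => η + t • hdir η e) (𝓝 0) (𝓝 η) := by
      have : Continuous (fun t : ℝ => η + t • hdir η e) := by fun_prop
      simpa using this.tendsto 0
    filter_upwards [hc.eventually (hu.eventually (by simp))] with t ht
    exact ((ht.differentiableAt (by norm_num)).hasFDerivAt.comp_hasDerivAt t (hline t)).unique (h1 t)
  refine ⟨?_, ?_⟩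
  · rw [hGrad_dot, ← hev.self_of_nhds]; simp
  · exact (qf_hHess_eq hu e).unique (h2.congr_of_eventuallyEq hev)
end


section
variable {n : ℕ}

/-- quadratic penalization -/
def Nn (ζ : Heis n) : ℝ := zsq ζ + ζ.2.2 ^ 2

lemma zsq_nonneg (ζ : Heis n) : 0 ≤ zsq ζ :=
  Finset.sum_nonneg fun _ _ => add_nonneg (sq_nonneg _) (sq_nonneg _)

lemma Nn_nonneg (ζ : Heis n) : 0 ≤ Nn ζ := add_nonneg (zsq_nonneg ζ) (sq_nonneg _)

lemma continuous_Nn : Continuous (Nn : Heis n → ℝ) := by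
  unfold Nn zsq; fun_prop

lemma continuous_om : Continuous (fun z : Heis n × Heis n => om z.1 z.2) := by
  unfold om; fun_prop

lemma continuous_hmul : Continuous (fun z : Heis n × Heis n => hmul z.1 z.2) := by
  unfold hmul; fun_prop

lemma continuous_hinv : Continuous (hinv : Heis n → Heis n) := by
  unfold hinv; fun_prop

lemma coord1_le (h : Heis n) (i : Fin n) : |h.1 i| ≤ ‖h‖ :=
  (norm_le_pi_norm h.1 i).trans (norm_fst_le h)

lemma coord2_le (h : Heis n) (i : Fin n) : |h.2.1 i| ≤ ‖h‖ :=
  (norm_le_pi_norm h.2.1 i).trans ((norm_fst_le h.2).trans (norm_snd_le h))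

lemma coord3_le (h : Heis n) : |h.2.2| ≤ ‖h‖ := (norm_snd_le h.2).trans (norm_snd_le h)

lemma abs_om_le (a b : Heis n) : |om a b| ≤ 2 * n * ‖a‖ * ‖b‖ := by
  unfold om
  refine (Finset.abs_sum_le_sum_abs _ _).trans ?_
  have : ∀ i ∈ (Finset.univ : Finset (Fin n)), |a.2.1 i * b.1 i - a.1 i * b.2.1 i| ≤ 2 * ‖a‖ * ‖b‖ := by
    intro i _
    refine (abs_sub _ _).trans ?_
    rw [abs_mul, abs_mul]
    have h1 : |a.2.1 i| * |b.1 i| ≤ ‖a‖ * ‖b‖ :=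
      mul_le_mul (coord2_le a i) (coord1_le b i) (abs_nonneg _) (norm_nonneg _)
    have h2 : |a.1 i| * |b.2.1 i| ≤ ‖a‖ * ‖b‖ :=
      mul_le_mul (coord1_le a i) (coord2_le b i) (abs_nonneg _) (norm_nonneg _)
    linarith
  refine (Finset.sum_le_card_nsmul _ _ _ this).trans (le_of_eq ?_)
  simp; ring

lemma zsq_le (h : Heis n) : zsq h ≤ 2 * n * ‖h‖ ^ 2 := by
  unfold zsq
  have : ∀ i ∈ (Finset.univ : Finset (Fin n)), h.1 i ^ 2 + h.2.1 i ^ 2 ≤ 2 * ‖h‖ ^ 2 := by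
    intro i _
    have h1 := coord1_le h i
    have h2 := coord2_le h i
    rw [← sq_abs (h.1 i), ← sq_abs (h.2.1 i)]
    have := pow_le_pow_left₀ (abs_nonneg _) h1 2
    have := pow_le_pow_left₀ (abs_nonneg _) h2 2
    linarith
  refine (Finset.sum_le_card_nsmul _ _ _ this).trans (le_of_eq ?_)
  simp; ring

/-- polar form of `Nn` -/
def pol (a b : Heis n) : ℝ := ∑ i, (a.1 i * b.1 i + a.2.1 i * b.2.1 i) + a.2.2 * b.2.2

lemma Nn_add (a b : Heis n) : Nn (a + b) = Nn a + 2 * pol a b + Nn b := by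
  have : zsq (a + b) = zsq a + 2 * (∑ i, (a.1 i * b.1 i + a.2.1 i * b.2.1 i)) + zsq b := by
    simp only [zsq, Finset.mul_sum, ← Finset.sum_add_distrib]
    exact Finset.sum_congr rfl fun i _ => by simp; ring
  simp only [Nn, this, pol, Prod.snd_add]
  ring

lemma pol_add (a b c : Heis n) : pol a (b + c) = pol a b + pol a c := by
  have : ∑ i, (a.1 i * (b + c).1 i + a.2.1 i * (b + c).2.1 i) =
     (∑ i, (a.1 i * b.1 i + a.2.1 i * b.2.1 i)) + ∑ i, (a.1 i * c.1 i + a.2.1 i * c.2.1 i) := by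
    simp only [← Finset.sum_add_distrib]
    exact Finset.sum_congr rfl fun i _ => by simp; ring
  unfold pol
  rw [this]
  simp only [Prod.snd_add]
  ring

lemma pol_smul (a b : Heis n) (t : ℝ) : pol a (t • b) = t * pol a b := by
  have : ∑ i, (a.1 i * (t • b).1 i + a.2.1 i * (t • b).2.1 i) =
     t * (∑ i, (a.1 i * b.1 i + a.2.1 i * b.2.1 i)) := by
    simp only [Finset.mul_sum]
    exact Finset.sum_congr rfl fun i _ => by simp; ring
  unfold pol
  rw [this]
  simp only [Prod.smul_snd, smul_eq_mul]
  ring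

/-- linear part of right translation -/
def rlin (μ h : Heis n) : Heis n := h + ((0, 0, 2 * om h μ) : Heis n)

lemma rlin_add (μ a b : Heis n) : rlin μ (a + b) = rlin μ a + rlin μ b := by
  simp only [rlin, om_add_left]
  refine Prod.ext ?_ (Prod.ext ?_ ?_)
  · simp
  · simp
  · simp; ring

lemma rlin_smul (μ a : Heis n) (t : ℝ) : rlin μ (t • a) = t • rlin μ a := by
  simp only [rlin, om_smul_left]
  refine Prod.ext ?_ (Prod.ext ?_ ?_)
  · simp
  · simp
  · simp; ring

lemma hmul_rlin (z x μ : Heis n) : hmul z μ = hmul x μ + rlin μ (z - x) := by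
  have : om z μ = om x μ + om (z - x) μ := by rw [← om_add_left]; simp
  rw [hmul_eq, hmul_eq, this, rlin]
  refine Prod.ext ?_ (Prod.ext ?_ ?_)
  · simp; abel
  · simp; abel
  · simp; ring

lemma Nn_rlin_le {M : ℝ} (μ h : Heis n) (hμ : ‖μ‖ ≤ M) :
    Nn (rlin μ h) ≤ (2 * n + (1 + 4 * n * M) ^ 2) * ‖h‖ ^ 2 := by
  have h1 : Nn (rlin μ h) = zsq h + (h.2.2 + 2 * om h μ) ^ 2 := by
    simp [Nn, rlin, zsq]
  have h2 : |h.2.2 + 2 * om h μ| ≤ (1 + 4 * n * M) * ‖h‖ := by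
    refine (abs_add_le _ _).trans ?_
    rw [abs_mul, abs_two]
    have a1 := coord3_le h
    have a2 := abs_om_le h μ
    have a3 : 2 * n * ‖h‖ * ‖μ‖ ≤ 2 * n * ‖h‖ * M := by gcongr
    nlinarith
  have h3 := pow_le_pow_left₀ (abs_nonneg _) h2 2
  rw [sq_abs] at h3
  have := zsq_le h
  rw [h1]; nlinarith

lemma hinv_norm (μ : Heis n) : ‖hinv μ‖ = ‖μ‖ := by rw [hinv_eq, norm_neg]

lemma env_exists {K : Set (Heis n)} (hK : IsCompact K) (hKne : K.Nonempty) {f : Heis n → ℝ}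
    (hf : UpperSemicontinuousOn f K) {Λ : ℝ} (hΛ : 0 < Λ) :
    ∃ (F : Heis n → ℝ) (μ : Heis n → Heis n) (k : ℝ),
      (∀ ξ, μ ξ ∈ K ∧ F ξ = f (μ ξ) - Λ * Nn (hmul ξ (hinv (μ ξ)))) ∧
      (∀ ξ, ∀ η ∈ K, f η - Λ * Nn (hmul ξ (hinv η)) ≤ F ξ) ∧ 0 ≤ k ∧ SemiSub k F := by
  have hmax : ∀ ξ : Heis n, ∃ η ∈ K, ∀ η' ∈ K, f η' - Λ * Nn (hmul ξ (hinv η')) ≤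
      f η - Λ * Nn (hmul ξ (hinv η)) := by
    intro ξ
    have hc : Continuous (fun η : Heis n => - (Λ * Nn (hmul ξ (hinv η)))) := by
      have h1 : Continuous (fun η : Heis n => hmul ξ (hinv η)) :=
        continuous_hmul.comp (continuous_const.prodMk continuous_hinv)
      exact (continuous_const.mul (continuous_Nn.comp h1)).neg
    have hu : UpperSemicontinuousOn (fun η => f η + - (Λ * Nn (hmul ξ (hinv η)))) K :=
      hf.add (hc.upperSemicontinuous.upperSemicontinuousOn K)
    obtain ⟨η, hη, hmx⟩ := hu.exists_isMaxOn hKne hK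
    refine ⟨η, hη, fun η' hη' => ?_⟩
    have := hmx hη'
    simpa [sub_eq_add_neg] using this
  choose μ hμK hμmax using hmax
  obtain ⟨M, hM⟩ := hK.isBounded.exists_norm_le
  refine ⟨fun ξ => f (μ ξ) - Λ * Nn (hmul ξ (hinv (μ ξ))), μ, Λ * (2 * n + (1 + 4 * n * M) ^ 2),
    fun ξ => ⟨hμK ξ, rfl⟩, fun ξ η hη => hμmax ξ η hη, by positivity, ?_⟩
  intro x
  set a := hmul x (hinv (μ x)) with ha
  let l : Heis n →ₗ[ℝ] ℝ :=
    { toFun := fun h => -(2 * Λ) * pol a (rlin (hinv (μ x)) h)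
      map_add' := fun h h' => by simp only [rlin_add, pol_add]; ring
      map_smul' := fun t h => by simp only [rlin_smul, pol_smul, smul_eq_mul, RingHom.id_apply]; ring }
  refine ⟨LinearMap.toContinuousLinearMap l, fun z => ?_⟩
  have h1 := hμmax z (μ x) (hμK x)
  rw [hmul_rlin z x, ← ha, Nn_add] at h1
  have h2 := Nn_rlin_le (hinv (μ x)) (z - x) (M := M) (by rw [hinv_norm]; exact hM _ (hμK x))
  have h3 : LinearMap.toContinuousLinearMap l (z - x) = -(2 * Λ) * pol a (rlin (hinv (μ x)) (z - x)) := rfl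
  have h4 := mul_le_mul_of_nonneg_left h2 hΛ.le
  rw [h3]
  dsimp only
  rw [← ha]
  nlinarith

lemma env_jet {K : Set (Heis n)} {f F : Heis n → ℝ} {Λ : ℝ} {x μ : Heis n}
    (h1 : F x = f μ - Λ * Nn (hmul x (hinv μ)))
    (h2 : ∀ ξ, ∀ η ∈ K, f η - Λ * Nn (hmul ξ (hinv η)) ≤ F ξ)
    {p : Heis n →L[ℝ] ℝ} {B : Heis n →L[ℝ] Heis n →L[ℝ] ℝ}
    (h3 : ∀ᶠ z in 𝓝 x, F z ≤ F x + p (z - x) + B (z - x) (z - x)) :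
    ∀ᶠ η in 𝓝 μ, η ∈ K → f η ≤ f μ + p (hmul (hmul x (hinv μ)) η - x)
      + B (hmul (hmul x (hinv μ)) η - x) (hmul (hmul x (hinv μ)) η - x) := by
  have hc : Tendsto (fun η => hmul (hmul x (hinv μ)) η) (𝓝 μ) (𝓝 x) := by
    have : Continuous (fun η => hmul (hmul x (hinv μ)) η) :=
      continuous_hmul.comp (continuous_const.prodMk continuous_id)
    have h := this.tendsto μ
    simpa only [hmul_cancel'] using h
  filter_upwards [hc.eventually h3] with η hη hηK
  have := h2 (hmul (hmul x (hinv μ)) η) η hηK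
  rw [hmul_cancel] at this
  linarith

lemma norm_le_of_Nn {x μ : Heis n} {r M : ℝ} (hr : 0 ≤ r) (hμ : ‖μ‖ ≤ M)
    (h : Nn (hmul x (hinv μ)) ≤ r ^ 2) : ‖x - μ‖ ≤ (1 + 4 * n * M) * r := by
  have hM : 0 ≤ M := (norm_nonneg _).trans hμ
  have hN := h
  simp only [Nn] at hN
  have hz0 := zsq_nonneg (hmul x (hinv μ))
  have hzle : zsq (hmul x (hinv μ)) ≤ r ^ 2 := by nlinarith [sq_nonneg (hmul x (hinv μ)).2.2]
  have ht : |(hmul x (hinv μ)).2.2| ≤ r := abs_le_of_sq_le_sq (by linarith) hr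
  have hone : (r : ℝ) ≤ (1 + 4 * n * M) * r := by
    have : 0 ≤ 4 * n * M * r := by positivity
    nlinarith
  have hc : ∀ i, |(x - μ).1 i| ≤ r ∧ |(x - μ).2.1 i| ≤ r := by
    intro i
    have h1 : (hmul x (hinv μ)).1 i = (x - μ).1 i := by simp [hmul, hinv, sub_eq_add_neg]
    have h2 : (hmul x (hinv μ)).2.1 i = (x - μ).2.1 i := by simp [hmul, hinv, sub_eq_add_neg]
    have h3 : (hmul x (hinv μ)).1 i ^ 2 + (hmul x (hinv μ)).2.1 i ^ 2 ≤ zsq (hmul x (hinv μ)) :=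
      Finset.single_le_sum (f := fun i => (hmul x (hinv μ)).1 i ^ 2 + (hmul x (hinv μ)).2.1 i ^ 2)
        (fun i _ => add_nonneg (sq_nonneg _) (sq_nonneg _)) (Finset.mem_univ i)
    rw [h1, h2] at h3
    exact ⟨abs_le_of_sq_le_sq (by nlinarith [sq_nonneg ((x - μ).2.1 i)]) hr,
      abs_le_of_sq_le_sq (by nlinarith [sq_nonneg ((x - μ).1 i)]) hr⟩
  -- horizontal part of x - μ
  set h0 : Heis n := ((x - μ).1, (x - μ).2.1, 0) with hh0
  have hn0 : ‖h0‖ ≤ r := by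
    rw [hh0]
    refine (norm_prod_le_iff).2 ⟨(pi_norm_le_iff_of_nonneg hr).2 fun i => (hc i).1, ?_⟩
    exact norm_prod_le_iff.2 ⟨(pi_norm_le_iff_of_nonneg hr).2 fun i => (hc i).2, by simpa using hr⟩
  have hom : om x μ = om h0 μ := by
    have : om x μ = om (x - μ) μ + om μ μ := by rw [← om_add_left]; simp
    rw [this, om_self, add_zero]
    exact om_congr rfl rfl rfl rfl
  have h3 : (hmul x (hinv μ)).2.2 = (x - μ).2.2 - 2 * om h0 μ := by
    rw [← hom, hmul_eq, hinv_eq, om_neg_right]; simp; ring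
  have h4 := abs_om_le h0 μ
  have h5 : 2 * n * ‖h0‖ * ‖μ‖ ≤ 2 * n * r * M := by gcongr
  have h6 : |(x - μ).2.2| ≤ (1 + 4 * n * M) * r := by
    have e : (x - μ).2.2 = (hmul x (hinv μ)).2.2 + 2 * om h0 μ := by rw [h3]; ring
    rw [e]
    refine (abs_add_le _ _).trans ?_
    rw [abs_mul, abs_two]
    nlinarith
  have hR : 0 ≤ (1 + 4 * n * M) * r := hr.trans hone
  refine (norm_prod_le_iff).2 ⟨(pi_norm_le_iff_of_nonneg hR).2 fun i => ((hc i).1).trans hone, ?_⟩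
  exact norm_prod_le_iff.2 ⟨(pi_norm_le_iff_of_nonneg hR).2 fun i => ((hc i).2).trans hone, h6⟩
end

section
variable {n : ℕ}

lemma SemiSub.mono {V : Type*} [NormedAddCommGroup V] [NormedSpace ℝ V] {k k' : ℝ} {F : V → ℝ}
    (h : SemiSub k F) (hk : k ≤ k') : SemiSub k' F := by
  intro x
  obtain ⟨p, hp⟩ := h x
  refine ⟨p, fun z => le_trans ?_ (hp z)⟩
  have : k * ‖z - x‖ ^ 2 ≤ k' * ‖z - x‖ ^ 2 := by gcongr
  linarith

/-- the strictifying change of variable -/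
def Hf (δ β u : ℝ) : ℝ := u - δ * Real.exp (-(β * u))

/-- its derivative -/
def Hf1 (δ β u : ℝ) : ℝ := 1 + δ * β * Real.exp (-(β * u))

lemma Hf_deriv (δ β u : ℝ) : HasDerivAt (Hf δ β) (Hf1 δ β u) u := by
  have h1 : HasDerivAt (fun u : ℝ => -(β * u)) (-β) u := by
    exact (((hasDerivAt_id u).const_mul β).neg).congr_deriv (by simp)
  have h2 := (hasDerivAt_id u).sub ((h1.exp).const_mul δ)
  refine h2.congr_deriv ?_
  simp only [Hf1]; ring

lemma Hf1_deriv (δ β u : ℝ) : HasDerivAt (Hf1 δ β) (-(β * (Hf1 δ β u - 1))) u := by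
  have h1 : HasDerivAt (fun u : ℝ => -(β * u)) (-β) u := by
    exact (((hasDerivAt_id u).const_mul β).neg).congr_deriv (by simp)
  have h2 := ((h1.exp).const_mul (δ * β)).const_add 1
  refine h2.congr_deriv ?_
  simp only [Hf1]; ring

lemma Hf_contDiff (δ β : ℝ) : ContDiff ℝ 2 (Hf δ β) := by
  unfold Hf; fun_prop

lemma Hf_strictMono {δ β : ℝ} (hδ : 0 < δ) (hβ : 0 < β) : StrictMono (Hf δ β) := by
  intro a b hab
  have : Real.exp (-(β * b)) < Real.exp (-(β * a)) := by
    apply Real.exp_lt_exp.2; nlinarith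
  simp only [Hf]; nlinarith

lemma Hf_surj {δ β : ℝ} (hδ : 0 < δ) (hβ : 0 < β) : Function.Surjective (Hf δ β) := by
  intro y
  have hc : Continuous (Hf δ β) := (Hf_contDiff δ β).continuous
  -- lower point
  have h1 : Hf δ β y ≤ y := by
    simp only [Hf]; have := Real.exp_pos (-(β * y)); nlinarith
  have h2 : y ≤ Hf δ β (y + δ * Real.exp (-(β * y))) := by
    simp only [Hf]
    have : Real.exp (-(β * (y + δ * Real.exp (-(β * y))))) ≤ Real.exp (-(β * y)) := by
      apply Real.exp_le_exp.2
      have := Real.exp_pos (-(β * y))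
      have : 0 ≤ β * (δ * Real.exp (-(β * y))) := by positivity
      nlinarith
    nlinarith
  exact mem_range_of_exists_le_of_exists_ge hc ⟨_, h1⟩ ⟨_, h2⟩

lemma Hf_inv {δ β : ℝ} (hδ : 0 < δ) (hβ : 0 < β) : ∃ K : ℝ → ℝ, (∀ u, Hf δ β (K u) = u) ∧
    Monotone K ∧ Continuous K ∧ (∀ u, u ≤ K u) ∧ (∀ u, K u ≤ u + δ * Real.exp (-(β * u))) := by
  let o := StrictMono.orderIsoOfSurjective (Hf δ β) (Hf_strictMono hδ hβ) (Hf_surj hδ hβ)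
  have h1 : ∀ u, Hf δ β (o.symm u) = u := fun u => o.apply_symm_apply u
  have h2 : ∀ u, u ≤ o.symm u := fun u => by
    have := h1 u
    simp only [Hf] at this
    have := Real.exp_pos (-(β * o.symm u))
    nlinarith
  refine ⟨o.symm, h1, o.symm.monotone, o.symm.continuous, h2, fun u => ?_⟩
  have h3 := h1 u
  simp only [Hf] at h3
  have : Real.exp (-(β * o.symm u)) ≤ Real.exp (-(β * u)) := by
    apply Real.exp_le_exp.2; nlinarith [h2 u]
  nlinarith

/-- horizontal part as an element of `ℝ^{2n}` -/
def hz (η : Heis n) : HIdx n → ℝ := Sum.elim η.1 η.2.1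

lemma zsq_eq (η : Heis n) : zsq η = esq (hz η) := by
  simp [zsq, esq, hz, Fintype.sum_sum_type, Finset.sum_add_distrib]

lemma zsq_line (η : Heis n) (e : HIdx n → ℝ) (t : ℝ) :
    zsq (η + t • hdir η e) = zsq η + t * (2 * ∑ j, hz η j * e j) + t ^ 2 * esq e := by
  rw [zsq_eq, zsq_eq]
  simp only [esq, Finset.mul_sum, ← Finset.sum_add_distrib]
  refine Finset.sum_congr rfl fun j _ => ?_
  rcases j with j | j <;> simp [hz, hdir] <;> ring

lemma dot_ext {p q : HIdx n → ℝ} (h : ∀ e : HIdx n → ℝ, ∑ j, p j * e j = ∑ j, q j * e j) : p = q := by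
  ext k
  simpa [Pi.single_apply] using h (Pi.single k 1)

/-- inner test function -/
def Atest (α τ : ℝ) (a x : Heis n) (p : Heis n →L[ℝ] ℝ) (B : Heis n →L[ℝ] Heis n →L[ℝ] ℝ)
    (η : Heis n) : ℝ :=
  α + p (hmul a η - x) + B (hmul a η - x) (hmul a η - x) - τ * zsq η

lemma Atest_contDiff (α τ : ℝ) (a x : Heis n) (p : Heis n →L[ℝ] ℝ)
    (B : Heis n →L[ℝ] Heis n →L[ℝ] ℝ) : ContDiff ℝ 2 (Atest α τ a x p B) := by
  have h1 : ContDiff ℝ 2 (fun η : Heis n => hmul a η - x) := by unfold hmul; fun_prop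
  have h2 : ContDiff ℝ 2 (zsq : Heis n → ℝ) := by unfold zsq; fun_prop
  unfold Atest
  have h3 : ContDiff ℝ 2 (fun η : Heis n => B (hmul a η - x) (hmul a η - x)) :=
    (B.contDiff.comp h1).clm_apply h1
  have h4 : ContDiff ℝ 2 (fun η : Heis n => p (hmul a η - x)) := p.contDiff.comp h1
  exact ((contDiff_const.add h4).add h3).sub (contDiff_const.mul h2)

lemma test_jet {G G1 : ℝ → ℝ} {G2 : ℝ} (hG : ContDiff ℝ 2 G) (hG1 : ∀ u, HasDerivAt G (G1 u) u)
    (α τ : ℝ) (a x η : Heis n) (hx : hmul a η = x) (p : Heis n →L[ℝ] ℝ)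
    (B : Heis n →L[ℝ] Heis n →L[ℝ] ℝ) (hG2 : HasDerivAt G1 G2 (α - τ * zsq η))
    (e : HIdx n → ℝ) :
    ∑ j, hGrad (fun ζ => G (Atest α τ a x p B ζ)) η j * e j
      = G1 (α - τ * zsq η) * (p (hdir x e) - 2 * τ * ∑ j, hz η j * e j) ∧
    qf (hHessSym (fun ζ => G (Atest α τ a x p B ζ)) η) e
      = G2 * (p (hdir x e) - 2 * τ * ∑ j, hz η j * e j) ^ 2
        + G1 (α - τ * zsq η) * (2 * B (hdir x e) (hdir x e) - 2 * τ * esq e) := by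
  set b := p (hdir x e) - 2 * τ * ∑ j, hz η j * e j with hb
  set d := B (hdir x e) (hdir x e) - τ * esq e with hd
  set u0 := α - τ * zsq η with hu0
  have hcd : ContDiffAt ℝ 2 (fun ζ => G (Atest α τ a x p B ζ)) η :=
    (hG.comp (Atest_contDiff α τ a x p B)).contDiffAt
  have hA : ∀ t : ℝ, Atest α τ a x p B (η + t • hdir η e) = u0 + t * b + t ^ 2 * d := by
    intro t
    simp only [Atest, hmul_line, hx, zsq_line, add_sub_cancel_left, map_smul, _root_.smul_apply,
      smul_eq_mul, hb, hd, hu0]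
    ring
  have hl : ∀ t : ℝ, HasDerivAt (fun t : ℝ => u0 + t * b + t ^ 2 * d) (b + 2 * t * d) t := by
    intro t
    have := (((hasDerivAt_id t).mul_const b).const_add u0).add (((hasDerivAt_id t).pow 2).mul_const d)
    refine this.congr_deriv ?_
    simp
  have h1 : ∀ t, HasDerivAt (fun t : ℝ => G (Atest α τ a x p B (η + t • hdir η e)))
      (G1 (u0 + t * b + t ^ 2 * d) * (b + 2 * t * d)) t := by
    intro t
    simp only [hA]
    exact (hG1 _).comp t (hl t)
  have h2 : HasDerivAt (fun t : ℝ => G1 (u0 + t * b + t ^ 2 * d) * (b + 2 * t * d))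
      (G2 * b * b + G1 u0 * (2 * d)) 0 := by
    have a1 : HasDerivAt (fun t : ℝ => G1 (u0 + t * b + t ^ 2 * d)) (G2 * b) 0 := by
      have := HasDerivAt.comp_of_eq (0:ℝ) hG2 (hl 0) (by simp)
      exact this.congr_deriv (by simp)
    have a2 : HasDerivAt (fun t : ℝ => b + 2 * t * d) (2 * d) 0 := by
      have := ((((hasDerivAt_id (0:ℝ)).const_mul 2).mul_const d).const_add b)
      simpa using this
    have := a1.mul a2
    refine this.congr_deriv ?_
    simp
  obtain ⟨r1, r2⟩ := horiz_jet hcd e h1 h2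
  refine ⟨by rw [r1]; simp, by rw [r2, hd]; ring⟩

lemma coord_le_pnorm (e : HIdx n → ℝ) (j : HIdx n) : |e j| ≤ pnorm e := by
  refine abs_le_of_sq_le_sq ?_ (pnorm_nonneg e)
  rw [pnorm_sq]
  exact Finset.single_le_sum (f := fun j => e j ^ 2) (fun _ _ => sq_nonneg _) (Finset.mem_univ j)

lemma norm_hdir_le {M : ℝ} (x : Heis n) (hx : ‖x‖ ≤ M) (e : HIdx n → ℝ) :
    ‖hdir x e‖ ≤ (1 + 4 * n * M) * pnorm e := by
  have hM : 0 ≤ M := (norm_nonneg _).trans hx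
  have hp := pnorm_nonneg e
  have hv : ‖hvec e‖ ≤ pnorm e := by
    refine norm_prod_le_iff.2 ⟨(pi_norm_le_iff_of_nonneg hp).2 fun i => coord_le_pnorm e _, ?_⟩
    exact norm_prod_le_iff.2 ⟨(pi_norm_le_iff_of_nonneg hp).2 fun i => coord_le_pnorm e _,
      by simpa [hvec] using hp⟩
  rw [hdir_eq]
  have h2 : ‖((0, 0, 2 * om x (hvec e)) : Heis n)‖ ≤ 4 * n * M * pnorm e := by
    have h0 : 0 ≤ 4 * n * M * pnorm e := by positivity
    refine norm_prod_le_iff.2 ⟨by simpa using h0, norm_prod_le_iff.2 ⟨by simpa using h0, ?_⟩⟩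
    have h4 := abs_om_le x (hvec e)
    have h5 : 2 * n * ‖x‖ * ‖hvec e‖ ≤ 2 * n * M * pnorm e := by gcongr
    simp only [Real.norm_eq_abs, abs_mul, abs_two]
    linarith
  refine (norm_add_le _ _).trans ?_
  linarith

/-- horizontal components of a covector -/
def hcov (p : Heis n →L[ℝ] ℝ) (x : Heis n) : HIdx n → ℝ := fun j => p (vecField j x)

lemma hcov_dot (p : Heis n →L[ℝ] ℝ) (x : Heis n) (e : HIdx n → ℝ) :
    ∑ j, hcov p x j * e j = p (hdir x e) := by
  rw [hdir_sum, map_sum]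
  exact Finset.sum_congr rfl fun i _ => by rw [map_smul, hcov, smul_eq_mul, mul_comm]

lemma pnorm_hcov_le {M : ℝ} (p : Heis n →L[ℝ] ℝ) (x : Heis n) (hx : ‖x‖ ≤ M) :
    pnorm (hcov p x) ≤ ‖p‖ * (1 + 4 * n * M) := by
  have hM : 0 ≤ M := (norm_nonneg _).trans hx
  set r := hcov p x with hr
  have h1 : pnorm r ^ 2 = p (hdir x r) := by
    rw [pnorm_sq, ← hcov_dot, esq, ← hr]; exact Finset.sum_congr rfl fun i _ => by ring
  have h2 : p (hdir x r) ≤ ‖p‖ * ((1 + 4 * n * M) * pnorm r) :=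
    (le_abs_self _).trans ((p.le_opNorm _).trans
      (mul_le_mul_of_nonneg_left (norm_hdir_le x hx r) (norm_nonneg _)))
  rcases (pnorm_nonneg r).eq_or_lt with h0 | h0
  · rw [← h0]; positivity
  · nlinarith
end

section
variable {n : ℕ}

lemma pair_limit {V : Type*} [NormedAddCommGroup V] {K : Set V} (hK : IsCompact K) {a b : ℕ → V}
    (ha : ∀ N, a N ∈ K) (hb : ∀ N, b N ∈ K) (hab : ∀ N : ℕ, ‖a N - b N‖ < 1 / ((N : ℝ) + 1)) :
    ∃ η ∈ K, ∃ φ : ℕ → ℕ, StrictMono φ ∧ Tendsto (a ∘ φ) atTop (𝓝[K] η) ∧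
      Tendsto (b ∘ φ) atTop (𝓝[K] η) := by
  obtain ⟨η, hη, φ, hφ, hlim⟩ := hK.tendsto_subseq ha
  have h0 : Tendsto (fun N => ‖a N - b N‖) atTop (𝓝 0) :=
    squeeze_zero (fun _ => norm_nonneg _) (fun N => (hab N).le) tendsto_one_div_add_atTop_nhds_zero_nat
  have h1 : Tendsto (fun N => a N - b N) atTop (𝓝 0) := tendsto_zero_iff_norm_tendsto_zero.2 h0
  have h2 : Tendsto (b ∘ φ) atTop (𝓝 η) := by
    have := hlim.sub (h1.comp hφ.tendsto_atTop)
    simpa [Function.comp_def] using this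
  refine ⟨η, hη, φ, hφ, ?_, ?_⟩
  · exact tendsto_nhdsWithin_iff.2 ⟨hlim, Eventually.of_forall fun N => ha _⟩
  · exact tendsto_nhdsWithin_iff.2 ⟨h2, Eventually.of_forall fun N => hb _⟩

lemma compact_a {Ω : Set (Heis n)} (hΩ : IsOpen Ω) (hb : Bornology.IsBounded Ω) {v w : Heis n → ℝ}
    (hv : UpperSemicontinuousOn v (closure Ω)) (hw : LowerSemicontinuousOn w (closure Ω))
    (hlt : ∀ ξ ∈ frontier Ω, v ξ < w ξ) :
    ∃ κ > 0, κ ≤ 1 ∧ ∀ η ∈ closure Ω, ∀ η' ∈ closure Ω, ‖η - η'‖ < κ → v η - w η' ≥ -κ →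
      Metric.ball η κ ⊆ Ω := by
  have hK : IsCompact (closure Ω) := hb.isCompact_closure
  by_contra! hcon
  have hN : ∀ N : ℕ, (0:ℝ) < 1 / ((N : ℝ) + 1) ∧ 1 / ((N : ℝ) + 1) ≤ 1 := fun N => by
    have : (0:ℝ) ≤ N := by positivity
    exact ⟨by positivity, by rw [div_le_one (by positivity)]; linarith⟩
  choose a ha b hb hab hvw hball using fun N : ℕ => hcon _ (hN N).1 (hN N).2
  obtain ⟨η, hη, φ, hφ, la, lb⟩ := pair_limit hK ha hb hab
  have hz : Tendsto (fun N => 1 / (((φ N : ℕ) : ℝ) + 1)) atTop (𝓝 0) :=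
    tendsto_one_div_add_atTop_nhds_zero_nat.comp hφ.tendsto_atTop
  have hfr : η ∈ frontier Ω := by
    rw [frontier, hΩ.interior_eq]
    refine ⟨hη, fun hηΩ => ?_⟩
    obtain ⟨r, hr, hrb⟩ := Metric.isOpen_iff.1 hΩ η hηΩ
    have e1 : ∀ᶠ N in atTop, dist ((a ∘ φ) N) η < r / 2 :=
      (tendsto_nhdsWithin_iff.1 la).1.eventually (Metric.ball_mem_nhds η (by positivity))
    have e2 : ∀ᶠ N in atTop, 1 / (((φ N : ℕ) : ℝ) + 1) < r / 2 := hz.eventually_lt_const (by positivity)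
    obtain ⟨N, h1, h2⟩ := (e1.and e2).exists
    refine hball (φ N) fun z hz => hrb ?_
    rw [Metric.mem_ball] at hz ⊢
    have := dist_triangle z (a (φ N)) η
    simp only [Function.comp] at h1
    linarith
  have h := hlt η hfr
  set d := (w η - v η) / 4 with hd
  have hdpos : 0 < d := by rw [hd]; linarith
  have e1 := la.eventually (hv η hη (v η + d) (by linarith))
  have e2 := lb.eventually (hw η hη (w η - d) (by linarith))
  have e3 := hz.eventually_lt_const hdpos
  obtain ⟨N, h1, h2, h3⟩ := (e1.and (e2.and e3)).exists
  have := hvw (φ N)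
  simp only [Function.comp] at h1 h2
  linarith

lemma compact_b {Ω : Set (Heis n)} (hb : Bornology.IsBounded Ω) {v w : Heis n → ℝ}
    (hv : UpperSemicontinuousOn v (closure Ω)) (hw : LowerSemicontinuousOn w (closure Ω))
    (hle : ∀ ξ ∈ closure Ω, v ξ ≤ w ξ) {ε : ℝ} (hε : 0 < ε) :
    ∃ ρ > 0, ∀ η ∈ closure Ω, ∀ η' ∈ closure Ω, ‖η - η'‖ < ρ → v η ≤ w η' + ε := by
  have hK : IsCompact (closure Ω) := hb.isCompact_closure
  by_contra! hcon
  have hN : ∀ N : ℕ, (0:ℝ) < 1 / ((N : ℝ) + 1) := fun N => by positivity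
  choose a ha b hb hab hvw using fun N : ℕ => hcon _ (hN N)
  obtain ⟨η, hη, φ, hφ, la, lb⟩ := pair_limit hK ha hb hab
  have h := hle η hη
  have e1 := la.eventually (hv η hη (v η + ε / 2) (by linarith))
  have e2 := lb.eventually (hw η hη (w η - ε / 2) (by linarith))
  obtain ⟨N, h1, h2⟩ := (e1.and e2).exists
  have := hvw (φ N)
  simp only [Function.comp] at h1 h2
  linarith

lemma trunc_v {Ω : Set (Heis n)} {L : Heis n → ℝ → (HIdx n → ℝ) → HMat n} {S : Set (HMat n)}
    {v : Heis n → EReal}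
    (hv : USCFun (closure Ω) v) (hsub : IsSubsolution Ω L S v) (R : ℝ)
    (hR : ∀ ξ ∈ closure Ω, v ξ ≤ ((R : ℝ) : EReal)) (hR0 : 0 ≤ R) :
    ∃ vb : Heis n → ℝ, (∀ ξ ∈ closure Ω, ((vb ξ : ℝ) : EReal) = max (v ξ) ((-R : ℝ) : EReal)) ∧
      UpperSemicontinuousOn vb (closure Ω) ∧
      (∀ ξ₀ ∈ Ω, -R < vb ξ₀ → ∀ φ : Heis n → ℝ, ContDiff ℝ 2 φ → vb ξ₀ = φ ξ₀ →
        (∀ᶠ η in 𝓝 ξ₀, η ∈ closure Ω → vb η ≤ φ η) → Fop L φ ξ₀ ∈ closure S) := by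
  have hco : ∀ ξ ∈ closure Ω, (((max (v ξ) ((-R : ℝ) : EReal)).toReal : ℝ) : EReal)
      = max (v ξ) ((-R : ℝ) : EReal) := by
    intro ξ hξ
    apply EReal.coe_toReal
    · refine ne_of_lt (lt_of_le_of_lt (max_le (hR ξ hξ) ?_) (EReal.coe_lt_top R))
      exact EReal.coe_le_coe_iff.2 (by linarith)
    · exact ne_of_gt (lt_of_lt_of_le (EReal.bot_lt_coe (-R)) (le_max_right _ _))
  refine ⟨fun ξ => (max (v ξ) ((-R : ℝ) : EReal)).toReal, hco, ?_, ?_⟩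
  · intro ξ hξ y hy
    have h1 : max (v ξ) ((-R : ℝ) : EReal) < (y : EReal) := by
      rw [← hco ξ hξ]; exact EReal.coe_lt_coe_iff.2 hy
    have h2 := hv.1 ξ hξ (y : EReal) ((le_max_left _ _).trans_lt h1)
    filter_upwards [h2, self_mem_nhdsWithin] with z hz hzK
    rw [← EReal.coe_lt_coe_iff, hco z hzK]
    exact max_lt hz ((le_max_right _ _).trans_lt h1)
  · intro ξ₀ hξ₀ hgt φ hφ heq hev
    have hcl := subset_closure hξ₀
    have h1 := hco ξ₀ hcl
    have h2 : v ξ₀ = ((φ ξ₀ : ℝ) : EReal) := by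
      rw [← heq]
      dsimp only
      rw [h1]
      rcases le_total (v ξ₀) ((-R : ℝ) : EReal) with h | h
      · exfalso
        dsimp only at hgt
        rw [max_eq_right h, EReal.toReal_coe] at hgt
        exact lt_irrefl _ hgt
      · rw [max_eq_left h]
    refine hsub ξ₀ hξ₀ φ hφ.contDiffOn h2 ?_
    filter_upwards [hev] with η hη hηΩ
    have h3 := hη (subset_closure hηΩ)
    have h4 := EReal.coe_le_coe_iff.2 h3
    rw [hco η (subset_closure hηΩ)] at h4
    exact (le_max_left _ _).trans h4

lemma trunc_w {Ω : Set (Heis n)} {L : Heis n → ℝ → (HIdx n → ℝ) → HMat n} {S : Set (HMat n)}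
    {w : Heis n → EReal}
    (hw : LSCFun (closure Ω) w) (hsup : IsSupersolution Ω L S w) (R : ℝ)
    (hR : ∀ ξ ∈ closure Ω, ((-R : ℝ) : EReal) ≤ w ξ) (hR0 : 0 ≤ R) :
    ∃ wb : Heis n → ℝ, (∀ ξ ∈ closure Ω, ((wb ξ : ℝ) : EReal) = min (w ξ) ((R : ℝ) : EReal)) ∧
      LowerSemicontinuousOn wb (closure Ω) ∧
      (∀ ξ₀ ∈ Ω, wb ξ₀ < R → ∀ φ : Heis n → ℝ, ContDiff ℝ 2 φ → wb ξ₀ = φ ξ₀ →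
        (∀ᶠ η in 𝓝 ξ₀, η ∈ closure Ω → φ η ≤ wb η) → Fop L φ ξ₀ ∉ S) := by
  have hco : ∀ ξ ∈ closure Ω, (((min (w ξ) ((R : ℝ) : EReal)).toReal : ℝ) : EReal)
      = min (w ξ) ((R : ℝ) : EReal) := by
    intro ξ hξ
    apply EReal.coe_toReal
    · exact ne_of_lt (lt_of_le_of_lt (min_le_right _ _) (EReal.coe_lt_top R))
    · refine ne_of_gt (lt_of_lt_of_le (EReal.bot_lt_coe (-R)) (le_min (hR ξ hξ) ?_))
      exact EReal.coe_le_coe_iff.2 (by linarith)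
  refine ⟨fun ξ => (min (w ξ) ((R : ℝ) : EReal)).toReal, hco, ?_, ?_⟩
  · intro ξ hξ y hy
    have h1 : (y : EReal) < min (w ξ) ((R : ℝ) : EReal) := by
      rw [← hco ξ hξ]; exact EReal.coe_lt_coe_iff.2 hy
    have h2 := hw.1 ξ hξ (y : EReal) (h1.trans_le (min_le_left _ _))
    filter_upwards [h2, self_mem_nhdsWithin] with z hz hzK
    rw [gt_iff_lt, ← EReal.coe_lt_coe_iff, hco z hzK]
    exact lt_min hz (h1.trans_le (min_le_right _ _))
  · intro ξ₀ hξ₀ hgt φ hφ heq hev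
    have hcl := subset_closure hξ₀
    have h1 := hco ξ₀ hcl
    have h2 : w ξ₀ = ((φ ξ₀ : ℝ) : EReal) := by
      rw [← heq]
      dsimp only
      rw [h1]
      rcases le_total (w ξ₀) ((R : ℝ) : EReal) with h | h
      · rw [min_eq_left h]
      · exfalso
        dsimp only at hgt
        rw [min_eq_right h, EReal.toReal_coe] at hgt
        exact lt_irrefl _ hgt
    refine hsup ξ₀ hξ₀ φ hφ.contDiffOn h2 ?_
    filter_upwards [hev] with η hη hηΩ
    have h3 := hη (subset_closure hηΩ)
    have h4 := EReal.coe_le_coe_iff.2 h3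
    rw [hco η (subset_closure hηΩ)] at h4
    exact h4.trans (min_le_left _ _)

lemma bound_v {K : Set (Heis n)} (hK : IsCompact K) {v : Heis n → EReal} (hv : USCFun K v) :
    ∃ R : ℝ, 0 ≤ R ∧ ∀ ξ ∈ K, v ξ ≤ ((R : ℝ) : EReal) := by
  obtain ⟨ξ0, hξ0, -⟩ := hv.2.2
  obtain ⟨η, hη, hmx⟩ := hv.1.exists_isMaxOn ⟨ξ0, hξ0⟩ hK
  refine ⟨max (v η).toReal 0, le_max_right _ _, fun ξ hξ => (hmx hξ).trans ?_⟩
  refine (EReal.le_coe_toReal (hv.2.1 η hη)).trans (EReal.coe_le_coe_iff.2 (le_max_left _ _))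

lemma bound_w {K : Set (Heis n)} (hK : IsCompact K) {w : Heis n → EReal} (hw : LSCFun K w) :
    ∃ R : ℝ, 0 ≤ R ∧ ∀ ξ ∈ K, ((-R : ℝ) : EReal) ≤ w ξ := by
  obtain ⟨ξ0, hξ0, -⟩ := hw.2.2
  obtain ⟨η, hη, hmx⟩ := hw.1.exists_isMinOn ⟨ξ0, hξ0⟩ hK
  refine ⟨max (-(w η).toReal) 0, le_max_right _ _, fun ξ hξ => le_trans ?_ (hmx hξ)⟩
  refine le_trans (EReal.coe_le_coe_iff.2 ?_) (EReal.coe_toReal_le (hw.2.1 η hη))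
  have := le_max_left (-(w η).toReal) 0
  linarith

/-- closure of `S` plus positive definite lies in `S` -/
lemma closure_add_pos {S : Set (HMat n)} (hSsymm : ∀ A ∈ S, A.IsSymm)
    (hSpos : ∀ A ∈ S, ∀ B : HMat n, B.PosDef → A + B ∈ S) {A B : HMat n} (hA : A ∈ closure S)
    (hB : B.IsSymm) {d : ℝ} (hd : 0 < d) (hBd : ∀ e, qf A e + d * esq e ≤ qf B e) : B ∈ S := by
  have hev : ∀ᶠ A' in 𝓝 A, ∀ i j, |A' i j - A i j| < d / (2 * n + 1) := by
    refine eventually_all.2 fun i => eventually_all.2 fun j => ?_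
    have : Tendsto (fun A' : HMat n => |A' i j - A i j|) (𝓝 A) (𝓝 0) := by
      have hc : Continuous (fun A' : HMat n => |A' i j - A i j|) := by fun_prop
      simpa using hc.tendsto A
    exact this.eventually_lt_const (by positivity)
  obtain ⟨A', hA', hA'S⟩ := mem_closure_iff_nhds.1 hA _ hev
  have hA' : ∀ i j, |A' i j - A i j| < d / (2 * n + 1) := hA'
  have key : (B - A').PosDef := by
    apply Matrix.PosDef.of_dotProduct_mulVec_pos
    · have h := hB.sub (hSsymm A' hA'S)
      rw [Matrix.IsHermitian, Matrix.conjTranspose_eq_transpose_of_trivial]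
      exact h
    · intro e he
      have hst : star e = e := by simp
      rw [hst, qf_eq, qf_sub]
      have h1 := hBd e
      have hpos : 0 < esq e := by
        rcases (esq_nonneg e).eq_or_lt with h | h
        · exfalso
          apply he
          ext j
          have := (Finset.sum_eq_zero_iff_of_nonneg (fun j _ => sq_nonneg (e j))).1 h.symm j (Finset.mem_univ j)
          simpa using this
        · exact h
      have h2 : qf A' e - qf A e ≤ d * (2 * n / (2 * n + 1)) * esq e := by
        rw [← qf_sub]
        unfold qf
        have : ∀ i j : HIdx n, e i * (A' - A) i j * e j ≤ (d / (2 * n + 1)) * ((e i ^ 2 + e j ^ 2) / 2) := by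
          intro i j
          have h3 := (hA' i j).le
          have h4 : e i * (A' - A) i j * e j ≤ |e i| * |A' i j - A i j| * |e j| := by
            rw [← abs_mul, ← abs_mul]; exact le_abs_self _
          have h5 : |e i| * |A' i j - A i j| * |e j| ≤ |e i| * (d / (2 * n + 1)) * |e j| := by gcongr
          have h6 : |e i| * |e j| ≤ (e i ^ 2 + e j ^ 2) / 2 := by
            rw [← sq_abs (e i), ← sq_abs (e j)]; nlinarith [sq_nonneg (|e i| - |e j|)]
          have h7 : 0 ≤ d / (2 * n + 1) := by positivity
          nlinarith [mul_le_mul_of_nonneg_left h6 h7]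
        refine (Finset.sum_le_sum fun i _ => Finset.sum_le_sum fun j _ => this i j).trans (le_of_eq ?_)
        simp only [← Finset.mul_sum, ← Finset.sum_div, Finset.sum_add_distrib, Finset.sum_const,
          Finset.card_univ, Fintype.card_sum, Fintype.card_fin, nsmul_eq_mul, Nat.cast_add, esq]
        field_simp
        ring
      have h3 : d * (2 * n / (2 * n + 1)) < d := by
        have : (2 * n / (2 * n + 1) : ℝ) < 1 := by rw [div_lt_one (by positivity)]; linarith
        nlinarith
      nlinarith
  have := hSpos A' hA'S _ key
  simpa using this

lemma closure_scale {S : Set (HMat n)} (hScone : ∀ A ∈ S, ∀ c : ℝ, 0 < c → c < 1 → c • A ∈ S)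
    {A : HMat n} (hA : A ∈ closure S) {c : ℝ} (h0 : 0 < c) (h1 : c < 1) : c • A ∈ closure S :=
  map_mem_closure (continuous_const_smul c) hA fun A hA => hScone A hA c h0 h1
end

section
variable {n : ℕ}

lemma Nn_self (ξ : Heis n) : Nn (hmul ξ (hinv ξ)) = 0 := by
  rw [hmul_eq, hinv_eq, om_neg_right, om_self]
  simp [Nn, zsq]

lemma select {K : Set (Heis n)} (hK : IsCompact K) {f1 f2 : Heis n → ℝ}
    (h1 : UpperSemicontinuousOn f1 K) (h2 : UpperSemicontinuousOn f2 K) {Q M : ℝ} (hQ : 0 ≤ Q)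
    (hQ1 : ∀ η ∈ K, f1 η ≤ Q) (hQ2 : ∀ η ∈ K, f2 η ≤ Q) (hM : ∀ η ∈ K, ‖η‖ ≤ M)
    {ξs : Heis n} (hξs : ξs ∈ K) (hs0 : 0 ≤ f1 ξs + f2 ξs) {ρ s : ℝ} (hρ : 0 < ρ) (hs : 0 < s)
    (hs1 : s ≤ 1) :
    ∃ (x η η' : Heis n) (p1 p2 : Heis n →L[ℝ] ℝ) (B1 B2 : Heis n →L[ℝ] Heis n →L[ℝ] ℝ),
      η ∈ K ∧ η' ∈ K ∧ ‖x - η‖ ≤ ρ ∧ ‖x - η'‖ ≤ ρ ∧ -s ≤ f1 η + f2 η' ∧ ‖p1 + p2‖ ≤ s ∧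
      (∀ h, B1 h h + B2 h h ≤ s * ‖h‖ ^ 2) ∧
      (∀ᶠ z in 𝓝 η, z ∈ K → f1 z ≤ f1 η + p1 (hmul (hmul x (hinv η)) z - x)
        + B1 (hmul (hmul x (hinv η)) z - x) (hmul (hmul x (hinv η)) z - x)) ∧
      (∀ᶠ z in 𝓝 η', z ∈ K → f2 z ≤ f2 η' + p2 (hmul (hmul x (hinv η')) z - x)
        + B2 (hmul (hmul x (hinv η')) z - x) (hmul (hmul x (hinv η')) z - x)) := by
  have hM0 : 0 ≤ M := (norm_nonneg _).trans (hM ξs hξs)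
  have hT : 0 < 1 + 4 * n * M := by positivity
  set r := ρ / (1 + 4 * n * M) with hr
  have hrpos : 0 < r := by positivity
  set Λ := (2 * Q + 1) / r ^ 2 with hΛ
  have hΛpos : 0 < Λ := by positivity
  obtain ⟨F1, μ1, k1, e1, g1, hk1, S1⟩ := env_exists hK ⟨ξs, hξs⟩ h1 hΛpos
  obtain ⟨F2, μ2, k2, e2, g2, hk2, S2⟩ := env_exists hK ⟨ξs, hξs⟩ h2 hΛpos
  have b1 : ∀ z, F1 z ≤ Q := fun z => by
    rw [(e1 z).2]
    have := hQ1 _ (e1 z).1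
    have := mul_nonneg hΛpos.le (Nn_nonneg (hmul z (hinv (μ1 z))))
    linarith
  have b2 : ∀ z, F2 z ≤ Q := fun z => by
    rw [(e2 z).2]
    have := hQ2 _ (e2 z).1
    have := mul_nonneg hΛpos.le (Nn_nonneg (hmul z (hinv (μ2 z))))
    linarith
  obtain ⟨x, p1, p2, B1, B2, hx, hp, hB, hev⟩ := jensen_V (k := max k1 k2) (hk1.trans (le_max_left _ _))
    (S1.mono (le_max_left _ _)) (S2.mono (le_max_right _ _)) (Bd := 2 * Q)
    (fun z => by linarith [b1 z, b2 z]) hs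
  have c1 := g1 ξs ξs hξs
  have c2 := g2 ξs ξs hξs
  rw [Nn_self] at c1 c2
  have c3 := hx ξs
  have n1 := mul_nonneg hΛpos.le (Nn_nonneg (hmul x (hinv (μ1 x))))
  have n2 := mul_nonneg hΛpos.le (Nn_nonneg (hmul x (hinv (μ2 x))))
  have q1 := hQ1 _ (e1 x).1
  have q2 := hQ2 _ (e2 x).1
  have d1 := (e1 x).2
  have d2 := (e2 x).2
  have hΛr : Λ * r ^ 2 = 2 * Q + 1 := by rw [hΛ]; field_simp
  have m1 : Nn (hmul x (hinv (μ1 x))) ≤ r ^ 2 := by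
    refine le_of_mul_le_mul_left ?_ hΛpos
    rw [hΛr]; linarith
  have m2 : Nn (hmul x (hinv (μ2 x))) ≤ r ^ 2 := by
    refine le_of_mul_le_mul_left ?_ hΛpos
    rw [hΛr]; linarith
  have hTr : (1 + 4 * n * M) * r = ρ := by rw [hr]; field_simp
  have l1 := norm_le_of_Nn hrpos.le (hM _ (e1 x).1) m1
  have l2 := norm_le_of_Nn hrpos.le (hM _ (e2 x).1) m2
  rw [hTr] at l1 l2
  exact ⟨x, μ1 x, μ2 x, p1, p2, B1, B2, (e1 x).1, (e2 x).1, l1, l2, by linarith, hp, hB,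
    env_jet d1 g1 hev.1, env_jet d2 g2 hev.2⟩

lemma final_real {c γ C C3 C4 β τ E P B l1 l2 l3 l4 l5 Z Zm W pm ε ρ r K s : ℝ}
    (hE : 0 ≤ E) (hc1 : c < 1) (hC : 0 < C) (hC3 : 0 < C3)
    (hγ : γ ≤ 1 - c) (hβ : C ≤ β * c ^ 2)
    (hpm : 0 ≤ pm) (hW : W ≤ 1 + pm) (hr0 : 0 ≤ r)
    (h1 : c * l1 ≤ l2 + (1 - c) * (C * P ^ 2 + C * Z * E - (1 / C) * pm * E + (1 / C) * Zm * E)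
      + τ * E)
    (hZ : (1 - c) * (C * Z + (1 / C) * Zm) ≤ τ / 4)
    (h2 : l2 ≤ l3 + C4 * ε * pm * E) (h3 : l3 ≤ l4 + C3 * pm * ρ * E)
    (h4 : l4 ≤ l5 + C3 * (W + r + r) * r * E)
    (hB : B ≤ 2 * s * K ^ 2 * E) (hsK : 2 * s * K ^ 2 ≤ τ / 8)
    (hε : C4 * ε ≤ γ / (4 * C)) (hρ : C3 * ρ ≤ γ / (4 * C)) (hr1 : 3 * C3 * r ≤ τ / 8)
    (hr2 : C3 * r ≤ γ / (4 * C)) (hr3 : r ≤ 1) :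
    c * l1 + (-(β * (1 - c)) * c ^ 2 * P ^ 2 - 2 * τ * E) + τ / 2 * E ≤ l5 - B := by
  have a1 : (1 - c) * C * P ^ 2 ≤ (1 - c) * (β * c ^ 2) * P ^ 2 := by
    have : 0 ≤ 1 - c := by linarith
    gcongr
  have a2 := mul_le_mul_of_nonneg_right hZ hE
  have hpE : 0 ≤ pm * E := mul_nonneg hpm hE
  have a3 := mul_le_mul_of_nonneg_right hε hpE
  have a4 := mul_le_mul_of_nonneg_right hρ hpE
  have a5 : C3 * (W + r + r) * r * E ≤ τ / 8 * E + γ / (4 * C) * (pm * E) := by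
    have b1 : C3 * (W + r + r) * r ≤ C3 * (1 + pm + 2) * r := by
      have : W + r + r ≤ 1 + pm + 2 := by linarith
      gcongr
    have b2 : C3 * (1 + pm + 2) * r = 3 * C3 * r + C3 * r * pm := by ring
    have b3 := mul_le_mul_of_nonneg_right hr2 hpm
    have b4 : C3 * (W + r + r) * r ≤ τ / 8 + γ / (4 * C) * pm := by linarith
    have := mul_le_mul_of_nonneg_right b4 hE
    linarith
  have a6 : γ / C * (pm * E) ≤ (1 - c) / C * (pm * E) := by gcongr
  have a7 : γ / (4 * C) = γ / C / 4 := by field_simp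
  rw [a7] at a3 a4 a5
  have a8 := mul_le_mul_of_nonneg_right hsK hE
  have a9 : (1 - c) * ((1 / C) * pm * E) = (1 - c) / C * (pm * E) := by ring
  have a10 : 0 ≤ γ / C * (pm * E) := by
    have : 0 ≤ γ / (4 * C) := le_trans (by positivity) hr2
    have h : γ / C = 4 * (γ / (4 * C)) := by field_simp
    rw [h]; positivity
  nlinarith
end

section
variable {n : ℕ}

lemma le_one_add_rpow {a m : ℝ} (ha : 0 ≤ a) (hm : 1 < m) : a ≤ 1 + a ^ m := by
  rcases le_total a 1 with h | h
  · have := Real.rpow_nonneg ha m; linarith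
  · have := Real.rpow_le_rpow_of_exponent_le h hm.le
    rw [Real.rpow_one] at this; linarith

lemma L_s_le {Ω : Set (Heis n)} {L : Heis n → ℝ → (HIdx n → ℝ) → HMat n} {m C4 R ε : ℝ}
    (hC4 : 0 < C4) (hε : 0 ≤ ε)
    (h34 : ∀ ξ ∈ Ω, ∀ s s' : ℝ, -R ≤ s → s ≤ s' → s' ≤ R → ∀ p : HIdx n → ℝ,
      matLE 0 (L ξ s' p - L ξ s p) ∧
      matLE (L ξ s' p - L ξ s p) ((C4 * (s' - s) * pnorm p ^ m) • (1 : HMat n)))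
    {ξ : Heis n} (hξ : ξ ∈ Ω) {sv sw : ℝ} (hv : |sv| ≤ R) (hw : |sw| ≤ R) (h : sv ≤ sw + ε)
    (p e : HIdx n → ℝ) :
    qf (L ξ sv p) e ≤ qf (L ξ sw p) e + C4 * ε * pnorm p ^ m * esq e := by
  have hp := Real.rpow_nonneg (pnorm_nonneg p) m
  have hE := esq_nonneg e
  have hpE := mul_nonneg hp hE
  rw [abs_le] at hv hw
  rcases le_total sv sw with h1 | h1
  · have := qf_le_of_matLE (h34 ξ hξ sv sw hv.1 h1 hw.2 p).1 e
    rw [qf_zero, qf_sub] at this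
    have : 0 ≤ C4 * ε * pnorm p ^ m * esq e := by positivity
    linarith
  · have h2 := qf_le_of_matLE (h34 ξ hξ sw sv hw.1 h1 hv.2 p).2 e
    rw [qf_smul, qf_one, qf_sub] at h2
    have : C4 * (sv - sw) * pnorm p ^ m * esq e ≤ C4 * ε * pnorm p ^ m * esq e := by
      gcongr; linarith
    linarith

set_option maxHeartbeats 2000000 in
lemma point_ineq {Ω : Set (Heis n)} {L : Heis n → ℝ → (HIdx n → ℝ) → HMat n} (hΩ : IsOpen Ω)
    (hL : ∀ i j : HIdx n, LocallyLipschitzOnSet (Ω ×ˢ (Set.univ : Set (ℝ × (HIdx n → ℝ))))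
      (fun q : Heis n × ℝ × (HIdx n → ℝ) => L q.1 q.2.1 q.2.2 i j))
    {m R C C3 C4 θb Λ : ℝ} (hm : 1 < m) (hC : 0 < C) (hC3 : 0 < C3) (hC4 : 0 < C4)
    (h33 : ∀ ξ ∈ Ω, ∀ s : ℝ, |s| ≤ R → ∀ p : HIdx n → ℝ,
      (DiffInXi L ξ s p → xiGradNorm L ξ s p ≤ C3 * pnorm p ^ m) ∧
      (DiffInP L ξ s p → pGradNorm L ξ s p ≤ C3 * pnorm p))
    (h34 : ∀ ξ ∈ Ω, ∀ s s' : ℝ, -R ≤ s → s ≤ s' → s' ≤ R → ∀ p : HIdx n → ℝ,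
      matLE 0 (L ξ s' p - L ξ s p) ∧
      matLE (L ξ s' p - L ξ s p) ((C4 * (s' - s) * pnorm p ^ m) • (1 : HMat n)))
    (h35 : ∀ θ : ℝ, 0 ≤ θ → θ ≤ θb → ∀ ξ ∈ Ω, ∀ s : ℝ, |s| ≤ R → ∀ p : HIdx n → ℝ,
      DiffInP L ξ s p →
      matLE (pDotGradL L ξ s p - L ξ s p + (θ * Λ * pGradNorm L ξ s p) • (1 : HMat n)
              - θ • (1 : HMat n))
            (C • vecMulVec p p - ((1 / C) * pnorm p ^ m) • (1 : HMat n)))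
    {M β γ τ ε ρ s Hp : ℝ} {x η η' : Heis n} (hη : η ∈ Ω) (hη' : η' ∈ Ω) (hx : ‖x‖ ≤ M)
    (hHp1 : 1 < Hp) (hHp2 : Hp ≤ 2) (hγ0 : 0 < γ) (hγ : γ ≤ 1 - 1 / Hp) (hβ : β = 4 * C)
    (hτ : 0 < τ) (hΛ : 2 * pnorm (hz η) ≤ Λ)
    (hθ : ∀ θ, 0 ≤ θ → θ ≤ τ / γ → θ ≤ θb ∧ C * (θ * Λ) ^ 2 + (1 / C) * (θ * Λ) ^ m ≤ θ / 4)
    {φv φw : Heis n → ℝ} (hv : |φv η| ≤ R) (hw : |φw η'| ≤ R) (hε0 : 0 ≤ ε)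
    (hvw : φv η ≤ φw η' + ε)
    (hseg : ∀ t ∈ Set.Icc (0 : ℝ) 1, η' + t • (η - η') ∈ Ω) (hρ : ‖η - η'‖ ≤ ρ)
    {p1 p2 : Heis n →L[ℝ] ℝ} {B1 B2 : Heis n →L[ℝ] Heis n →L[ℝ] ℝ}
    (hp12 : ‖p1 + p2‖ ≤ s) (hB12 : ∀ h, B1 h h + B2 h h ≤ s * ‖h‖ ^ 2)
    (gv : ∀ e : HIdx n → ℝ, ∑ j, hGrad φv η j * e j
      = Hp * (p1 (hdir x e) - 2 * τ * ∑ j, hz η j * e j))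
    (Xv : ∀ e : HIdx n → ℝ, qf (hHessSym φv η) e
      = -(β * (Hp - 1)) * (p1 (hdir x e) - 2 * τ * ∑ j, hz η j * e j) ^ 2
        + Hp * (2 * B1 (hdir x e) (hdir x e) - 2 * τ * esq e))
    (gw : ∀ e : HIdx n → ℝ, ∑ j, hGrad φw η' j * e j = - p2 (hdir x e))
    (Xw : ∀ e : HIdx n → ℝ, qf (hHessSym φw η') e = - (2 * B2 (hdir x e) (hdir x e)))
    (c1 : 2 * s * (1 + 4 * n * M) ^ 2 ≤ τ / 8)
    (c2 : C4 * ε ≤ γ / (4 * C)) (c3 : C3 * ρ ≤ γ / (4 * C))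
    (c4 : 3 * C3 * (s * (1 + 4 * n * M)) ≤ τ / 8)
    (c5 : C3 * (s * (1 + 4 * n * M)) ≤ γ / (4 * C)) (c6 : s * (1 + 4 * n * M) ≤ 1)
    (e : HIdx n → ℝ) :
    qf ((1 / Hp) • Fop L φv η) e + τ / 2 * esq e ≤ qf (Fop L φw η') e := by
  have hHp0 : 0 < Hp := by linarith
  have hM : 0 ≤ M := (norm_nonneg _).trans hx
  set c := 1 / Hp with hc
  have hcH : c * Hp = 1 := by rw [hc]; field_simp
  have hc0 : 0 < c := by positivity
  have hc1 : c < 1 := by rw [hc, div_lt_one hHp0]; exact hHp1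
  have hchalf : 1 / 2 ≤ c := by rw [hc]; gcongr
  set p := hGrad φv η with hpdef
  set q := hGrad φw η' with hqdef
  have hs0 : 0 ≤ s := (norm_nonneg _).trans hp12
  have h1c : 0 < 1 - c := by linarith
  set θ := τ / (1 - c) with hθd
  have hθ0 : 0 ≤ θ := by positivity
  have hθle : θ ≤ τ / γ := by rw [hθd]; gcongr
  obtain ⟨hθb, hθs⟩ := hθ θ hθ0 hθle
  set ζ : HIdx n → ℝ := θ • ((2:ℝ) • hz η) with hζd
  have hζ : pnorm ζ ≤ θ * Λ := by
    rw [hζd, pnorm_smul, pnorm_smul, abs_of_nonneg hθ0, abs_two]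
    gcongr
  have hΛ0 : 0 ≤ Λ := le_trans (by have := pnorm_nonneg (hz η); positivity) hΛ
  -- π
  set π : HIdx n → ℝ := hcov p1 x with hπd
  have hπ : c • p + (1 - c) • ζ = π := by
    apply dot_ext
    intro e
    rw [hπd, hcov_dot]
    have h1 := gv e
    have h2 : ∑ j, (c • p + (1 - c) • ζ) j * e j = c * ∑ j, p j * e j
        + (1 - c) * (θ * 2 * ∑ j, hz η j * e j) := by
      simp only [Finset.mul_sum, ← Finset.sum_add_distrib]
      refine Finset.sum_congr rfl fun j _ => ?_
      simp only [Pi.add_apply, Pi.smul_apply, smul_eq_mul, hζd]; ring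
    have h3 : (1 - c) * θ = τ := by rw [hθd]; field_simp
    rw [h2, h1, ← mul_assoc c, hcH]
    linear_combination (2 * ∑ j, hz η j * e j) * h3
  have hq : q = hcov (-p2) x := by
    apply dot_ext
    intro e
    rw [hcov_dot, hqdef, gw e]; simp
  have hr : pnorm (π - q) ≤ s * (1 + 4 * n * M) := by
    have h1 : π - q = hcov (p1 + p2) x := by
      rw [hq, hπd]; ext j; simp [hcov]
    rw [h1]
    refine (pnorm_hcov_le _ x hx).trans ?_
    gcongr
  set E := esq e with hE
  have hE0 : 0 ≤ E := esq_nonneg e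
  set r := s * (1 + 4 * n * M) with hrd
  have hr0 : 0 ≤ r := by positivity
  have hpn := pnorm_nonneg ζ
  -- chain
  have s1 := L_persp hΩ hL hC hm hθ0 hη (h35 θ hθ0 hθb η hη _ hv) hc0 hc1 p ζ e hζ
  rw [hπ] at s1
  have s2 := L_s_le hC4 hε0 h34 hη hv hw hvw π e
  have s3 := L_xi_lip hΩ hL (fun ξ hξ => (h33 ξ hξ _ hw π).1) hseg e
  have s3' : C3 * pnorm π ^ m * ‖η - η'‖ * esq e ≤ C3 * pnorm π ^ m * ρ * E := by
    have := Real.rpow_nonneg (pnorm_nonneg π) m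
    gcongr
  have s4 := L_p_lip hΩ hL hC3 hη' (fun p => (h33 η' hη' _ hw p).2) q π e
  have s4' : C3 * (pnorm q + pnorm (π - q)) * pnorm (π - q) * esq e
      ≤ C3 * (pnorm π + r + r) * r * E := by
    have h1 : pnorm q ≤ pnorm π + r := by
      have h2 : q = π + -(π - q) := by abel
      have h3 := pnorm_add_le π (-(π - q))
      rw [← h2, pnorm_neg] at h3
      linarith
    have := pnorm_nonneg q
    have := pnorm_nonneg (π - q)
    have := pnorm_nonneg π
    have hpos : 0 ≤ C3 * (pnorm π + r + r) := by positivity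
    gcongr
  have hD : ‖hdir x e‖ ^ 2 ≤ (1 + 4 * n * M) ^ 2 * E := by
    have h1 := pow_le_pow_left₀ (norm_nonneg _) (norm_hdir_le x hx e) 2
    rw [mul_pow, pnorm_sq] at h1
    exact h1
  have hBB := hB12 (hdir x e)
  have hBs := mul_le_mul_of_nonneg_left hD hs0
  set D1 := B1 (hdir x e) (hdir x e) with hD1
  set D2 := B2 (hdir x e) (hdir x e) with hD2
  set P := ∑ i, p i * e i with hP
  have hZ : (1 - c) * (C * pnorm ζ ^ 2 + (1 / C) * pnorm ζ ^ m) ≤ τ / 4 := by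
    have h1 : C * pnorm ζ ^ 2 + (1 / C) * pnorm ζ ^ m ≤ θ / 4 := by
      refine le_trans ?_ hθs
      gcongr
    have h2 := mul_le_mul_of_nonneg_left h1 h1c.le
    have h3 : (1 - c) * (θ / 4) = τ / 4 := by rw [hθd]; field_simp
    linarith
  have hτE : (1 - c) * (θ * E) = τ * E := by rw [hθd]; field_simp
  have fin := final_real (c := c) (γ := γ) (C := C) (C3 := C3) (C4 := C4) (β := β) (τ := τ) (E := E)
    (P := P) (B := 2 * (D1 + D2)) (l1 := qf (L η (φv η) p) e) (l2 := qf (L η (φv η) π) e)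
    (l3 := qf (L η (φw η') π) e) (l4 := qf (L η' (φw η') π) e) (l5 := qf (L η' (φw η') q) e)
    (Z := pnorm ζ ^ 2) (Zm := pnorm ζ ^ m) (W := pnorm π) (pm := pnorm π ^ m) (ε := ε) (ρ := ρ)
    (r := r) (K := 1 + 4 * n * M) (s := s) hE0 hc1 hC hC3 hγ
    (by rw [hβ]; nlinarith [mul_nonneg (sub_nonneg.2 hchalf) (add_nonneg hc0.le (by norm_num : (0:ℝ) ≤ 1/2))])
    (Real.rpow_nonneg (pnorm_nonneg π) m) (le_one_add_rpow (pnorm_nonneg π) hm) hr0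
    (by linarith) hZ s2 (by linarith) (by linarith) (by linarith) c1 c2 c3 c4 c5 c6
  have hb : p1 (hdir x e) - 2 * τ * ∑ j, hz η j * e j = c * P := by
    rw [hP, gv e, ← mul_assoc c, hcH, one_mul]
  have hXv := Xv e
  rw [hb] at hXv
  rw [qf_smul, Fop, Fop, qf_add, qf_add, hXv, Xw e]
  have e1 : c * (-(β * (Hp - 1)) * (c * P) ^ 2 + Hp * (2 * D1 - 2 * τ * E)) =
      -(β * (1 - c)) * c ^ 2 * P ^ 2 + 2 * D1 - 2 * τ * E := by
    have : c * (-(β * (Hp - 1)) * (c * P) ^ 2 + Hp * (2 * D1 - 2 * τ * E)) =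
      -(β * (c * Hp - c)) * (c * P) ^ 2 + (c * Hp) * (2 * D1 - 2 * τ * E) := by ring
    rw [this, hcH]; ring
  rw [mul_add, e1]
  linarith
end

section
variable {n : ℕ}

lemma theta_small {C Λ m : ℝ} (hΛ : 0 ≤ Λ) (hm : 1 < m) :
    ∃ θ1 > 0, ∀ θ : ℝ, 0 ≤ θ → θ ≤ θ1 → C * (θ * Λ) ^ 2 + (1 / C) * (θ * Λ) ^ m ≤ θ / 4 := by
  have hc : Continuous (fun θ : ℝ => C * θ * Λ ^ 2 + (1 / C) * (θ ^ (m - 1) * Λ ^ m)) := by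
    have : Continuous (fun θ : ℝ => θ ^ (m - 1)) := Real.continuous_rpow_const (by linarith)
    fun_prop
  have h0 : Tendsto (fun θ : ℝ => C * θ * Λ ^ 2 + (1 / C) * (θ ^ (m - 1) * Λ ^ m)) (𝓝 0) (𝓝 0) := by
    have := hc.tendsto 0
    simpa [Real.zero_rpow (by linarith : m - 1 ≠ 0)] using this
  have h1 := h0.eventually_lt_const (by norm_num : (0:ℝ) < 1 / 4)
  obtain ⟨r, hr, hb⟩ := Metric.eventually_nhds_iff.1 h1
  refine ⟨r / 2, by positivity, fun θ hθ hθr => ?_⟩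
  rcases hθ.eq_or_lt with h | h
  · rw [← h]; simp [Real.zero_rpow (by linarith : m ≠ 0)]
  · have h2 := hb (y := θ) (by rw [Real.dist_eq, sub_zero, abs_of_pos h]; linarith)
    have h3 : (θ * Λ) ^ m = θ * (θ ^ (m - 1) * Λ ^ m) := by
      rw [Real.mul_rpow hθ hΛ, Real.rpow_sub_one h.ne']; field_simp
    rw [h3]
    nlinarith

lemma hHessSym_symm (u : Heis n → ℝ) (η : Heis n) : (hHessSym u η).IsSymm := by
  rw [Matrix.IsSymm, hHessSym, transpose_smul, transpose_add, transpose_transpose, add_comm]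

lemma Fop_symm {L : Heis n → ℝ → (HIdx n → ℝ) → HMat n} (hLsymm : ∀ ξ s p, (L ξ s p).IsSymm)
    (u : Heis n → ℝ) (η : Heis n) : (Fop L u η).IsSymm :=
  (hHessSym_symm u η).add (hLsymm _ _ _)

lemma Atest_self (α τ : ℝ) (a x η : Heis n) (hx : hmul a η = x) (p : Heis n →L[ℝ] ℝ)
    (B : Heis n →L[ℝ] Heis n →L[ℝ] ℝ) : Atest α τ a x p B η = α - τ * zsq η := by
  simp [Atest, hx]

set_option maxHeartbeats 2000000 in
lemma core (Ω : Set (Heis n)) (hΩopen : IsOpen Ω) (hΩbdd : Bornology.IsBounded Ω)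
    (L : Heis n → ℝ → (HIdx n → ℝ) → HMat n)
    (hLsymm : ∀ ξ s p, (L ξ s p).IsSymm)
    (hLlip : ∀ i j : HIdx n, LocallyLipschitzOnSet
      (Ω ×ˢ (Set.univ : Set (ℝ × (HIdx n → ℝ))))
      (fun q : Heis n × ℝ × (HIdx n → ℝ) => L q.1 q.2.1 q.2.2 i j))
    (m : ℝ) (hm : 1 < m)
    (h33 : Cond33 Ω L m) (h34 : Cond34 Ω L m) (h35 : Cond35 Ω L m)
    (S : Set (HMat n)) (hSsymm : ∀ A ∈ S, A.IsSymm)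
    (hSpos : ∀ A ∈ S, ∀ B : HMat n, B.PosDef → A + B ∈ S)
    (hScone : ∀ A ∈ S, ∀ c : ℝ, 0 < c → c < 1 → c • A ∈ S)
    (w v : Heis n → ℝ) (R : ℝ) (hR : 2 ≤ R)
    (hw : LowerSemicontinuousOn w (closure Ω)) (hv : UpperSemicontinuousOn v (closure Ω))
    (hv1 : ∀ ξ ∈ closure Ω, -R ≤ v ξ) (hv2 : ∀ ξ ∈ closure Ω, v ξ ≤ R - 2)
    (hw1 : ∀ ξ ∈ closure Ω, -R + 2 ≤ w ξ) (hw2 : ∀ ξ ∈ closure Ω, w ξ ≤ R)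
    (hle : ∀ ξ ∈ closure Ω, v ξ ≤ w ξ) (hlt : ∀ ξ ∈ frontier Ω, v ξ < w ξ)
    (hsub : ∀ ξ₀ ∈ Ω, -R < v ξ₀ → ∀ φ : Heis n → ℝ, ContDiff ℝ 2 φ → v ξ₀ = φ ξ₀ →
        (∀ᶠ η in 𝓝 ξ₀, η ∈ closure Ω → v η ≤ φ η) → Fop L φ ξ₀ ∈ closure S)
    (hsup : ∀ ξ₀ ∈ Ω, w ξ₀ < R → ∀ φ : Heis n → ℝ, ContDiff ℝ 2 φ → w ξ₀ = φ ξ₀ →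
        (∀ᶠ η in 𝓝 ξ₀, η ∈ closure Ω → φ η ≤ w η) → Fop L φ ξ₀ ∉ S)
    (ξs : Heis n) (hξs : ξs ∈ closure Ω) (hs0 : w ξs ≤ v ξs) : False := by
  have hK : IsCompact (closure Ω) := hΩbdd.isCompact_closure
  obtain ⟨M, hM⟩ := hK.isBounded.exists_norm_le
  have hM0 : 0 ≤ M := (norm_nonneg _).trans (hM ξs hξs)
  obtain ⟨κ, hκ, hκ1, hin⟩ := compact_a hΩopen hΩbdd hv hw hlt
  have hRpos : 0 < R := by linarith
  set Zb : ℝ := 2 * n * M ^ 2 with hZb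
  have hZb0 : 0 ≤ Zb := by positivity
  have hzb : ∀ ξ ∈ closure Ω, zsq ξ ≤ Zb := fun ξ hξ => (zsq_le ξ).trans (by
    have := hM ξ hξ
    rw [hZb]; gcongr)
  set Λ := 2 * (1 + Zb) with hΛd
  have hΛ0 : 0 < Λ := by positivity
  obtain ⟨C3, hC3, H33⟩ := h33 R hRpos
  obtain ⟨C4, hC4, H34⟩ := h34 R hRpos
  obtain ⟨θb, hθb, C, hC, H35⟩ := h35 R hRpos Λ hΛ0
  obtain ⟨θ1, hθ1, Hθ⟩ := theta_small (C := C) hΛ0.le hm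
  obtain ⟨β, hβ⟩ : ∃ β, β = 4 * C := ⟨_, rfl⟩
  have hβ0 : 0 < β := by rw [hβ]; positivity
  -- δ
  obtain ⟨δ, hδ, hδ1, hδ2⟩ : ∃ δ > 0, δ * Real.exp (β * R) ≤ κ / 4 ∧ δ * β * Real.exp (β * R) ≤ 1 := by
    have hX := Real.exp_pos (β * R)
    refine ⟨min (κ / 4 / Real.exp (β * R)) (1 / (β * Real.exp (β * R))), by positivity, ?_, ?_⟩
    · exact (le_div_iff₀ hX).1 (min_le_left _ _)
    · rw [mul_assoc]; exact (le_div_iff₀ (by positivity)).1 (min_le_right _ _)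
  obtain ⟨Kf, hK1, hKmono, hKcont, hK2, hK3⟩ := Hf_inv hδ hβ0
  have hKb : ∀ ξ ∈ closure Ω, Kf (v ξ) ≤ v ξ + κ / 4 := by
    intro ξ hξ
    refine (hK3 _).trans ?_
    have : Real.exp (-(β * v ξ)) ≤ Real.exp (β * R) := by
      apply Real.exp_le_exp.2; nlinarith [hv1 ξ hξ]
    nlinarith
  obtain ⟨γ, hγd⟩ : ∃ γ, γ = δ * β * Real.exp (-(β * R)) / 2 := ⟨_, rfl⟩
  have hγ0 : 0 < γ := by rw [hγd]; positivity
  -- τ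
  obtain ⟨τ, hτ, hτ1, hτ2, hτ3⟩ : ∃ τ > 0, τ / γ ≤ θb ∧ τ / γ ≤ θ1 ∧ τ * Zb ≤ κ / 4 := by
    refine ⟨min (min (θb * γ) (θ1 * γ)) (κ / 4 / (Zb + 1)), by positivity, ?_, ?_, ?_⟩
    · rw [div_le_iff₀ hγ0]; exact (min_le_left _ _).trans (min_le_left _ _)
    · rw [div_le_iff₀ hγ0]; exact (min_le_left _ _).trans (min_le_right _ _)
    · have h1 := (le_div_iff₀ (by positivity)).1 (min_le_right (min (θb * γ) (θ1 * γ)) (κ / 4 / (Zb + 1)))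
      have h2 : 0 < min (min (θb * γ) (θ1 * γ)) (κ / 4 / (Zb + 1)) := by positivity
      nlinarith
  -- ε, ρ
  obtain ⟨ε, hεd⟩ : ∃ ε, ε = γ / (4 * C) / C4 := ⟨_, rfl⟩
  have hε : 0 < ε := by rw [hεd]; positivity
  obtain ⟨ρb, hρb, Hρb⟩ := compact_b hΩbdd hv hw hle hε
  obtain ⟨ρ, hρ, hρ1, hρ2, hρ3, hρ4⟩ : ∃ ρ > 0, ρ ≤ 1 ∧ 2 * ρ < κ ∧ 2 * ρ < ρb ∧
      C3 * (2 * ρ) ≤ γ / (4 * C) := by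
    refine ⟨min (min 1 (κ / 4)) (min (ρb / 4) (γ / (4 * C) / C3 / 2)), by positivity, ?_, ?_, ?_, ?_⟩
    · exact (min_le_left _ _).trans (min_le_left _ _)
    · have := (min_le_left (min 1 (κ / 4)) (min (ρb / 4) (γ / (4 * C) / C3 / 2))).trans (min_le_right _ _)
      linarith
    · have := (min_le_right (min 1 (κ / 4)) (min (ρb / 4) (γ / (4 * C) / C3 / 2))).trans (min_le_left _ _)
      linarith
    · have h1 := (min_le_right (min 1 (κ / 4)) (min (ρb / 4) (γ / (4 * C) / C3 / 2))).trans (min_le_right _ _)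
      have h2 := (le_div_iff₀ (by norm_num : (0:ℝ) < 2)).1 h1
      have h3 := (le_div_iff₀ hC3).1 h2
      linarith
  -- s
  obtain ⟨T, hTd⟩ : ∃ T : ℝ, T = 1 + 4 * n * (M + 1) := ⟨_, rfl⟩
  have hT0 : 0 < T := by rw [hTd]; positivity
  obtain ⟨s, hs, hs1, hsκ, c1, c4, c5, c6⟩ : ∃ s > 0, s ≤ 1 ∧ s ≤ κ / 4 ∧ 2 * s * T ^ 2 ≤ τ / 8 ∧
      3 * C3 * (s * T) ≤ τ / 8 ∧ C3 * (s * T) ≤ γ / (4 * C) ∧ s * T ≤ 1 := by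
    have hev : ∀ᶠ s in 𝓝[>] (0:ℝ), s < 1 ∧ s < κ / 4 ∧ 2 * s * T ^ 2 < τ / 8 ∧
      3 * C3 * (s * T) < τ / 8 ∧ C3 * (s * T) < γ / (4 * C) ∧ s * T < 1 := by
      have hlim : ∀ (f : ℝ → ℝ) (b : ℝ), Continuous f → f 0 = 0 → 0 < b → ∀ᶠ s in 𝓝[>] (0:ℝ), f s < b := by
        intro f b hf h0 hb
        have := hf.tendsto 0
        rw [h0] at this
        exact (this.mono_left nhdsWithin_le_nhds).eventually_lt_const hb
      refine (hlim (fun s => s) _ (by fun_prop) (by simp) (by positivity)).and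
        ((hlim (fun s => s) _ (by fun_prop) (by simp) (by positivity)).and
        ((hlim (fun s => 2 * s * T ^ 2) _ (by fun_prop) (by simp) (by positivity)).and
        ((hlim (fun s => 3 * C3 * (s * T)) _ (by fun_prop) (by simp) (by positivity)).and
        ((hlim (fun s => C3 * (s * T)) _ (by fun_prop) (by simp) (by positivity)).and
        (hlim (fun s => s * T) _ (by fun_prop) (by simp) (by positivity))))))
    obtain ⟨s, ⟨a1, a2, a3, a4, a5, a6⟩, hs⟩ := (hev.and self_mem_nhdsWithin).exists
    exact ⟨s, hs, a1.le, a2.le, a3.le, a4.le, a5.le, a6.le⟩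
  -- select points
  have hzc : Continuous (zsq : Heis n → ℝ) := by unfold zsq; fun_prop
  have hψ : UpperSemicontinuousOn (fun ξ => Kf (v ξ) + τ * zsq ξ) (closure Ω) := by
    have h1 : UpperSemicontinuousOn (fun ξ => Kf (v ξ)) (closure Ω) := by
      intro ξ hξ y hy
      have h2 : v ξ < Hf δ β y := by
        rw [← hK1 (v ξ)]; exact Hf_strictMono hδ hβ0 hy
      filter_upwards [hv ξ hξ _ h2] with z hz
      rw [← hK1 (v z)] at hz
      exact (Hf_strictMono hδ hβ0).lt_iff_lt.1 hz
    exact h1.add ((continuous_const.mul hzc).upperSemicontinuous.upperSemicontinuousOn _)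
  have hw' : UpperSemicontinuousOn (fun ξ => -w ξ) (closure Ω) := by
    intro ξ hξ y hy
    filter_upwards [hw ξ hξ (-y) (by dsimp only at hy; linarith)] with z hz
    linarith
  have hτz : ∀ ξ ∈ closure Ω, 0 ≤ τ * zsq ξ ∧ τ * zsq ξ ≤ κ / 4 := fun ξ hξ =>
    ⟨mul_nonneg hτ.le (zsq_nonneg ξ), (mul_le_mul_of_nonneg_left (hzb ξ hξ) hτ.le).trans hτ3⟩
  obtain ⟨x, η, η', p1, p2, B1, B2, hη, hη', l1, l2, hsum, hp, hB, J1, J2⟩ :=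
    select hK hψ hw' (Q := R) (M := M) hRpos.le
      (fun ξ hξ => by linarith [hKb ξ hξ, (hτz ξ hξ).2, hv2 ξ hξ])
      (fun ξ hξ => by linarith [hw1 ξ hξ]) hM hξs
      (by linarith [hK2 (v ξs), (hτz ξs hξs).1]) hρ hs hs1
  have hdist : ‖η - η'‖ ≤ 2 * ρ := by
    have : η - η' = (x - η') - (x - η) := by abel
    rw [this]
    exact (norm_sub_le _ _).trans (by linarith)
  have hvw : v η - w η' ≥ -κ := by linarith [hKb η hη, (hτz η hη).2]
  have hball := hin η hη η' hη' (by linarith) hvw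
  have hηΩ : η ∈ Ω := hball (Metric.mem_ball_self hκ)
  have hseg : ∀ t ∈ Set.Icc (0 : ℝ) 1, η' + t • (η - η') ∈ Ω := by
    intro t ht
    apply hball
    rw [Metric.mem_ball, dist_eq_norm]
    have : η' + t • (η - η') - η = (t - 1) • (η - η') := by module
    rw [this, norm_smul, Real.norm_eq_abs]
    have h1 : |t - 1| ≤ 1 := by rw [abs_le]; constructor <;> linarith [ht.1, ht.2]
    have h2 : |t - 1| * ‖η - η'‖ ≤ 1 * ‖η - η'‖ := by gcongr
    linarith
  have hη'Ω : η' ∈ Ω := by simpa using hseg 0 (by simp)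
  -- test functions
  set α := Kf (v η) + τ * zsq η with hα
  set φv : Heis n → ℝ := fun ζ => Hf δ β (Atest α τ (hmul x (hinv η)) x p1 B1 ζ) with hφv
  set φw : Heis n → ℝ := fun ζ => id (Atest (w η') 0 (hmul x (hinv η')) x (-p2) (-B2) ζ) with hφw
  have hx1 : hmul (hmul x (hinv η)) η = x := hmul_cancel' x η
  have hx2 : hmul (hmul x (hinv η')) η' = x := hmul_cancel' x η'
  have hα0 : α - τ * zsq η = Kf (v η) := by rw [hα]; ring
  have ev : φv η = v η := by
    rw [hφv]
    dsimp only
    rw [Atest_self _ _ _ _ _ hx1, hα0, hK1]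
  have ew : φw η' = w η' := by
    rw [hφw]
    dsimp only [id]
    rw [Atest_self _ _ _ _ _ hx2]; ring
  have Fv : Fop L φv η ∈ closure S := by
    refine hsub η hηΩ (by linarith [hw1 η' hη']) φv
      ((Hf_contDiff δ β).comp (Atest_contDiff _ _ _ _ _ _)) ev.symm ?_
    filter_upwards [J1] with z hz hzK
    have h1 := hz hzK
    have h2 : Kf (v z) ≤ Atest α τ (hmul x (hinv η)) x p1 B1 z := by
      simp only [Atest]; linarith
    rw [← hK1 (v z)]
    exact (Hf_strictMono hδ hβ0).monotone h2
  have Fw : Fop L φw η' ∉ S := by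
    refine hsup η' hη'Ω (by linarith [hv2 η hη]) φw
      (Atest_contDiff _ _ _ _ _ _) ew.symm ?_
    filter_upwards [J2] with z hz hzK
    have h1 := hz hzK
    simp only [hφw, Atest, id, _root_.neg_apply]
    linarith
  apply Fw
  -- Hp
  obtain ⟨Hp, hHpd⟩ : ∃ Hp, Hp = Hf1 δ β (Kf (v η)) := ⟨_, rfl⟩
  have hu1 : -R ≤ Kf (v η) := (hv1 η hη).trans (hK2 _)
  have hu2 : Kf (v η) ≤ R := by linarith [hKb η hη, hv2 η hη]
  have hexp1 : Real.exp (-(β * Kf (v η))) ≤ Real.exp (β * R) := Real.exp_le_exp.2 (by nlinarith)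
  have hexp2 : Real.exp (-(β * R)) ≤ Real.exp (-(β * Kf (v η))) := Real.exp_le_exp.2 (by nlinarith)
  have hδβ : 0 < δ * β := by positivity
  have hHpge : 1 + 2 * γ ≤ Hp := by
    rw [hHpd, Hf1, hγd]
    have := mul_le_mul_of_nonneg_left hexp2 hδβ.le
    linarith
  have hHp2 : Hp ≤ 2 := by
    rw [hHpd, Hf1]
    have := mul_le_mul_of_nonneg_left hexp1 hδβ.le
    linarith
  have hHp1 : 1 < Hp := by linarith
  have hγ : γ ≤ 1 - 1 / Hp := by
    have h1 : 1 - 1 / Hp = (Hp - 1) / Hp := by field_simp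
    rw [h1, le_div_iff₀ (by linarith)]
    nlinarith
  have hΛz : 2 * pnorm (hz η) ≤ Λ := by
    have h1 : pnorm (hz η) ^ 2 ≤ Zb := by rw [pnorm_sq, ← zsq_eq]; exact hzb η hη
    rw [hΛd]
    nlinarith [sq_nonneg (pnorm (hz η) - 1), sq_nonneg (pnorm (hz η))]
  have hxM : ‖x‖ ≤ M + 1 := by
    have : x = (x - η) + η := by abel
    rw [this]
    exact (norm_add_le _ _).trans (by linarith [hM η hη])
  have jv := fun e => test_jet (G := Hf δ β) (G1 := Hf1 δ β) (G2 := -(β * (Hp - 1))) (Hf_contDiff δ β)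
    (Hf_deriv δ β) α τ (hmul x (hinv η)) x η hx1 p1 B1
    (by rw [hα0, hHpd]; exact Hf1_deriv δ β _) e
  have jw := fun e => test_jet (G := id) (G1 := fun _ => 1) (G2 := 0) contDiff_id
    (fun u => hasDerivAt_id u) (w η') 0 (hmul x (hinv η')) x η' hx2 (-p2) (-B2)
    (hasDerivAt_const _ _) e
  rw [hα0, ← hHpd] at jv
  have hfin := point_ineq (R := R) (θb := θb) (Λ := Λ) (M := M + 1) (β := β) (γ := γ) (τ := τ) (ε := ε)
    (ρ := 2 * ρ) (s := s) (Hp := Hp) (x := x) (φv := φv) (φw := φw) (p1 := p1) (p2 := p2) (B1 := B1)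
    (B2 := B2) hΩopen hLlip hm hC hC3 hC4
    H33 H34 H35 hηΩ hη'Ω hxM hHp1 hHp2 hγ0 hγ hβ hτ hΛz
    (fun θ h0 h1 => ⟨h1.trans hτ1, Hθ θ h0 (h1.trans hτ2)⟩)
    (by rw [ev, abs_le]; exact ⟨hv1 η hη, by linarith [hv2 η hη]⟩)
    (by rw [ew, abs_le]; exact ⟨by linarith [hw1 η' hη'], hw2 η' hη'⟩) hε.le
    (by rw [ev, ew]; exact Hρb η hη η' hη' (by linarith)) hseg hdist hp hB
    (fun e => (jv e).1) (fun e => (jv e).2)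
    (fun e => by rw [hφw, (jw e).1]; simp)
    (fun e => by rw [hφw, (jw e).2]; simp)
    (by rw [← hTd]; exact c1) (by rw [hεd]; exact le_of_eq (by field_simp)) hρ4
    (by rw [← hTd]; exact c4) (by rw [← hTd]; exact c5) (by rw [← hTd]; exact c6)
  have hHp0 : 0 < Hp := by linarith
  exact closure_add_pos hSsymm hSpos
    (closure_scale hScone Fv (c := 1 / Hp) (by positivity) (by rw [div_lt_one hHp0]; exact hHp1))
    (Fop_symm hLsymm _ _) (d := τ / 2) (by positivity) hfin
end

/-- Principle of propagation of touching points for general operators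
satisfying the structural conditions (3.3)-(3.5). -/
theorem propagation_of_touching_points_general
    {n : ℕ} (hn : 1 ≤ n)
    (Ω : Set (Heis n)) (hΩopen : IsOpen Ω) (hΩne : Ω.Nonempty)
    (hΩbdd : Bornology.IsBounded Ω)
    (L : Heis n → ℝ → (HIdx n → ℝ) → HMat n)
    (hLsymm : ∀ ξ s p, (L ξ s p).IsSymm)
    (hLlip : ∀ i j : HIdx n, LocallyLipschitzOnSet
      (Ω ×ˢ (Set.univ : Set (ℝ × (HIdx n → ℝ))))
      (fun q : Heis n × ℝ × (HIdx n → ℝ) => L q.1 q.2.1 q.2.2 i j))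
    (m : ℝ) (hm : 1 < m)
    (h33 : Cond33 Ω L m) (h34 : Cond34 Ω L m) (h35 : Cond35 Ω L m)
    (S : Set (HMat n)) (hSne : S.Nonempty) (hSsymm : ∀ A ∈ S, A.IsSymm)
    (hSopen : RelOpen S)
    (hSpos : ∀ A ∈ S, ∀ B : HMat n, B.PosDef → A + B ∈ S)
    (hScone : ∀ A ∈ S, ∀ c : ℝ, 0 < c → c < 1 → c • A ∈ S)
    (w v : Heis n → EReal)
    (hw : LSCFun (closure Ω) w) (hv : USCFun (closure Ω) v)
    (hwsuper : IsSupersolution Ω L S w)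
    (hvsub : IsSubsolution Ω L S v)
    (hge : ∀ ξ ∈ Ω, v ξ ≤ w ξ)
    (hbdry : ∀ ξ ∈ frontier Ω, v ξ < w ξ) :
    ∀ ξ ∈ Ω, v ξ < w ξ := by
  intro ξs hξs
  by_contra hcon
  have hcon' : w ξs ≤ v ξs := not_lt.1 hcon
  have hK : IsCompact (closure Ω) := hΩbdd.isCompact_closure
  obtain ⟨Rv, hRv0, hRv⟩ := bound_v hK hv
  obtain ⟨Rw, hRw0, hRw⟩ := bound_w hK hw
  have hA : ∀ ξ ∈ closure Ω, v ξ ≤ ((max Rv Rw : ℝ) : EReal) := fun ξ hξ =>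
    (hRv ξ hξ).trans (EReal.coe_le_coe_iff.2 (le_max_left _ _))
  have hB : ∀ ξ ∈ closure Ω, ((-(max Rv Rw) : ℝ) : EReal) ≤ w ξ := fun ξ hξ =>
    le_trans (EReal.coe_le_coe_iff.2 (neg_le_neg (le_max_right _ _))) (hRw ξ hξ)
  have hR0 : 0 ≤ max Rv Rw := hRv0.trans (le_max_left _ _)
  generalize max Rv Rw = R0 at hA hB hR0
  have hA' : ∀ ξ ∈ closure Ω, v ξ ≤ ((R0 + 2 : ℝ) : EReal) := fun ξ hξ =>
    (hA ξ hξ).trans (EReal.coe_le_coe_iff.2 (by linarith))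
  have hB' : ∀ ξ ∈ closure Ω, ((-(R0 + 2) : ℝ) : EReal) ≤ w ξ := fun ξ hξ =>
    le_trans (EReal.coe_le_coe_iff.2 (by linarith)) (hB ξ hξ)
  obtain ⟨vb, hvb, hvbu, hvbs⟩ := trunc_v hv hvsub (R0 + 2) hA' (by linarith)
  obtain ⟨wb, hwb, hwbl, hwbs⟩ := trunc_w hw hwsuper (R0 + 2) hB' (by linarith)
  have hle : ∀ ξ ∈ closure Ω, v ξ ≤ w ξ := by
    intro ξ hξ
    by_cases h : ξ ∈ Ω
    · exact hge ξ h
    · exact (hbdry ξ ⟨hξ, by rwa [hΩopen.interior_eq]⟩).le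
  refine core Ω hΩopen hΩbdd L hLsymm hLlip m hm h33 h34 h35 S hSsymm hSpos hScone wb vb
    (R0 + 2) (by linarith) hwbl hvbu ?_ ?_ ?_ ?_ ?_ ?_ hvbs hwbs ξs (subset_closure hξs) ?_
  · intro ξ hξ
    rw [← EReal.coe_le_coe_iff, hvb ξ hξ]
    exact le_max_right _ _
  · intro ξ hξ
    rw [← EReal.coe_le_coe_iff, hvb ξ hξ]
    refine max_le ((hA ξ hξ).trans (EReal.coe_le_coe_iff.2 (by linarith)))
      (EReal.coe_le_coe_iff.2 (by linarith))
  · intro ξ hξ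
    rw [← EReal.coe_le_coe_iff, hwb ξ hξ]
    refine le_min (le_trans (EReal.coe_le_coe_iff.2 (by linarith)) (hB ξ hξ))
      (EReal.coe_le_coe_iff.2 (by linarith))
  · intro ξ hξ
    rw [← EReal.coe_le_coe_iff, hwb ξ hξ]
    exact min_le_right _ _
  · intro ξ hξ
    rw [← EReal.coe_le_coe_iff, hvb ξ hξ, hwb ξ hξ]
    exact max_le (le_min (hle ξ hξ) (hA' ξ hξ))
      (le_min (hB' ξ hξ) (EReal.coe_le_coe_iff.2 (by linarith)))
  · intro ξ hξf
    have hξ : ξ ∈ closure Ω := hξf.1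
    rw [← EReal.coe_lt_coe_iff, hvb ξ hξ, hwb ξ hξ]
    exact max_lt
      (lt_min (hbdry ξ hξf) (lt_of_le_of_lt (hA ξ hξ) (EReal.coe_lt_coe_iff.2 (by linarith))))
      (lt_min (lt_of_lt_of_le (EReal.coe_lt_coe_iff.2 (by linarith)) (hB ξ hξ))
        (EReal.coe_lt_coe_iff.2 (by linarith)))
  · have hξ : ξs ∈ closure Ω := subset_closure hξs
    rw [← EReal.coe_le_coe_iff, hvb ξs hξ, hwb ξs hξ]
    exact (min_le_left _ _).trans (hcon'.trans (le_max_left _ _))
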